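/- arXiv:2506.03776 — 2 statements merged into one kernel-verified Lean document; each statement's English description precedes it below -/
import Mathlib

section
/- For every dimension n ≥ 2 and every s ∈ (0,1) there exists a constant C > 0, depending only on n and s, such that for every bounded convex set E ⊆ ℝⁿ with nonempty interior one has λ₀(E) ≤ C·√(δ_s(E)). -/
open MeasureTheory Metric Bornology
open scoped ENNReal symmDiff

/-- The fractional `s`-perimeter of a set `E ⊆ ℝⁿ`:
`P_s(E) = ∫_E ∫_{Eᶜ} |x - y|^{-(n+s)} dx dy`. -/
noncomputable def fracPer (n : ℕ) (s : ℝ) (E : Set (EuclideanSpace ℝ (Fin n))) : ℝ≥0∞ :=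
  ∫⁻ x in E, ∫⁻ y in Eᶜ, ENNReal.ofReal (‖x - y‖ ^ (-((n : ℝ) + s)))

/-- The radius of the ball centered at the origin with the same volume as `E`. -/
noncomputable def matchRad (n : ℕ) (E : Set (EuclideanSpace ℝ (Fin n))) : ℝ :=
  ((volume E).toReal / (volume (ball (0 : EuclideanSpace ℝ (Fin n)) 1)).toReal) ^ ((1 : ℝ) / n)

/-- The `s`-isoperimetric deficit `δ_s(E) = (P_s(E) - P_s(B(m)))/P_s(B(m))`, where `B(m)` is the
ball centered at the origin with `|B(m)| = |E|`. -/
noncomputable def sDeficit (n : ℕ) (s : ℝ) (E : Set (EuclideanSpace ℝ (Fin n))) : ℝ :=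
  ((fracPer n s E).toReal
      - (fracPer n s (ball (0 : EuclideanSpace ℝ (Fin n)) (matchRad n E))).toReal)
    / (fracPer n s (ball (0 : EuclideanSpace ℝ (Fin n)) (matchRad n E))).toReal

/-- The barycenter `bar(E) = (1/|E|) ∫_E x dx`. -/
noncomputable def barycenter (n : ℕ) (E : Set (EuclideanSpace ℝ (Fin n))) :
    EuclideanSpace ℝ (Fin n) :=
  ((volume E).toReal)⁻¹ • ∫ x in E, x

/-- The barycentric asymmetry `λ₀(E) = |E ∆ (bar(E) + B(m))| / |E|`. -/
noncomputable def barAsym (n : ℕ) (E : Set (EuclideanSpace ℝ (Fin n))) : ℝ :=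
  (volume (E ∆ ball (barycenter n E) (matchRad n E))).toReal / (volume E).toReal

section FractionalPerimeter

variable {n : ℕ} {s : ℝ}

/-- The kernel of the fractional perimeter. -/
noncomputable def fracKer (n : ℕ) (s : ℝ) (x y : EuclideanSpace ℝ (Fin n)) : ℝ≥0∞ :=
  ENNReal.ofReal (‖x - y‖ ^ (-((n : ℝ) + s)))

theorem measurable_fracKer :
    Measurable fun p : EuclideanSpace ℝ (Fin n) × EuclideanSpace ℝ (Fin n) =>
      fracKer n s p.1 p.2 := by
  unfold fracKer
  fun_prop

theorem measurable_fracKer_right (x : EuclideanSpace ℝ (Fin n)) : Measurable (fracKer n s x) := by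
  unfold fracKer
  fun_prop

theorem fracKer_comm (x y : EuclideanSpace ℝ (Fin n)) : fracKer n s x y = fracKer n s y x := by
  simp only [fracKer, norm_sub_rev]

theorem fracKer_eq_dist (x y : EuclideanSpace ℝ (Fin n)) :
    fracKer n s x y = ENNReal.ofReal (dist x y ^ (-((n : ℝ) + s))) := by
  rw [fracKer, dist_eq_norm]

/-- The interaction energy of two sets. -/
noncomputable def interaction (n : ℕ) (s : ℝ) (A B : Set (EuclideanSpace ℝ (Fin n))) : ℝ≥0∞ :=
  ∫⁻ x in A, ∫⁻ y in B, fracKer n s x y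

theorem fracPer_eq_interaction (E : Set (EuclideanSpace ℝ (Fin n))) :
    fracPer n s E = interaction n s E Eᶜ := rfl

theorem measurable_lintegral_fracKer (B : Set (EuclideanSpace ℝ (Fin n))) :
    Measurable fun x => ∫⁻ y in B, fracKer n s x y :=
  Measurable.lintegral_prod_right' (f := fun p => fracKer n s p.1 p.2) measurable_fracKer

theorem interaction_union_left {A A' : Set (EuclideanSpace ℝ (Fin n))} (hA' : MeasurableSet A')
    (h : Disjoint A A') (B : Set (EuclideanSpace ℝ (Fin n))) :
    interaction n s (A ∪ A') B = interaction n s A B + interaction n s A' B :=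
  lintegral_union hA' h

theorem interaction_comm (A B : Set (EuclideanSpace ℝ (Fin n))) :
    interaction n s A B = interaction n s B A := by
  unfold interaction
  rw [lintegral_lintegral_swap measurable_fracKer.aemeasurable]
  simp only [fracKer_comm]

theorem interaction_union_right (A : Set (EuclideanSpace ℝ (Fin n)))
    {B B' : Set (EuclideanSpace ℝ (Fin n))} (hB' : MeasurableSet B') (h : Disjoint B B') :
    interaction n s A (B ∪ B') = interaction n s A B + interaction n s A B' := by
  rw [interaction_comm, interaction_union_left hB' h, interaction_comm B, interaction_comm B']

theorem interaction_mono {A A' B B' : Set (EuclideanSpace ℝ (Fin n))} (h : A ⊆ A') (h' : B ⊆ B') :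
    interaction n s A B ≤ interaction n s A' B' :=
  (lintegral_mono_set h).trans (lintegral_mono fun _ => lintegral_mono_set h')

/-- An isometric involution preserving the volume, with a fundamental domain `H` off its fixed
points. Hyperplane reflections are the model. -/
structure IsReflection (σ : EuclideanSpace ℝ (Fin n) → EuclideanSpace ℝ (Fin n))
    (H : Set (EuclideanSpace ℝ (Fin n))) : Prop where
  isometry : Isometry σ
  involutive : Function.Involutive σ
  measurePreserving : MeasurePreserving σ volume volume
  measurableSet : MeasurableSet H
  mem_iff : ∀ x, σ x ≠ x → (x ∈ H ↔ σ x ∉ H)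
  dist_le : ∀ x ∈ H, ∀ y ∈ H, dist x y ≤ dist x (σ y)

/-- The points of `F ∩ H` whose mirror image is not in `F`. -/
def oddPart (σ : EuclideanSpace ℝ (Fin n) → EuclideanSpace ℝ (Fin n))
    (H F : Set (EuclideanSpace ℝ (Fin n))) : Set (EuclideanSpace ℝ (Fin n)) :=
  {x | x ∈ H ∧ x ∈ F ∧ σ x ∉ F}

/-- The two-point rearrangement of `F` towards `H`. -/
def polarize (σ : EuclideanSpace ℝ (Fin n) → EuclideanSpace ℝ (Fin n))
    (H F : Set (EuclideanSpace ℝ (Fin n))) : Set (EuclideanSpace ℝ (Fin n)) :=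
  (F ∩ σ ⁻¹' F) ∪ (oddPart σ H F ∪ oddPart σ H Fᶜ)

namespace IsReflection

variable {σ : EuclideanSpace ℝ (Fin n) → EuclideanSpace ℝ (Fin n)}
  {H F : Set (EuclideanSpace ℝ (Fin n))}

theorem measurable (h : IsReflection σ H) : Measurable σ := h.measurePreserving.measurable

theorem preimage_preimage (h : IsReflection σ H) (A : Set (EuclideanSpace ℝ (Fin n))) :
    σ ⁻¹' (σ ⁻¹' A) = A := by
  ext x; simp [h.involutive x]

theorem setLIntegral_preimage (h : IsReflection σ H) {A : Set (EuclideanSpace ℝ (Fin n))}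
    (hA : MeasurableSet A) {f : EuclideanSpace ℝ (Fin n) → ℝ≥0∞} (hf : Measurable f) :
    ∫⁻ x in σ ⁻¹' A, f x = ∫⁻ x in A, f (σ x) := by
  have := h.measurePreserving.setLIntegral_comp_preimage (h.measurable hA) hf
  rw [h.preimage_preimage] at this
  exact this.symm

theorem interaction_preimage (h : IsReflection σ H) {A B : Set (EuclideanSpace ℝ (Fin n))}
    (hA : MeasurableSet A) (hB : MeasurableSet B) :
    interaction n s (σ ⁻¹' A) (σ ⁻¹' B) = interaction n s A B := by
  unfold interaction
  rw [h.setLIntegral_preimage hA (measurable_lintegral_fracKer _)]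
  refine lintegral_congr fun x => ?_
  rw [h.setLIntegral_preimage hB (measurable_fracKer_right _)]
  simp only [fracKer_eq_dist, h.isometry.dist_eq]

theorem measurableSet_oddPart (h : IsReflection σ H) (hF : MeasurableSet F) :
    MeasurableSet (oddPart σ H F) :=
  h.measurableSet.inter (hF.inter (h.measurable hF).compl)

theorem measurableSet_polarize (h : IsReflection σ H) (hF : MeasurableSet F) :
    MeasurableSet (polarize σ H F) :=
  (hF.inter (h.measurable hF)).union
    ((h.measurableSet_oddPart hF).union (h.measurableSet_oddPart hF.compl))

theorem eq_union (h : IsReflection σ H) :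
    F = (F ∩ σ ⁻¹' F) ∪ (oddPart σ H F ∪ σ ⁻¹' oddPart σ H Fᶜ) := by
  ext x
  have h1 := h.mem_iff x
  have h2 := h.involutive x
  simp only [oddPart, Set.mem_union, Set.mem_inter_iff, Set.mem_preimage, Set.mem_ofPred_eq,
    Set.mem_compl_iff, h2]
  by_cases hx : σ x = x
  · simp only [hx]; tauto
  · have := h1 hx; tauto

theorem compl_polarize (h : IsReflection σ H) :
    (polarize σ H F)ᶜ = (Fᶜ ∩ σ ⁻¹' Fᶜ) ∪ (σ ⁻¹' oddPart σ H F ∪ σ ⁻¹' oddPart σ H Fᶜ) := by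
  ext x
  have h1 := h.mem_iff x
  have h2 := h.involutive x
  simp only [polarize, oddPart, Set.mem_union, Set.mem_inter_iff, Set.mem_preimage,
    Set.mem_ofPred_eq, Set.mem_compl_iff, h2]
  by_cases hx : σ x = x
  · simp only [hx]; tauto
  · have := h1 hx; tauto

theorem interaction_oddPart (h : IsReflection σ H) (hF : MeasurableSet F)
    (hs : 0 < (n : ℝ) + s) :
    interaction n s (oddPart σ H F) (oddPart σ H Fᶜ) =
      interaction n s (oddPart σ H F) (σ ⁻¹' oddPart σ H Fᶜ) + ∫⁻ x in oddPart σ H F,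
        ∫⁻ y in oddPart σ H Fᶜ, (fracKer n s x y - fracKer n s x (σ y)) := by
  unfold interaction
  rw [← lintegral_add_left (measurable_lintegral_fracKer _)]
  refine setLIntegral_congr_fun (h.measurableSet_oddPart hF) fun x hx => ?_
  have hm : Measurable fun y => fracKer n s x (σ y) :=
    (measurable_fracKer_right x).comp h.measurable
  beta_reduce
  rw [h.setLIntegral_preimage (h.measurableSet_oddPart hF.compl) (measurable_fracKer_right x),
    ← lintegral_add_left hm]
  refine setLIntegral_congr_fun (h.measurableSet_oddPart hF.compl) fun y hy => ?_
  have hxy : x ≠ y := by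
    rintro rfl
    exact hy.2.1 hx.2.1
  refine (add_tsub_cancel_of_le ?_).symm
  rw [fracKer_eq_dist, fracKer_eq_dist]
  exact ENNReal.ofReal_le_ofReal (Real.rpow_le_rpow_of_nonpos (dist_pos.2 hxy)
    (h.dist_le x hx.1 y hy.1) (by linarith))

/-- The fractional perimeter decreases under polarization, with an explicit gain. -/
theorem fracPer_eq_fracPer_polarize_add (h : IsReflection σ H) (hF : MeasurableSet F)
    (hs : 0 < (n : ℝ) + s) :
    fracPer n s F = fracPer n s (polarize σ H F) + 2 * ∫⁻ x in oddPart σ H F,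
      ∫⁻ y in oddPart σ H Fᶜ, (fracKer n s x y - fracKer n s x (σ y)) := by
  set A := oddPart σ H F with hA
  set A' := oddPart σ H Fᶜ with hA'
  set S := F ∩ σ ⁻¹' F with hS
  set U := Fᶜ ∩ σ ⁻¹' Fᶜ with hU
  have mA : MeasurableSet A := h.measurableSet_oddPart hF
  have mA' : MeasurableSet A' := h.measurableSet_oddPart hF.compl
  have mS : MeasurableSet S := hF.inter (h.measurable hF)
  have mU : MeasurableSet U := hF.compl.inter (h.measurable hF.compl)
  have mσA : MeasurableSet (σ ⁻¹' A) := h.measurable mA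
  have mσA' : MeasurableSet (σ ⁻¹' A') := h.measurable mA'
  have hσS : σ ⁻¹' S = S := by
    rw [hS, Set.preimage_inter, h.preimage_preimage, Set.inter_comm]
  have hσU : σ ⁻¹' U = U := by
    rw [hU, Set.preimage_inter, h.preimage_preimage, Set.inter_comm]
  have hF1 : F = S ∪ (A ∪ σ ⁻¹' A') := h.eq_union
  have hF2 : Fᶜ = U ∪ (A' ∪ σ ⁻¹' A) := by
    have := h.eq_union (F := Fᶜ)
    rwa [compl_compl] at this
  have hP1 : polarize σ H F = S ∪ (A ∪ A') := rfl
  have hP2 : (polarize σ H F)ᶜ = U ∪ (σ ⁻¹' A ∪ σ ⁻¹' A') := h.compl_polarize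
  have gain := h.interaction_oddPart (s := s) hF hs
  have d1 : Disjoint S (A ∪ σ ⁻¹' A') := by
    rw [Set.disjoint_left]
    rintro x ⟨h1, h2⟩ (h3 | h3)
    · exact h3.2.2 h2
    · exact h3.2.1 h2
  have d2 : Disjoint A (σ ⁻¹' A') := by
    rw [Set.disjoint_left]
    intro x h1 h2
    have hne : σ x ≠ x := fun e => h1.2.2 (e.symm ▸ h1.2.1)
    exact (h.mem_iff x hne).1 h1.1 h2.1
  have d3 : Disjoint U (A' ∪ σ ⁻¹' A) := by
    rw [Set.disjoint_left]
    rintro x ⟨h1, h2⟩ (h3 | h3)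
    · exact h3.2.2 h2
    · exact h2 h3.2.1
  have d4 : Disjoint A' (σ ⁻¹' A) := by
    rw [Set.disjoint_left]
    intro x h1 h2
    have hne : σ x ≠ x := fun e => h1.2.2 (e.symm ▸ h1.2.1)
    exact (h.mem_iff x hne).1 h1.1 h2.1
  have d5 : Disjoint A A' := by
    rw [Set.disjoint_left]
    intro x h1 h2
    exact h2.2.1 h1.2.1
  have d6 : Disjoint S (A ∪ A') := by
    rw [Set.disjoint_left]
    rintro x ⟨h1, h2⟩ (h3 | h3)
    · exact h3.2.2 h2
    · exact h3.2.1 h1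
  have d7 : Disjoint (σ ⁻¹' A) (σ ⁻¹' A') := d5.preimage σ
  have d8 : Disjoint U (σ ⁻¹' A ∪ σ ⁻¹' A') := by
    have := d6.preimage σ
    rw [Set.disjoint_left]
    rintro x ⟨h1, h2⟩ (h3 | h3)
    · exact h2 h3.2.1
    · exact h3.2.2 (by simpa [h.involutive x] using h1)
  have e1 : interaction n s S (σ ⁻¹' A') = interaction n s S A' := by
    conv_lhs => rw [← hσS]
    exact h.interaction_preimage mS mA'
  have e2 : interaction n s (σ ⁻¹' A') U = interaction n s A' U := by
    conv_lhs => rw [← hσU]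
    exact h.interaction_preimage mA' mU
  have e3 : interaction n s (σ ⁻¹' A') (σ ⁻¹' A) = interaction n s A A' := by
    rw [h.interaction_preimage mA' mA, interaction_comm]
  have e4 : interaction n s A' (σ ⁻¹' A) = interaction n s A (σ ⁻¹' A') := by
    rw [← h.interaction_preimage mA' mσA, h.preimage_preimage, interaction_comm]
  have e5 : interaction n s (σ ⁻¹' A') A' = interaction n s A' (σ ⁻¹' A') := interaction_comm _ _
  rw [fracPer_eq_interaction, fracPer_eq_interaction, hF2, hP2, hP1]
  conv_lhs => rw [hF1]
  rw [interaction_union_left (mA.union mσA') d1, interaction_union_left mσA' d2,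
    interaction_union_left (mA.union mA') d6, interaction_union_left mA' d5]
  simp only [interaction_union_right _ (mA'.union mσA) d3, interaction_union_right _ mσA d4,
    interaction_union_right _ (mσA.union mσA') d8, interaction_union_right _ mσA' d7]
  rw [e1, e2, e3, e4, e5, gain]
  ring

theorem fracPer_polarize_le (h : IsReflection σ H) (hF : MeasurableSet F)
    (hs : 0 < (n : ℝ) + s) : fracPer n s (polarize σ H F) ≤ fracPer n s F := by
  rw [h.fracPer_eq_fracPer_polarize_add hF hs]
  exact le_self_add

theorem volume_polarize (h : IsReflection σ H) (hF : MeasurableSet F) :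
    volume (polarize σ H F) = volume F := by
  have mA : MeasurableSet (oddPart σ H F) := h.measurableSet_oddPart hF
  have mA' : MeasurableSet (oddPart σ H Fᶜ) := h.measurableSet_oddPart hF.compl
  conv_rhs => rw [h.eq_union (F := F)]
  rw [polarize, measure_union _ (mA.union mA'), measure_union _ mA',
    measure_union _ (mA.union (h.measurable mA')), measure_union _ (h.measurable mA'),
    h.measurePreserving.measure_preimage mA'.nullMeasurableSet]
  all_goals rw [Set.disjoint_left]
  · intro x h1 h2
    have hne : σ x ≠ x := fun e => h1.2.2 (e.symm ▸ h1.2.1)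
    exact (h.mem_iff x hne).1 h1.1 h2.1
  · rintro x ⟨h1, h2⟩ (h3 | h3)
    · exact h3.2.2 h2
    · exact h3.2.1 h2
  · intro x h1 h2
    exact h2.2.1 h1.2.1
  · rintro x ⟨h1, h2⟩ (h3 | h3)
    · exact h3.2.2 h2
    · exact h3.2.1 h1

end IsReflection

/-- The reflection across the hyperplane `{x | ⟪x, v⟫ = c}`. -/
noncomputable def hypRefl (v : EuclideanSpace ℝ (Fin n)) (c : ℝ) (x : EuclideanSpace ℝ (Fin n)) :
    EuclideanSpace ℝ (Fin n) :=
  x - (2 * (inner ℝ x v - c) / ‖v‖ ^ 2) • v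

theorem inner_hypRefl {v : EuclideanSpace ℝ (Fin n)} (hv : v ≠ 0) (c : ℝ)
    (x : EuclideanSpace ℝ (Fin n)) : inner ℝ (hypRefl v c x) v = 2 * c - inner ℝ x v := by
  have : ‖v‖ ≠ 0 := norm_ne_zero_iff.2 hv
  rw [hypRefl, inner_sub_left, inner_smul_left, real_inner_self_eq_norm_sq]
  simp only [conj_trivial]
  field_simp
  ring

theorem hypRefl_eq_reflection (v : EuclideanSpace ℝ (Fin n)) (c : ℝ)
    (x : EuclideanSpace ℝ (Fin n)) :
    hypRefl v c x = (ℝ ∙ v)ᗮ.reflection x + (2 * c / ‖v‖ ^ 2) • v := by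
  rw [Submodule.reflection_orthogonal_apply, Submodule.reflection_singleton_apply, hypRefl,
    real_inner_comm]
  simp only [RCLike.ofReal_real_eq_id, id_eq]
  module

theorem hypRefl_eq_comp (v : EuclideanSpace ℝ (Fin n)) (c : ℝ) :
    hypRefl v c = (fun x => x + (2 * c / ‖v‖ ^ 2) • v) ∘ (ℝ ∙ v)ᗮ.reflection := by
  ext1 x
  exact hypRefl_eq_reflection v c x

theorem sq_dist_hypRefl {v : EuclideanSpace ℝ (Fin n)} (hv : v ≠ 0) (c : ℝ)
    (x y : EuclideanSpace ℝ (Fin n)) :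
    dist x (hypRefl v c y) ^ 2 =
      dist x y ^ 2 + 4 * (inner ℝ x v - c) * (inner ℝ y v - c) / ‖v‖ ^ 2 := by
  have : ‖v‖ ≠ 0 := norm_ne_zero_iff.2 hv
  have e : x - hypRefl v c y = (x - y) + (2 * (inner ℝ y v - c) / ‖v‖ ^ 2) • v := by
    rw [hypRefl]; abel
  rw [dist_eq_norm, dist_eq_norm, e, norm_add_sq_real, inner_smul_right, inner_sub_left,
    norm_smul, mul_pow, Real.norm_eq_abs, sq_abs]
  field_simp
  ring

theorem isReflection_hypRefl {v : EuclideanSpace ℝ (Fin n)} (hv : v ≠ 0) (c : ℝ) :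
    IsReflection (hypRefl v c) {x | c < inner ℝ x v} where
  isometry := by
    rw [hypRefl_eq_comp]
    exact (IsometryEquiv.addRight _).isometry.comp (LinearIsometryEquiv.isometry _)
  involutive x := by
    conv_lhs => rw [hypRefl, inner_hypRefl hv, hypRefl]
    module
  measurePreserving := by
    rw [hypRefl_eq_comp]
    exact (measurePreserving_add_right _ _).comp (LinearIsometryEquiv.measurePreserving _)
  measurableSet := measurableSet_lt measurable_const (by fun_prop)
  mem_iff x hx := by
    have : inner ℝ x v ≠ c := by
      intro h
      apply hx
      rw [hypRefl, h]
      simp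
    simp only [Set.mem_ofPred_eq, inner_hypRefl hv]
    rcases lt_or_gt_of_ne this with h | h
    · constructor <;> intro _ <;> linarith
    · constructor
      · intro _; linarith
      · intro _; exact h
  dist_le x hx y hy := by
    have := sq_dist_hypRefl hv c x y
    simp only [Set.mem_ofPred_eq] at hx hy
    have h2 : 0 ≤ 4 * (inner ℝ x v - c) * (inner ℝ y v - c) / ‖v‖ ^ 2 := by
      have := sub_pos.2 hx
      have := sub_pos.2 hy
      positivity
    exact le_of_sq_le_sq (by linarith) dist_nonneg

/-- A Lipschitz map increases the volume at most by a power of its Lipschitz constant. -/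
theorem volume_image_le_of_lipschitzOnWith {f : EuclideanSpace ℝ (Fin n) → EuclideanSpace ℝ (Fin n)}
    {K : NNReal} {S : Set (EuclideanSpace ℝ (Fin n))} (h : LipschitzOnWith K f S) :
    volume (f '' S) ≤ (K : ℝ≥0∞) ^ n * volume S := by
  have := h.hausdorffMeasure_image_le (d := n) (by positivity)
  rw [ENNReal.rpow_natCast] at this
  have e := Measure.isAddLeftInvariant_eq_smul (volume : Measure (EuclideanSpace ℝ (Fin n)))
    (Measure.hausdorffMeasure (n : ℝ))
  rw [e]
  simp only [Measure.smul_apply, smul_eq_mul, ENNReal.smul_def]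
  calc _ ≤ _ := mul_le_mul_right this _
    _ = _ := by ring

/-- Disjoint translates of a set inside another one. -/
theorem natCast_mul_volume_le {S Y : Set (EuclideanSpace ℝ (Fin n))} (hS : MeasurableSet S)
    (w : EuclideanSpace ℝ (Fin n)) (N : ℕ)
    (hY : ∀ k < N, ∀ x ∈ S, x + (k : ℝ) • w ∈ Y)
    (hd : ∀ k < N, ∀ l < N, ∀ x ∈ S, ∀ y ∈ S, x + (k : ℝ) • w = y + (l : ℝ) • w → k = l) :
    N * volume S ≤ volume Y := by
  have hm : ∀ k : ℕ, MeasurableSet ((fun x => x + -((k : ℝ) • w)) ⁻¹' S) := fun k =>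
    (measurable_add_const _) hS
  have hv : ∀ k : ℕ, volume ((fun x => x + -((k : ℝ) • w)) ⁻¹' S) = volume S := fun k =>
    measure_preimage_add_right _ _ _
  calc N * volume S = ∑ k ∈ Finset.range N, volume ((fun x => x + -((k : ℝ) • w)) ⁻¹' S) := by
        simp [hv]
    _ = volume (⋃ k ∈ Finset.range N, (fun x => x + -((k : ℝ) • w)) ⁻¹' S) := by
        refine (measure_biUnion_finset ?_ fun k _ => hm k).symm
        intro k hk l hl hkl
        simp only [Finset.coe_range, Set.mem_Iio] at hk hl
        change Disjoint _ _
        rw [Set.disjoint_left]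
        intro x h1 h2
        exact hkl (hd k hk l hl _ h1 _ h2 (by simp))
    _ ≤ volume Y := by
        refine measure_mono fun x hx => ?_
        simp only [Finset.mem_range, Set.mem_iUnion, Set.mem_preimage, exists_prop] at hx
        obtain ⟨k, hk, hx⟩ := hx
        simpa using hY k hk _ hx

namespace IsReflection

variable {σ : EuclideanSpace ℝ (Fin n) → EuclideanSpace ℝ (Fin n)}
  {H F : Set (EuclideanSpace ℝ (Fin n))}

theorem polarize_subset_closedBall (hH : ∀ x ∈ H, ‖x‖ ≤ ‖σ x‖) {R : ℝ}
    (hF : F ⊆ closedBall 0 R) : polarize σ H F ⊆ closedBall 0 R := by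
  rintro x (hx | hx | hx)
  · exact hF hx.1
  · exact hF hx.2.1
  · have h1 : σ x ∈ F := not_not.1 hx.2.2
    have h2 := hF h1
    rw [mem_closedBall_zero_iff] at h2 ⊢
    exact (hH x hx.1).trans h2

theorem volume_ball_diff_polarize_add_le (h : IsReflection σ H) (hH : ∀ x ∈ H, ‖x‖ ≤ ‖σ x‖)
    (hF : MeasurableSet F) (r : ℝ) :
    volume (ball 0 r \ polarize σ H F) + volume {w | w ∈ ball 0 r \ F ∧ σ w ∈ F \ ball 0 r} ≤
      volume (ball 0 r \ F) := by
  set P := polarize σ H F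
  set W : Set (EuclideanSpace ℝ (Fin n)) := {w | w ∈ ball 0 r \ F ∧ σ w ∈ F \ ball 0 r}
  have mP : MeasurableSet P := h.measurableSet_polarize hF
  have mW : MeasurableSet W :=
    (measurableSet_ball.diff hF).inter (h.measurable (hF.diff measurableSet_ball))
  set X := (ball 0 r \ P) ∩ F
  have mX : MeasurableSet X := (measurableSet_ball.diff mP).inter hF
  have hX : ∀ x ∈ σ ⁻¹' X, x ∈ H ∧ x ∉ F ∧ σ x ∈ F ∧ x ∈ ball 0 r := by
    intro x hx
    obtain ⟨⟨h1, h2⟩, h3⟩ := hx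
    have h4 : σ x ∈ σ ⁻¹' oddPart σ H Fᶜ := by
      have := h3
      rw [h.eq_union (F := F)] at this
      rcases this with t | t | t
      · exact absurd (Or.inl t) h2
      · exact absurd (Or.inr (Or.inl t)) h2
      · exact t
    have h5 : x ∈ oddPart σ H Fᶜ := by simpa [h.involutive x] using h4
    refine ⟨h5.1, h5.2.1, h3, ?_⟩
    rw [mem_ball_zero_iff] at h1 ⊢
    exact (hH x h5.1).trans_lt h1
  have hW : ∀ w ∈ W, w ∈ P := by
    rintro w ⟨⟨h1, h2⟩, h3, h4⟩
    refine Or.inr (Or.inr ⟨?_, h2, not_not.2 h3⟩)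
    by_contra hw
    have hne : σ w ≠ w := fun e => h2 (e ▸ h3)
    have h5 : σ w ∈ H := by
      by_contra h6
      exact hw ((h.mem_iff w hne).2 h6)
    have h7 := hH _ h5
    rw [h.involutive w] at h7
    rw [mem_ball_zero_iff] at h1 h4
    exact h4 (h7.trans_lt h1)
  calc volume (ball 0 r \ P) + volume W
      = volume X + volume ((ball 0 r \ P) \ F) + volume W := by
        rw [measure_inter_add_sdiff _ hF]
    _ = volume (σ ⁻¹' X) + volume ((ball 0 r \ P) \ F) + volume W := by
        rw [h.measurePreserving.measure_preimage mX.nullMeasurableSet]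
    _ = volume (σ ⁻¹' X ∪ (ball 0 r \ P) \ F ∪ W) := by
        rw [measure_union _ mW, measure_union _ ((measurableSet_ball.diff mP).diff hF)]
        · rw [Set.disjoint_left]
          rintro x hx ⟨⟨-, h2⟩, -⟩
          obtain ⟨h3, h4, h5, -⟩ := hX x hx
          exact h2 (Or.inr (Or.inr ⟨h3, h4, not_not.2 h5⟩))
        · rw [Set.disjoint_left]
          rintro x (hx | hx) hw
          · exact hw.2.2 hx.1.1
          · exact hx.1.2 (hW x hw)
    _ ≤ volume (ball 0 r \ F) := by
        refine measure_mono ?_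
        rintro x ((hx | hx) | hx)
        · obtain ⟨-, h4, -, h6⟩ := hX x hx
          exact ⟨h6, h4⟩
        · exact ⟨hx.1.1, hx.2⟩
        · exact hx.1

end IsReflection

/-- The reflection exchanging `0` and `p`. -/
noncomputable def swapRefl (p : EuclideanSpace ℝ (Fin n)) :
    EuclideanSpace ℝ (Fin n) → EuclideanSpace ℝ (Fin n) :=
  hypRefl (-p) (-(‖p‖ ^ 2 / 2))

/-- The half-space of the points that are closer to `0` than to `p`. -/
def swapHalf (p : EuclideanSpace ℝ (Fin n)) : Set (EuclideanSpace ℝ (Fin n)) :=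
  {x | -(‖p‖ ^ 2 / 2) < inner ℝ x (-p)}

theorem isReflection_swapRefl {p : EuclideanSpace ℝ (Fin n)} (hp : p ≠ 0) :
    IsReflection (swapRefl p) (swapHalf p) :=
  isReflection_hypRefl (neg_ne_zero.2 hp) _

theorem norm_le_norm_swapRefl {p : EuclideanSpace ℝ (Fin n)} (hp : p ≠ 0) :
    ∀ x ∈ swapHalf p, ‖x‖ ≤ ‖swapRefl p x‖ := by
  intro x hx
  have h := sq_dist_hypRefl (neg_ne_zero.2 hp) (-(‖p‖ ^ 2 / 2)) 0 x
  rw [dist_zero_left, dist_zero_left, inner_zero_left] at h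
  have h1 : 0 < inner ℝ x (-p) - -(‖p‖ ^ 2 / 2) := sub_pos.2 hx
  have h2 : 0 ≤ 4 * (0 - -(‖p‖ ^ 2 / 2)) * (inner ℝ x (-p) - -(‖p‖ ^ 2 / 2)) / ‖-p‖ ^ 2 := by
    have : (0 : ℝ) ≤ 0 - -(‖p‖ ^ 2 / 2) := by rw [zero_sub, neg_neg]; positivity
    positivity
  refine le_of_sq_le_sq ?_ (norm_nonneg _)
  rw [swapRefl]
  linarith

theorem swapRefl_apply {p : EuclideanSpace ℝ (Fin n)} (hp : p ≠ 0) (x : EuclideanSpace ℝ (Fin n)) :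
    swapRefl p x = x + p - (2 * inner ℝ x p) • ((1 / ‖p‖) ^ 2 • p) := by
  have : ‖p‖ ≠ 0 := norm_ne_zero_iff.2 hp
  have e : 2 * (-inner ℝ x p - -(‖p‖ ^ 2 / 2)) / ‖p‖ ^ 2 =
      1 - 2 * inner ℝ x p * (1 / ‖p‖) ^ 2 := by
    field_simp
    ring
  rw [swapRefl, hypRefl, inner_neg_right, norm_neg, e]
  module

theorem lipschitzOnWith_swapRefl {η : ℝ} (hη : 0 < η) {x : EuclideanSpace ℝ (Fin n)}
    (hx : ‖x‖ ≤ 1) :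
    LipschitzOnWith (Real.toNNReal (1 + 4 / η)) (fun p => swapRefl p x) {p | η ≤ ‖p‖} := by
  refine LipschitzOnWith.of_dist_le_mul fun p hp q hq => ?_
  have hp1 : η ≤ ‖p‖ := hp
  have hq1 : η ≤ ‖q‖ := hq
  have hp2 : 0 < ‖p‖ := hη.trans_le hp1
  have hq2 : 0 < ‖q‖ := hη.trans_le hq1
  have hp0 : p ≠ 0 := norm_pos_iff.1 hp2
  have hq0 : q ≠ 0 := norm_pos_iff.1 hq2
  have hi := dist_div_norm_sq_smul hp0 hq0 1
  rw [Real.coe_toNNReal _ (by positivity)]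
  rw [swapRefl_apply hp0, swapRefl_apply hq0, dist_eq_norm]
  have e : x + p - (2 * inner ℝ x p) • ((1 / ‖p‖) ^ 2 • p) -
      (x + q - (2 * inner ℝ x q) • ((1 / ‖q‖) ^ 2 • q)) =
      (p - q) - (2 * inner ℝ x (p - q)) • ((1 / ‖p‖) ^ 2 • p) -
      (2 * inner ℝ x q) • ((1 / ‖p‖) ^ 2 • p - (1 / ‖q‖) ^ 2 • q) := by
    rw [inner_sub_right]
    module
  rw [e]
  have b1 : ‖(2 * inner ℝ x (p - q)) • ((1 / ‖p‖) ^ 2 • p)‖ ≤ 2 / η * dist p q := by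
    rw [norm_smul, norm_smul, Real.norm_eq_abs, abs_mul, abs_two]
    have h1 : |inner ℝ x (p - q)| ≤ dist p q := by
      refine (abs_real_inner_le_norm _ _).trans ?_
      rw [dist_eq_norm]
      exact mul_le_of_le_one_left (norm_nonneg _) hx
    have h2 : ‖(1 / ‖p‖) ^ 2‖ * ‖p‖ ≤ 1 / η := by
      rw [Real.norm_of_nonneg (by positivity)]
      have : (1 / ‖p‖) ^ 2 * ‖p‖ = 1 / ‖p‖ := by field_simp
      rw [this]
      exact one_div_le_one_div_of_le hη hp1
    calc 2 * |inner ℝ x (p - q)| * (‖(1 / ‖p‖) ^ 2‖ * ‖p‖) ≤ 2 * dist p q * (1 / η) := by gcongr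
      _ = _ := by ring
  have b2 : ‖(2 * inner ℝ x q) • ((1 / ‖p‖) ^ 2 • p - (1 / ‖q‖) ^ 2 • q)‖ ≤ 2 / η * dist p q := by
    rw [norm_smul, Real.norm_eq_abs, abs_mul, abs_two, ← dist_eq_norm, hi]
    have h1 : |inner ℝ x q| ≤ ‖q‖ :=
      (abs_real_inner_le_norm _ _).trans (mul_le_of_le_one_left (norm_nonneg _) hx)
    calc 2 * |inner ℝ x q| * (1 ^ 2 / (‖p‖ * ‖q‖) * dist p q)
        ≤ 2 * ‖q‖ * (1 ^ 2 / (‖p‖ * ‖q‖) * dist p q) := by gcongr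
      _ = 2 / ‖p‖ * dist p q := by field_simp
      _ ≤ 2 / η * dist p q := by gcongr
  calc _ ≤ ‖p - q‖ + ‖(2 * inner ℝ x (p - q)) • ((1 / ‖p‖) ^ 2 • p)‖ +
        ‖(2 * inner ℝ x q) • ((1 / ‖p‖) ^ 2 • p - (1 / ‖q‖) ^ 2 • q)‖ :=
        (norm_sub_le _ _).trans (add_le_add_left (norm_sub_le _ _) _)
    _ ≤ dist p q + 2 / η * dist p q + 2 / η * dist p q := by
        rw [← dist_eq_norm]; gcongr
    _ = _ := by ring

/-- Any two points with different norms are exchanged by a reflection `swapRefl p`. -/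
theorem exists_swapRefl_eq {x y : EuclideanSpace ℝ (Fin n)} (hxy : ‖x‖ < ‖y‖) :
    ∃ p, ‖y‖ - ‖x‖ ≤ ‖p‖ ∧ ‖p‖ ≤ ‖y‖ + ‖x‖ ∧ swapRefl p x = y := by
  have hne : y - x ≠ 0 := by
    rw [sub_ne_zero]
    rintro rfl
    exact lt_irrefl _ hxy
  have hd : 0 < ‖y - x‖ := norm_pos_iff.2 hne
  set t := (‖y‖ ^ 2 - ‖x‖ ^ 2) / ‖y - x‖ ^ 2 with ht
  have hnum : 0 < ‖y‖ ^ 2 - ‖x‖ ^ 2 := by nlinarith [norm_nonneg x]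
  have ht0 : 0 < t := by positivity
  have hp : ‖t • (y - x)‖ = (‖y‖ ^ 2 - ‖x‖ ^ 2) / ‖y - x‖ := by
    rw [norm_smul, Real.norm_of_nonneg ht0.le, ht]
    field_simp
  refine ⟨t • (y - x), ?_, ?_, ?_⟩
  · rw [hp, le_div_iff₀ hd]
    nlinarith [norm_sub_le y x]
  · rw [hp, div_le_iff₀ hd]
    nlinarith [norm_sub_norm_le y x, norm_nonneg x]
  · rw [swapRefl_apply (smul_ne_zero ht0.ne' hne), inner_smul_right]
    have e : 2 * t * inner ℝ x (y - x) * (1 / ‖t • (y - x)‖) ^ 2 * t = t - 1 := by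
      rw [norm_smul, Real.norm_of_nonneg ht0.le]
      have h1 : ‖y‖ ^ 2 = ‖x‖ ^ 2 + 2 * inner ℝ x (y - x) + ‖y - x‖ ^ 2 := by
        rw [← norm_add_sq_real, add_sub_cancel]
      have h2 : t * ‖y - x‖ ^ 2 = 2 * inner ℝ x (y - x) + ‖y - x‖ ^ 2 := by
        rw [ht, div_mul_cancel₀ _ (by positivity)]
        linarith
      field_simp
      linarith
    rw [smul_smul, smul_smul, ← mul_assoc, e]
    module

theorem measurable_swapRefl :
    Measurable fun q : EuclideanSpace ℝ (Fin n) × EuclideanSpace ℝ (Fin n) =>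
      swapRefl q.1 q.2 := by
  unfold swapRefl hypRefl
  fun_prop

theorem exists_pos_volume_ball_diff_ball_le {d : ℝ≥0∞} (hd : d ≠ 0) :
    ∃ η : ℝ, 0 < η ∧
      volume (ball (0 : EuclideanSpace ℝ (Fin n)) (1 + η) \ closedBall 0 1) ≤ d := by
  have h := tendsto_measure_biInter_gt (μ := (volume : Measure (EuclideanSpace ℝ (Fin n))))
    (s := fun η : ℝ => ball (0 : EuclideanSpace ℝ (Fin n)) (1 + η) \ closedBall 0 1) (a := 0)
    (fun r _ => (measurableSet_ball.diff measurableSet_closedBall).nullMeasurableSet)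
    (fun i j _ hij => Set.sdiff_subset_sdiff_left (ball_subset_ball (by linarith)))
    ⟨1, one_pos, ((measure_mono Set.sdiff_subset).trans_lt measure_ball_lt_top).ne⟩
  have e : (⋂ r > (0 : ℝ), ball (0 : EuclideanSpace ℝ (Fin n)) (1 + r) \ closedBall 0 1) = ∅ := by
    rw [Set.eq_empty_iff_forall_notMem]
    intro x hx
    simp only [Set.mem_iInter] at hx
    have h1 := (hx 1 one_pos).2
    rw [mem_closedBall_zero_iff, not_le] at h1
    have h2 := (hx (‖x‖ - 1) (by linarith)).1
    rw [mem_ball_zero_iff] at h2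
    linarith
  rw [e, measure_empty] at h
  have h2 := (h.eventually_le_const (pos_iff_ne_zero.2 hd)).and self_mem_nhdsWithin
  obtain ⟨η, h3, h4⟩ := h2.exists
  exact ⟨η, h4, h3⟩

theorem volume_closedBall_diff_ball :
    volume (closedBall (0 : EuclideanSpace ℝ (Fin n)) 1 \ ball 0 1) = 0 := by
  rw [measure_sdiff ball_subset_closedBall measurableSet_ball.nullMeasurableSet
    measure_ball_lt_top.ne, Measure.addHaar_unitClosedBall_eq_addHaar_unitBall, tsub_self]

/-- Polarizations moving a definite amount of mass into the unit ball. -/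
theorem exists_le_volume_swapRefl {d : ℝ≥0∞} (hd : d ≠ 0) (R : ℝ) :
    ∃ c : ℝ≥0∞, c ≠ 0 ∧ ∀ F : Set (EuclideanSpace ℝ (Fin n)), MeasurableSet F →
      F ⊆ closedBall 0 R → d ≤ volume (ball 0 1 \ F) → d ≤ volume (F \ ball 0 1) →
      ∃ p : EuclideanSpace ℝ (Fin n), p ≠ 0 ∧
        c ≤ volume {w | w ∈ ball 0 1 \ F ∧ swapRefl p w ∈ F \ ball 0 1} := by
  by_cases hdt : d = ∞
  · refine ⟨1, one_ne_zero, fun F _ _ h1 _ => ?_⟩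
    rw [hdt, top_le_iff] at h1
    exact absurd h1 ((measure_mono Set.sdiff_subset).trans_lt measure_ball_lt_top).ne
  have hd2 : d / 2 ≠ 0 := (ENNReal.half_pos hd).ne'
  obtain ⟨η, hη, hη2⟩ := exists_pos_volume_ball_diff_ball_le (n := n) hd2
  set K := Real.toNNReal (1 + 4 / η)
  set N : Set (EuclideanSpace ℝ (Fin n)) := {p | η ≤ ‖p‖ ∧ ‖p‖ ≤ R + 1} with hN
  have mN : MeasurableSet N :=
    (measurableSet_le measurable_const measurable_norm).inter
      (measurableSet_le measurable_norm measurable_const)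
  have vN : volume N ≠ ∞ :=
    ((measure_mono (fun p hp => by simpa using hp.2)).trans_lt
      (measure_closedBall_lt_top (x := (0 : EuclideanSpace ℝ (Fin n))) (r := R + 1))).ne
  have hKt : ((K : ℝ≥0∞) ^ n) ≠ ∞ := ENNReal.pow_ne_top ENNReal.coe_ne_top
  obtain ⟨c, hc, hc2⟩ := ENNReal.exists_nnreal_pos_mul_lt (a := (K : ℝ≥0∞) ^ n * volume N)
    (b := d / 2 * d) (ENNReal.mul_ne_top hKt vN) (mul_ne_zero hd2 hd)
  refine ⟨c, by exact_mod_cast hc.ne', fun F mF hFR h1 h2 => ?_⟩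
  by_contra! hcon
  set D := F \ ball 0 (1 + η)
  have hD : d / 2 ≤ volume D := by
    have h3 : F \ ball 0 1 ⊆ D ∪ (ball 0 (1 + η) \ closedBall 0 1 ∪ closedBall 0 1 \ ball 0 1) := by
      intro x hx
      by_cases h4 : x ∈ ball (0 : EuclideanSpace ℝ (Fin n)) (1 + η)
      · by_cases h5 : x ∈ closedBall (0 : EuclideanSpace ℝ (Fin n)) 1
        · exact Or.inr (Or.inr ⟨h5, hx.2⟩)
        · exact Or.inr (Or.inl ⟨h4, h5⟩)
      · exact Or.inl ⟨hx.1, h4⟩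
    have h4 := h2.trans ((measure_mono h3).trans ((measure_union_le _ _).trans
      (add_le_add_right (measure_union_le _ _) _)))
    rw [volume_closedBall_diff_ball, add_zero] at h4
    have h5 : d / 2 + d / 2 ≤ volume D + d / 2 := by
      rw [ENNReal.add_halves]
      exact h4.trans (add_le_add_right hη2 _)
    exact (ENNReal.add_le_add_iff_right (ENNReal.div_ne_top hdt two_ne_zero)).1 h5
  have key : ∀ w ∈ ball 0 1 \ F,
      d / 2 ≤ (K : ℝ≥0∞) ^ n * volume {p | p ∈ N ∧ swapRefl p w ∈ F \ ball 0 1} := by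
    intro w hw
    have hw1 : ‖w‖ < 1 := by simpa using hw.1
    have hsub : D ⊆ (fun p => swapRefl p w) '' {p | p ∈ N ∧ swapRefl p w ∈ F \ ball 0 1} := by
      intro z hz
      have hz1 : 1 + η ≤ ‖z‖ := by simpa using hz.2
      have hz2 : ‖z‖ ≤ R := by simpa using hFR hz.1
      obtain ⟨p, hp1, hp2, hp3⟩ := exists_swapRefl_eq (x := w) (y := z) (by linarith)
      refine ⟨p, ⟨⟨by linarith, by linarith⟩, ?_⟩, hp3⟩
      rw [hp3]
      refine ⟨hz.1, ?_⟩
      rw [mem_ball_zero_iff]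
      linarith
    refine hD.trans ((measure_mono hsub).trans (volume_image_le_of_lipschitzOnWith ?_))
    exact (lipschitzOnWith_swapRefl hη hw1.le).mono fun p hp => hp.1.1
  set M : Set (EuclideanSpace ℝ (Fin n) × EuclideanSpace ℝ (Fin n)) :=
    {q | q.1 ∈ N ∧ q.2 ∈ ball 0 1 \ F ∧ swapRefl q.1 q.2 ∈ F \ ball 0 1}
  have mM : MeasurableSet M :=
    (measurable_fst mN).inter ((measurable_snd (measurableSet_ball.diff mF)).inter
      (measurable_swapRefl (mF.diff measurableSet_ball)))
  have hM1 : (volume.prod volume) M ≤ c * volume N := by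
    rw [Measure.prod_apply mM]
    calc _ ≤ ∫⁻ p, N.indicator (fun _ => (c : ℝ≥0∞)) p := by
          refine lintegral_mono fun p => ?_
          by_cases hp : p ∈ N
          · rw [Set.indicator_of_mem hp]
            have hp0 : p ≠ 0 := by
              rintro rfl
              have := hp.1
              rw [norm_zero] at this
              linarith
            exact (measure_mono fun w hw => hw.2).trans (hcon p hp0).le
          · rw [Set.indicator_of_notMem hp, nonpos_iff_eq_zero]
            have : Prod.mk p ⁻¹' M = ∅ := by
              ext w
              simp [M, hp]
            rw [this, measure_empty]
      _ = _ := by rw [lintegral_indicator_const mN]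
  have hM2 : d / 2 * d ≤ (K : ℝ≥0∞) ^ n * (volume.prod volume) M := by
    rw [Measure.prod_apply_symm mM, ← lintegral_const_mul' _ _ hKt]
    calc d / 2 * d ≤ d / 2 * volume (ball 0 1 \ F) := by gcongr
      _ = ∫⁻ w, (ball 0 1 \ F).indicator (fun _ => d / 2) w := by
          rw [lintegral_indicator_const (measurableSet_ball.diff mF)]
      _ ≤ _ := by
          refine lintegral_mono fun w => ?_
          by_cases hw : w ∈ ball 0 1 \ F
          · rw [Set.indicator_of_mem hw]
            refine (key w hw).trans ?_
            gcongr
            intro p hp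
            exact ⟨hp.1, hw, hp.2⟩
          · rw [Set.indicator_of_notMem hw]
            exact zero_le
  refine absurd (hM2.trans (mul_le_mul_right hM1 _)) (not_le.2 ?_)
  calc _ = _ := by ring
    _ < _ := hc2

theorem volume_sdiff_comm {A B : Set (EuclideanSpace ℝ (Fin n))} (hA : MeasurableSet A)
    (hB : MeasurableSet B) (hfin : volume A ≠ ∞) (h : volume A = volume B) :
    volume (A \ B) = volume (B \ A) := by
  have h1 := measure_inter_add_sdiff (μ := volume) A hB
  have h2 := measure_inter_add_sdiff (μ := volume) B hA
  rw [Set.inter_comm, ← h, ← h1] at h2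
  exact ((ENNReal.add_right_inj
    ((measure_mono Set.inter_subset_left).trans_lt hfin.lt_top).ne).1 h2).symm

theorem exists_volume_ball_diff_lt (hs : 0 < (n : ℝ) + s) {F₀ : Set (EuclideanSpace ℝ (Fin n))}
    (hF₀ : MeasurableSet F₀) {R : ℝ} (hR : F₀ ⊆ closedBall 0 R)
    (hv : volume F₀ = volume (ball (0 : EuclideanSpace ℝ (Fin n)) 1)) {d : ℝ≥0∞} (hd : d ≠ 0) :
    ∃ F : Set (EuclideanSpace ℝ (Fin n)), MeasurableSet F ∧
      volume F = volume (ball (0 : EuclideanSpace ℝ (Fin n)) 1) ∧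
      fracPer n s F ≤ fracPer n s F₀ ∧ volume (ball 0 1 \ F) < d := by
  by_contra! hcon
  obtain ⟨c, hc, hc2⟩ := exists_le_volume_swapRefl (n := n) hd R
  have key : ∀ k : ℕ, ∀ F : Set (EuclideanSpace ℝ (Fin n)), MeasurableSet F →
      volume F = volume (ball (0 : EuclideanSpace ℝ (Fin n)) 1) →
      fracPer n s F ≤ fracPer n s F₀ → F ⊆ closedBall 0 R →
      k * c ≤ volume (ball 0 1 \ F) := by
    intro k
    induction k with
    | zero => intros; simp
    | succ k ih =>
      intro F mF vF pF hF
      have h1 := hcon F mF vF pF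
      have h2 : volume (ball 0 1 \ F) = volume (F \ ball 0 1) :=
        volume_sdiff_comm measurableSet_ball mF measure_ball_lt_top.ne vF.symm
      obtain ⟨p, hp, hcp⟩ := hc2 F mF hF h1 (h2 ▸ h1)
      have hr := isReflection_swapRefl hp
      have hn := norm_le_norm_swapRefl hp
      have h3 := ih _ (hr.measurableSet_polarize mF) ((hr.volume_polarize mF).trans vF)
        ((hr.fracPer_polarize_le mF hs).trans pF) (IsReflection.polarize_subset_closedBall hn hF)
      refine le_trans ?_ (hr.volume_ball_diff_polarize_add_le hn mF 1)
      push_cast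
      rw [add_mul, one_mul]
      exact add_le_add h3 hcp
  have h := fun k => (key k F₀ hF₀ hv le_rfl hR).trans (measure_mono Set.sdiff_subset)
  obtain ⟨k, hk⟩ := ENNReal.exists_nat_mul_gt hc
    (measure_ball_lt_top (μ := volume) (x := (0 : EuclideanSpace ℝ (Fin n))) (r := 1)).ne
  exact absurd (h k) (not_le.2 hk)

/-- Lower semicontinuity of the fractional perimeter. -/
theorem fracPer_le_of_ae_eventually {B : Set (EuclideanSpace ℝ (Fin n))} (hB : MeasurableSet B)
    {F : ℕ → Set (EuclideanSpace ℝ (Fin n))} (hF : ∀ k, MeasurableSet (F k))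
    (h : ∀ᵐ x, ∀ᶠ k in Filter.atTop, x ∈ B ↔ x ∈ F k) {P : ℝ≥0∞}
    (hP : ∀ k, fracPer n s (F k) ≤ P) : fracPer n s B ≤ P := by
  have e : ∀ G : Set (EuclideanSpace ℝ (Fin n)), MeasurableSet G → fracPer n s G =
      ∫⁻ x, ∫⁻ y, G.indicator 1 x * (Gᶜ.indicator 1 y * fracKer n s x y) := by
    intro G hG
    rw [fracPer_eq_interaction, interaction, ← lintegral_indicator hG]
    refine lintegral_congr fun x => ?_
    by_cases hx : x ∈ G
    · simp only [Set.indicator_of_mem hx, Pi.one_apply, one_mul]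
      rw [← lintegral_indicator hG.compl]
      refine lintegral_congr fun y => ?_
      by_cases hy : y ∈ Gᶜ
      · rw [Set.indicator_of_mem hy, Set.indicator_of_mem hy, Pi.one_apply, one_mul]
      · rw [Set.indicator_of_notMem hy, Set.indicator_of_notMem hy, zero_mul]
    · simp [Set.indicator_of_notMem hx]
  have hm : ∀ k, Measurable fun q : EuclideanSpace ℝ (Fin n) × EuclideanSpace ℝ (Fin n) =>
      (F k).indicator (1 : EuclideanSpace ℝ (Fin n) → ℝ≥0∞) q.1 *
        ((F k)ᶜ.indicator 1 q.2 * fracKer n s q.1 q.2) := fun k =>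
    ((measurable_one.indicator (hF k)).comp measurable_fst).mul
      (((measurable_one.indicator (hF k).compl).comp measurable_snd).mul measurable_fracKer)
  calc fracPer n s B = ∫⁻ x, ∫⁻ y, B.indicator 1 x * (Bᶜ.indicator 1 y * fracKer n s x y) := e B hB
    _ ≤ ∫⁻ x, ∫⁻ y, Filter.liminf (fun k => (F k).indicator 1 x *
          ((F k)ᶜ.indicator 1 y * fracKer n s x y)) Filter.atTop := by
        refine lintegral_mono_ae ?_
        filter_upwards [h] with x hx
        refine lintegral_mono_ae ?_
        filter_upwards [h] with y hy
        refine Filter.le_liminf_of_le (by isBoundedDefault) ?_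
        filter_upwards [hx, hy] with k hxk hyk
        have e1 : B.indicator (1 : EuclideanSpace ℝ (Fin n) → ℝ≥0∞) x = (F k).indicator 1 x := by
          by_cases hx' : x ∈ B
          · rw [Set.indicator_of_mem hx', Set.indicator_of_mem (hxk.1 hx')]
          · rw [Set.indicator_of_notMem hx', Set.indicator_of_notMem (mt hxk.2 hx')]
        have e2 : Bᶜ.indicator (1 : EuclideanSpace ℝ (Fin n) → ℝ≥0∞) y = (F k)ᶜ.indicator 1 y := by
          by_cases hy' : y ∈ B
          · rw [Set.indicator_of_notMem (not_not.2 hy'),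
              Set.indicator_of_notMem (not_not.2 (hyk.1 hy'))]
          · rw [Set.indicator_of_mem (Set.mem_compl hy'),
              Set.indicator_of_mem (Set.mem_compl (mt hyk.2 hy'))]
        rw [e1, e2]
    _ ≤ ∫⁻ x, Filter.liminf (fun k => ∫⁻ y, (F k).indicator 1 x *
          ((F k)ᶜ.indicator 1 y * fracKer n s x y)) Filter.atTop :=
        lintegral_mono fun x => lintegral_liminf_le fun k => (hm k).comp measurable_prodMk_left
    _ ≤ Filter.liminf (fun k => ∫⁻ x, ∫⁻ y, (F k).indicator 1 x *
          ((F k)ᶜ.indicator 1 y * fracKer n s x y)) Filter.atTop :=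
        lintegral_liminf_le fun k => (hm k).lintegral_prod_right'
    _ ≤ P := by
        simp only [← e _ (hF _)]
        exact Filter.liminf_le_of_le (by isBoundedDefault) fun b hb => by
          obtain ⟨k, hk⟩ := hb.exists
          exact hk.trans (hP k)

/-- The fractional isoperimetric inequality for bounded sets. -/
theorem fracPer_ball_le (hs : 0 < (n : ℝ) + s) {F : Set (EuclideanSpace ℝ (Fin n))}
    (hF : MeasurableSet F) {R : ℝ} (hR : F ⊆ closedBall 0 R)
    (hv : volume F = volume (ball (0 : EuclideanSpace ℝ (Fin n)) 1)) :
    fracPer n s (ball 0 1) ≤ fracPer n s F := by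
  obtain ⟨ε, hε, hε2⟩ := ENNReal.exists_pos_sum_of_countable' one_ne_zero ℕ
  choose G mG vG pG dG using fun k : ℕ => exists_volume_ball_diff_lt hs hF hR hv (hε k).ne'
  refine fracPer_le_of_ae_eventually measurableSet_ball mG ?_ pG
  have h2 : ∀ k, volume (G k \ ball 0 1) = volume (ball 0 1 \ G k) := fun k =>
    (volume_sdiff_comm measurableSet_ball (mG k) measure_ball_lt_top.ne (vG k).symm).symm
  have hsum : ∑' k, volume (ball 0 1 \ G k) ≠ ∞ :=
    ((ENNReal.tsum_le_tsum fun k => (dG k).le).trans_lt (hε2.trans ENNReal.one_lt_top)).ne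
  have a1 := ae_eventually_notMem hsum
  have a2 := ae_eventually_notMem (μ := volume) (s := fun k => G k \ ball 0 1)
    (by simpa only [h2] using hsum)
  filter_upwards [a1, a2] with x h1 h2
  filter_upwards [h1, h2] with k h3 h4
  simp only [Set.mem_sdiff] at h3 h4
  tauto

theorem ofReal_mul_volume_le_lintegral_fracKer (hs : 0 < (n : ℝ) + s)
    {B : Set (EuclideanSpace ℝ (Fin n))} (hB : MeasurableSet B) {x : EuclideanSpace ℝ (Fin n)}
    (hx : x ∉ B) {R : ℝ} (hR : B ⊆ closedBall x R) :
    ENNReal.ofReal (R ^ (-((n : ℝ) + s))) * volume B ≤ ∫⁻ y in B, fracKer n s x y := by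
  rw [← setLIntegral_const]
  refine setLIntegral_mono' hB fun y hy => ?_
  have hne : x ≠ y := fun e => hx (e ▸ hy)
  rw [fracKer_eq_dist]
  refine ENNReal.ofReal_le_ofReal (Real.rpow_le_rpow_of_nonpos (dist_pos.2 hne) ?_ (by linarith))
  rw [dist_comm]
  exact hR hy

theorem fracPer_ball_pos [NeZero n] (hs : 0 < (n : ℝ) + s) :
    0 < fracPer n s (ball 0 1) := by
  obtain ⟨e, he⟩ := exists_norm_eq (EuclideanSpace ℝ (Fin n)) (c := 3) (by norm_num)
  have hsub : ball e 1 ⊆ (ball (0 : EuclideanSpace ℝ (Fin n)) 1)ᶜ := by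
    intro y hy
    rw [Set.mem_compl_iff, mem_ball_zero_iff, not_lt]
    rw [mem_ball, dist_eq_norm] at hy
    have := norm_sub_norm_le e y
    rw [norm_sub_rev] at this
    linarith
  refine lt_of_lt_of_le ?_ (interaction_mono subset_rfl hsub)
  calc 0 < ENNReal.ofReal ((5 : ℝ) ^ (-((n : ℝ) + s))) * volume (ball e 1) *
        volume (ball (0 : EuclideanSpace ℝ (Fin n)) 1) := by
        refine ENNReal.mul_pos (mul_ne_zero ?_ ?_) ?_
        · rw [Ne, ENNReal.ofReal_eq_zero, not_le]; positivity
        · exact (measure_ball_pos _ _ one_pos).ne'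
        · exact (measure_ball_pos _ _ one_pos).ne'
    _ = ∫⁻ x in ball (0 : EuclideanSpace ℝ (Fin n)) 1,
        ENNReal.ofReal ((5 : ℝ) ^ (-((n : ℝ) + s))) * volume (ball e 1) := by
        rw [setLIntegral_const]
    _ ≤ _ := by
        refine setLIntegral_mono' measurableSet_ball fun x hx => ?_
        refine ofReal_mul_volume_le_lintegral_fracKer hs measurableSet_ball
          (fun h => hsub h hx) fun y hy => ?_
        rw [mem_closedBall]
        have h1 := dist_triangle4 y e 0 x
        rw [mem_ball] at hy hx
        rw [dist_zero_right, he, dist_comm 0 x] at h1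
        linarith

theorem exists_ball_subset_or_le_fracPer (hs : 0 < (n : ℝ) + s)
    {E : Set (EuclideanSpace ℝ (Fin n))} (hc : Convex ℝ E) (hE : MeasurableSet E) (r : ℝ) :
    (∃ x, ball x r ⊆ E) ∨
      ENNReal.ofReal ((3 * r) ^ (-((n : ℝ) + s))) *
        (volume (ball (0 : EuclideanSpace ℝ (Fin n)) r) / 2) * volume E ≤ fracPer n s E := by
  by_cases h : ∃ x, ball x r ⊆ E
  · exact Or.inl h
  right
  push Not at h
  rw [← setLIntegral_const]
  refine setLIntegral_mono' hE fun x hx => ?_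
  obtain ⟨b, hb, hbE⟩ := Set.not_subset.1 (h x)
  have mV : MeasurableSet (Eᶜ ∩ closedBall x (3 * r)) := hE.compl.inter measurableSet_closedBall
  have hr : 0 < r := dist_nonneg.trans_lt (mem_ball.1 hb)
  have hV : volume (ball (0 : EuclideanSpace ℝ (Fin n)) r) / 2 ≤
      volume (Eᶜ ∩ closedBall x (3 * r)) := by
    have h1 : volume (ball x r ∩ E) ≤ volume (Eᶜ ∩ closedBall x (3 * r)) := by
      have hmp := (Measure.measurePreserving_sub_left
        (volume : Measure (EuclideanSpace ℝ (Fin n))) ((2 : ℝ) • b))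
      rw [← hmp.measure_preimage mV.nullMeasurableSet]
      refine measure_mono fun z hz => ⟨fun hz2 => hbE ?_, ?_⟩
      · have := hc hz.2 hz2 (a := 1 / 2) (b := 1 / 2) (by norm_num) (by norm_num) (by norm_num)
        convert this using 1
        module
      · have h3 := hz.1
        rw [mem_ball, dist_eq_norm] at h3 hb
        rw [mem_closedBall, dist_eq_norm]
        have e : (2 : ℝ) • b - z - x = (b - x) + (b - x) - (z - x) := by module
        rw [e]
        have h4 := norm_sub_le ((b - x) + (b - x)) (z - x)
        have h5 := norm_add_le (b - x) (b - x)
        linarith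
    have h2 : volume (ball x r \ E) ≤ volume (Eᶜ ∩ closedBall x (3 * r)) := by
      refine measure_mono fun z hz => ⟨hz.2, ?_⟩
      exact ball_subset_closedBall (ball_subset_ball (by linarith) hz.1)
    rw [ENNReal.div_le_iff_le_mul (by simp) (by simp), mul_two,
      ← Measure.addHaar_ball_center _ x r, ← measure_inter_add_sdiff (ball x r) hE]
    exact add_le_add h1 h2
  calc _ ≤ ENNReal.ofReal ((3 * r) ^ (-((n : ℝ) + s))) *
        volume (Eᶜ ∩ closedBall x (3 * r)) := by gcongr
    _ ≤ ∫⁻ y in Eᶜ ∩ closedBall x (3 * r), fracKer n s x y :=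
        ofReal_mul_volume_le_lintegral_fracKer hs mV (fun h => h.1 hx) Set.inter_subset_right
    _ ≤ _ := lintegral_mono_set Set.inter_subset_left

theorem Convex.subset_closedBall_of_ball_subset {E : Set (EuclideanSpace ℝ (Fin n))}
    (hc : Convex ℝ E) {x₀ : EuclideanSpace ℝ (Fin n)} {r : ℝ} (hr : 0 < r) (hx₀ : ball x₀ r ⊆ E)
    {N : ℕ} (hN : volume E < N * volume (ball (0 : EuclideanSpace ℝ (Fin n)) (r / 2))) :
    E ⊆ closedBall x₀ (2 * N * r) := by
  intro y hy
  by_contra hcon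
  rw [mem_closedBall, not_le, dist_eq_norm] at hcon
  have hL : 0 < ‖y - x₀‖ := lt_of_le_of_lt (by positivity) hcon
  have hw : ‖(r / ‖y - x₀‖) • (y - x₀)‖ = r := by
    rw [norm_smul, Real.norm_of_nonneg (by positivity)]
    field_simp
  rw [← Measure.addHaar_ball_center volume x₀] at hN
  refine absurd hN (not_lt.2 (natCast_mul_volume_le measurableSet_ball
    ((r / ‖y - x₀‖) • (y - x₀)) N ?_ ?_))
  · intro k hk x hx
    rw [mem_ball, dist_eq_norm] at hx
    have hkN : (k : ℝ) ≤ N := by exact_mod_cast hk.le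
    set τ : ℝ := k * (r / ‖y - x₀‖) with hτ
    have hτ0 : 0 ≤ τ := by positivity
    have hτ1 : τ ≤ 1 / 2 := by
      rw [hτ, ← mul_div_assoc, div_le_iff₀ hL]
      nlinarith
    have hu : x₀ + (1 - τ)⁻¹ • (x - x₀) ∈ E := by
      refine hx₀ ?_
      rw [mem_ball, dist_eq_norm, add_sub_cancel_left, norm_smul,
        Real.norm_of_nonneg (inv_nonneg.2 (by linarith))]
      have : (1 - τ)⁻¹ ≤ 2 := by
        rw [inv_le_comm₀ (by linarith) (by norm_num)]
        linarith
      nlinarith [norm_nonneg (x - x₀)]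
    have h := hc hu hy (a := 1 - τ) (b := τ) (by linarith) hτ0 (by ring)
    convert h using 1
    have h1 : 1 - τ ≠ 0 := by linarith
    rw [smul_add, smul_inv_smul₀ h1, smul_smul, ← hτ]
    module
  · intro k _ l _ x hx y' hy' he
    have h1 : ‖x - y'‖ < r := by
      rw [← dist_eq_norm]
      have h3 := dist_triangle x x₀ y'
      rw [mem_ball] at hx hy'
      rw [dist_comm x₀ y'] at h3
      linarith
    have h2 : x - y' = ((l : ℝ) - k) • ((r / ‖y - x₀‖) • (y - x₀)) := by
      rw [sub_smul, sub_eq_sub_iff_add_eq_add, he, add_comm]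
    rw [h2, norm_smul, hw, Real.norm_eq_abs] at h1
    have h3 : |(l : ℝ) - k| < 1 := by
      by_contra h4
      push Not at h4
      nlinarith
    have h4 : |(l : ℤ) - k| < 1 := by exact_mod_cast h3
    rw [Int.abs_lt_one_iff] at h4
    omega

/-- Convex sets of bounded fractional perimeter and fixed volume have bounded diameter. -/
theorem exists_dist_le_of_fracPer_le [NeZero n] (hs0 : 0 < s) {M : ℝ≥0∞} (hM : M ≠ ∞) :
    ∃ D : ℝ, 0 < D ∧ ∀ E : Set (EuclideanSpace ℝ (Fin n)), Convex ℝ E → MeasurableSet E →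
      volume E = volume (ball (0 : EuclideanSpace ℝ (Fin n)) 1) → fracPer n s E ≤ M →
      ∀ x ∈ E, ∀ y ∈ E, dist x y ≤ D := by
  have hs : 0 < (n : ℝ) + s := by positivity
  set ω := (volume (ball (0 : EuclideanSpace ℝ (Fin n)) 1)).toReal with hω
  have hωt : volume (ball (0 : EuclideanSpace ℝ (Fin n)) 1) ≠ ∞ := measure_ball_lt_top.ne
  have hω0 : 0 < ω := ENNReal.toReal_pos (measure_ball_pos _ _ one_pos).ne' hωt
  have hωe : volume (ball (0 : EuclideanSpace ℝ (Fin n)) 1) = ENNReal.ofReal ω :=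
    (ENNReal.ofReal_toReal hωt).symm
  set κ : ℝ := 3 ^ (-((n : ℝ) + s)) * (ω / 2) * ω with hκ
  have hκ0 : 0 < κ := by positivity
  set t : ℝ := M.toReal / κ + 1 with ht
  have ht0 : 0 < t := by positivity
  set r : ℝ := t ^ (-(1 / s)) with hr
  have hr0 : 0 < r := by positivity
  have hrs : r ^ (-s) = t := by
    rw [hr, ← Real.rpow_mul ht0.le]
    have : -(1 / s) * -s = 1 := by field_simp
    rw [this, Real.rpow_one]
  have hbig : M < ENNReal.ofReal ((3 * r) ^ (-((n : ℝ) + s))) *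
      (volume (ball (0 : EuclideanSpace ℝ (Fin n)) r) / 2) *
        volume (ball (0 : EuclideanSpace ℝ (Fin n)) 1) := by
    rw [Measure.addHaar_ball_of_pos _ _ hr0, hωe, finrank_euclideanSpace_fin,
      ← ENNReal.ofReal_mul (by positivity), ← ENNReal.ofReal_ofNat 2,
      ← ENNReal.ofReal_div_of_pos (by norm_num), ← ENNReal.ofReal_mul (by positivity),
      ← ENNReal.ofReal_mul (by positivity), ENNReal.lt_ofReal_iff_toReal_lt hM]
    have e : (3 * r) ^ (-((n : ℝ) + s)) * (r ^ n * ω / 2) * ω = κ * r ^ (-s) := by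
      rw [Real.mul_rpow (by norm_num) hr0.le, ← Real.rpow_natCast r n]
      have : r ^ (-s) = r ^ (-((n : ℝ) + s)) * r ^ (n : ℝ) := by
        rw [← Real.rpow_add hr0]; congr 1; ring
      rw [this, hκ]
      ring
    rw [e, hrs, ht, mul_add, mul_div_cancel₀ _ hκ0.ne']
    linarith
  obtain ⟨N, hN⟩ := ENNReal.exists_nat_mul_gt
    (measure_ball_pos volume (0 : EuclideanSpace ℝ (Fin n)) (half_pos hr0)).ne' hωt
  refine ⟨2 * (2 * N * r) + 1, by positivity, fun E hc mE vE pE x hx y hy => ?_⟩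
  obtain ⟨x₀, hx₀⟩ : ∃ x, ball x r ⊆ E := by
    refine (exists_ball_subset_or_le_fracPer hs hc mE r).resolve_right fun h => ?_
    rw [vE] at h
    exact absurd (hbig.trans_le (h.trans pE)) (lt_irrefl _)
  have hsub := hc.subset_closedBall_of_ball_subset hr0 hx₀ (N := N) (by rwa [vE])
  have h1 := hsub hx
  have h2 := hsub hy
  rw [mem_closedBall] at h1 h2
  have := dist_triangle_right x y x₀
  linarith

theorem fracPer_eq_lintegral_volume {E : Set (EuclideanSpace ℝ (Fin n))} (hE : MeasurableSet E) :
    fracPer n s E = ∫⁻ h : EuclideanSpace ℝ (Fin n), ENNReal.ofReal (‖h‖ ^ (-((n : ℝ) + s))) *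
      volume (E \ (fun x => x + h) ⁻¹' E) := by
  have h1 : fracPer n s E = ∫⁻ x, ∫⁻ h, E.indicator 1 x *
      (Eᶜ.indicator 1 (x + h) * ENNReal.ofReal (‖h‖ ^ (-((n : ℝ) + s)))) := by
    rw [fracPer, ← lintegral_indicator hE]
    refine lintegral_congr fun x => ?_
    by_cases hx : x ∈ E
    · simp only [Set.indicator_of_mem hx, Pi.one_apply, one_mul]
      rw [← lintegral_indicator hE.compl, ← lintegral_add_left_eq_self _ x]
      refine lintegral_congr fun h => ?_
      by_cases hy : x + h ∈ Eᶜ <;> simp [hy]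
    · simp [hx]
  rw [h1, lintegral_lintegral_swap]
  · refine lintegral_congr fun h => ?_
    have hm : MeasurableSet (E \ (fun x => x + h) ⁻¹' E) :=
      hE.diff (measurable_add_const h hE)
    rw [← lintegral_indicator_one hm, ← lintegral_const_mul _ (measurable_one.indicator hm)]
    refine lintegral_congr fun x => ?_
    by_cases hx : x ∈ E <;> by_cases hy : x + h ∈ E <;> simp [hx, hy]
  · refine Measurable.aemeasurable ?_
    have h2 : Measurable fun p : EuclideanSpace ℝ (Fin n) × EuclideanSpace ℝ (Fin n) =>
        E.indicator (1 : EuclideanSpace ℝ (Fin n) → ℝ≥0∞) p.1 :=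
      (measurable_one.indicator hE).comp measurable_fst
    have h3 : Measurable fun p : EuclideanSpace ℝ (Fin n) × EuclideanSpace ℝ (Fin n) =>
        Eᶜ.indicator (1 : EuclideanSpace ℝ (Fin n) → ℝ≥0∞) (p.1 + p.2) :=
      (measurable_one.indicator hE.compl).comp (measurable_fst.add measurable_snd)
    exact h2.mul (h3.mul (by fun_prop))

theorem lintegral_norm_rpow_mul_min_ne_top [NeZero n] (hs : s ∈ Set.Ioo (0 : ℝ) 1) {a : ℝ}
    (ha : 0 ≤ a) :
    ∫⁻ h : EuclideanSpace ℝ (Fin n), ENNReal.ofReal (‖h‖ ^ (-((n : ℝ) + s)) * min 1 (a * ‖h‖))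
      ≠ ∞ := by
  have hi : Integrable fun h : EuclideanSpace ℝ (Fin n) =>
      ‖h‖ ^ (-((n : ℝ) + s)) * min 1 (a * ‖h‖) := by
    rw [integrable_fun_norm_addHaar volume
      (f := fun t : ℝ => t ^ (-((n : ℝ) + s)) * min 1 (a * t))]
    have hn : 1 ≤ n := NeZero.one_le
    have key : ∀ t : ℝ, 0 < t → t ^ (n - 1) * t ^ (-((n : ℝ) + s)) = t ^ (-1 - s) := by
      intro t ht
      rw [← Real.rpow_natCast, ← Real.rpow_add ht, Nat.cast_sub hn]
      congr 1
      push_cast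
      ring
    rw [finrank_euclideanSpace_fin, ← Set.Ioc_union_Ioi_eq_Ioi zero_le_one]
    refine IntegrableOn.union ?_ ?_
    · have h1 : IntegrableOn (fun t : ℝ => a * t ^ (-s)) (Set.Ioc 0 1) := by
        refine Integrable.const_mul ?_ a
        rw [← IntegrableOn, ← intervalIntegrable_iff_integrableOn_Ioc_of_le zero_le_one]
        exact intervalIntegral.intervalIntegrable_rpow' (by linarith [hs.2])
      refine h1.mono' (by fun_prop) ?_
      filter_upwards [ae_restrict_mem measurableSet_Ioc] with t ht
      rw [smul_eq_mul, ← mul_assoc, key t ht.1, Real.norm_of_nonneg (mul_nonneg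
        (Real.rpow_nonneg ht.1.le _) (le_min zero_le_one (mul_nonneg ha ht.1.le)))]
      have h2 : t ^ (-s) = t ^ (-1 - s) * t := by
        nth_rewrite 3 [← Real.rpow_one t]
        rw [← Real.rpow_add ht.1]
        congr 1
        ring
      rw [h2, mul_left_comm a]
      exact mul_le_mul_of_nonneg_left (min_le_right _ _) (Real.rpow_nonneg ht.1.le _)
    · refine (integrableOn_Ioi_rpow_of_lt (a := -1 - s) (by linarith [hs.1])
        zero_lt_one).mono' (by fun_prop) ?_
      filter_upwards [ae_restrict_mem measurableSet_Ioi] with t ht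
      have ht0 : 0 < t := zero_lt_one.trans ht
      rw [smul_eq_mul, ← mul_assoc, key t ht0, Real.norm_of_nonneg (mul_nonneg
        (Real.rpow_nonneg ht0.le _) (le_min zero_le_one (mul_nonneg ha ht0.le)))]
      exact mul_le_of_le_one_right (Real.rpow_nonneg ht0.le _) (min_le_left _ _)
  exact hi.lintegral_lt_top.ne

theorem volume_sdiff_preimage_add_le {E : Set (EuclideanSpace ℝ (Fin n))} (hc : Convex ℝ E)
    (hE : MeasurableSet E) (hfin : volume E ≠ ∞) {c : EuclideanSpace ℝ (Fin n)} {r : ℝ} (hr : 0 < r)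
    (hball : closedBall c r ⊆ E) (h : EuclideanSpace ℝ (Fin n)) :
    volume (E \ (fun x => x + h) ⁻¹' E) ≤
      ENNReal.ofReal (min 1 (n / r * ‖h‖)) * volume E := by
  rcases le_total 1 (n / r * ‖h‖) with h1 | h1
  · rw [min_eq_left h1, ENNReal.ofReal_one, one_mul]
    exact measure_mono Set.sdiff_subset
  rw [min_eq_right h1]
  rcases eq_or_ne h 0 with rfl | h0
  · simp
  have hh : 0 < ‖h‖ := norm_pos_iff.2 h0
  have hn : n ≠ 0 := by
    rintro rfl
    exact h0 (Subsingleton.elim _ _)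
  have hn1 : (1 : ℝ) ≤ n := by exact_mod_cast Nat.one_le_iff_ne_zero.2 hn
  set t : ℝ := ‖h‖ / r with ht
  have ht0 : 0 < t := by positivity
  have e1 : n / r * ‖h‖ = n * t := by rw [ht]; ring
  rw [e1] at h1 ⊢
  have ht1 : t ≤ 1 := by nlinarith
  have hsub : AffineMap.homothety c (1 - t) '' E ⊆ E ∩ (fun x => x + h) ⁻¹' E := by
    rintro _ ⟨y, hy, rfl⟩
    have hc' : c ∈ E := hball (mem_closedBall_self hr.le)
    rw [AffineMap.homothety_apply, vsub_eq_sub, vadd_eq_add]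
    constructor
    · convert hc hc' hy ht0.le (by linarith : 0 ≤ 1 - t) (by ring) using 1
      module
    · have h2 : c + t⁻¹ • h ∈ E := by
        refine hball ?_
        rw [mem_closedBall, dist_eq_norm, add_sub_cancel_left, norm_smul,
          Real.norm_of_nonneg (by positivity), ht]
        field_simp
        exact le_rfl
      have := hc h2 hy ht0.le (by linarith : 0 ≤ 1 - t) (by ring)
      rw [smul_add, smul_inv_smul₀ ht0.ne'] at this
      change _ + h ∈ E
      convert this using 1
      module
  have hmE : volume (E \ (fun x => x + h) ⁻¹' E) =
      volume E - volume (E ∩ (fun x => x + h) ⁻¹' E) := by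
    rw [← Set.sdiff_self_inter, measure_sdiff Set.inter_subset_left
      (hE.inter (measurable_add_const h hE)).nullMeasurableSet
      (ne_top_of_le_ne_top hfin (measure_mono Set.inter_subset_left))]
  have h3 : ENNReal.ofReal ((1 - t) ^ n) * volume E ≤
      volume (E ∩ (fun x => x + h) ⁻¹' E) := by
    refine le_trans (le_of_eq ?_) (measure_mono hsub)
    rw [Measure.addHaar_image_homothety, finrank_euclideanSpace_fin,
      abs_of_nonneg (pow_nonneg (by linarith) _)]
  have h4 : 1 - n * t ≤ (1 - t) ^ n := by
    have := one_add_mul_le_pow (a := -t) (by linarith) n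
    have e : 1 + -t = 1 - t := by ring
    rw [e] at this
    linarith
  rw [hmE, tsub_le_iff_right]
  calc volume E = ENNReal.ofReal (n * t + (1 - n * t)) * volume E := by
        rw [add_sub_cancel, ENNReal.ofReal_one, one_mul]
    _ = ENNReal.ofReal (n * t) * volume E + ENNReal.ofReal (1 - n * t) * volume E := by
        rw [ENNReal.ofReal_add (by positivity) (by linarith), add_mul]
    _ ≤ ENNReal.ofReal (n * t) * volume E + ENNReal.ofReal ((1 - t) ^ n) * volume E := by
        gcongr
    _ ≤ _ := by gcongr

/-- Bounded convex sets with nonempty interior have finite fractional perimeter. -/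
theorem Convex.fracPer_ne_top [NeZero n] (hs : s ∈ Set.Ioo (0 : ℝ) 1)
    {E : Set (EuclideanSpace ℝ (Fin n))} (hc : Convex ℝ E)
    (hE : MeasurableSet E) (hfin : volume E ≠ ∞) {c : EuclideanSpace ℝ (Fin n)} {r : ℝ} (hr : 0 < r)
    (hball : closedBall c r ⊆ E) : fracPer n s E ≠ ∞ := by
  rw [fracPer_eq_lintegral_volume hE]
  refine ne_top_of_le_ne_top (ENNReal.mul_ne_top
    (lintegral_norm_rpow_mul_min_ne_top (n := n) hs (a := n / r) (by positivity)) hfin) ?_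
  rw [← lintegral_mul_const _ (by fun_prop)]
  refine lintegral_mono fun h => ?_
  rw [ENNReal.ofReal_mul (by positivity), mul_assoc]
  gcongr
  exact volume_sdiff_preimage_add_le hc hE hfin hr hball h

theorem two_mul_mul_rpow_le_rpow_sub_rpow {q d e D h : ℝ} (hq : 2 ≤ q) (hd : 0 < d) (he0 : 0 ≤ e)
    (he : e ≤ D) (h0 : 0 ≤ h) (hde : e ^ 2 = d ^ 2 + 4 * h) :
    2 * q * D ^ (-q - 2) * h ≤ d ^ (-q) - e ^ (-q) := by
  have hde' : d ≤ e := abs_le_of_sq_le_sq' (by linarith) he0 |>.2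
  have he1 : 0 < e := hd.trans_le hde'
  have hD : 0 < D := he1.trans_le he
  have h1 : 1 + q / 2 * (4 * h / d ^ 2) ≤ (1 + 4 * h / d ^ 2) ^ (q / 2) :=
    one_add_mul_self_le_rpow_one_add (by linarith [show 0 ≤ 4 * h / d ^ 2 by positivity])
      (by linarith)
  have h2 : (1 + 4 * h / d ^ 2) ^ (q / 2) = e ^ q * d ^ (-q) := by
    have : 1 + 4 * h / d ^ 2 = (e / d) ^ (2 : ℝ) := by
      rw [Real.rpow_two, div_pow, hde]
      field_simp
    rw [this, ← Real.rpow_mul (by positivity), Real.div_rpow he1.le hd.le, Real.rpow_neg hd.le]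
    rw [show 2 * (q / 2) = q by ring]
    rfl
  have h3 : e ^ (-q) * (1 + q / 2 * (4 * h / d ^ 2)) ≤ d ^ (-q) := by
    refine (mul_le_mul_of_nonneg_left h1 (by positivity)).trans (le_of_eq ?_)
    rw [h2, ← mul_assoc, ← Real.rpow_add he1]
    simp
  have h4 : D ^ (-q - 2) ≤ e ^ (-q) * (d ^ 2)⁻¹ := by
    rw [sub_eq_add_neg, Real.rpow_add hD, ← Real.rpow_natCast d 2, ← Real.rpow_neg hd.le]
    refine mul_le_mul (Real.rpow_le_rpow_of_nonpos he1 he (by linarith)) ?_ (by positivity)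
      (by positivity)
    exact Real.rpow_le_rpow_of_nonpos hd (hde'.trans he) (by norm_num)
  calc 2 * q * D ^ (-q - 2) * h ≤ 2 * q * (e ^ (-q) * (d ^ 2)⁻¹) * h := by gcongr
    _ = e ^ (-q) * (1 + q / 2 * (4 * h / d ^ 2)) - e ^ (-q) := by ring
    _ ≤ _ := by linarith

/-- The part of `E` not matched by reflection across a hyperplane through the barycenter has small
first moment when the deficit is small. -/
theorem lintegral_inner_oddPart_le (hq : 2 ≤ (n : ℝ) + s) {E : Set (EuclideanSpace ℝ (Fin n))}
    (hE : MeasurableSet E) (hvol : volume E = volume (ball (0 : EuclideanSpace ℝ (Fin n)) 1))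
    (hbar : ∫ x in E, x = 0) {D : ℝ} (hD : ∀ x ∈ E, ∀ y ∈ E, dist x y ≤ D) (h0 : 0 ∈ E)
    (hP : fracPer n s E ≠ ∞) {v : EuclideanSpace ℝ (Fin n)} (hv : v ≠ 0) :
    ∫⁻ x in oddPart (hypRefl v 0) {x | 0 < inner ℝ x v} E, ENNReal.ofReal (inner ℝ x v) ≤
      ENNReal.ofReal (‖v‖ * √(((fracPer n s E).toReal -
        (fracPer n s (ball (0 : EuclideanSpace ℝ (Fin n)) 1)).toReal) /
          (4 * (n + s) * D ^ (-((n : ℝ) + s) - 2)))) ∧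
    ∫⁻ x in oddPart (hypRefl v 0) {x | 0 < inner ℝ x v} Eᶜ, ENNReal.ofReal (inner ℝ x v) =
      ∫⁻ x in oddPart (hypRefl v 0) {x | 0 < inner ℝ x v} E, ENNReal.ofReal (inner ℝ x v) := by
  have h := isReflection_hypRefl hv 0
  set σ := hypRefl v 0 with hσ
  set H := {x : EuclideanSpace ℝ (Fin n) | 0 < inner ℝ x v} with hH
  set A := oddPart σ H E with hA
  set A' := oddPart σ H Eᶜ with hA'
  have mA : MeasurableSet A := h.measurableSet_oddPart hE
  have mA' : MeasurableSet A' := h.measurableSet_oddPart hE.compl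
  have mS : MeasurableSet (E ∩ σ ⁻¹' E) := hE.inter (h.measurable hE)
  set f : EuclideanSpace ℝ (Fin n) → ℝ≥0∞ := fun x => ENNReal.ofReal (inner ℝ x v) with hf
  have mf : Measurable f := by fun_prop
  have hR : E ⊆ closedBall 0 D := fun x hx => mem_closedBall.2 (hD x hx 0 h0)
  have hvn : 0 < ‖v‖ := norm_pos_iff.2 hv
  have hinner : ∀ x, inner ℝ (σ x) v = -inner ℝ x v := by
    intro x
    rw [hσ, inner_hypRefl hv]
    ring
  have hint : IntegrableOn (fun x : EuclideanSpace ℝ (Fin n) => x) E :=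
    (continuous_id.continuousOn.integrableOn_compact (isCompact_closedBall 0 D)).mono_set hR
  have hint' : IntegrableOn (fun x : EuclideanSpace ℝ (Fin n) => inner ℝ x v) E :=
    hint.inner_const v
  have hzero : ∫ x in E, (inner ℝ x v : ℝ) = 0 := by
    have h1 := integral_inner (𝕜 := ℝ) hint v
    rw [hbar, inner_zero_right] at h1
    simpa [real_inner_comm] using h1
  have hfin : ∫⁻ x in E, f x ≠ ∞ := hint'.lintegral_lt_top.ne
  have hfin' : ∫⁻ x in E, f (σ x) ≠ ∞ := by
    simp only [hf, hinner]
    exact hint'.neg.lintegral_lt_top.ne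
  have heq : ∫⁻ x in E, f x = ∫⁻ x in E, f (σ x) := by
    rw [integral_eq_lintegral_pos_part_sub_lintegral_neg_part hint', sub_eq_zero] at hzero
    simp only [hf, hinner] at hfin hfin' ⊢
    exact (ENNReal.toReal_eq_toReal_iff' hfin hfin').1 hzero
  have hdisj : Disjoint A (σ ⁻¹' A') := by
    rw [Set.disjoint_left]
    intro x hx hx'
    have h1 : (0 : ℝ) < inner ℝ x v := hx.1
    have h2 : (0 : ℝ) < inner ℝ (σ x) v := hx'.1
    rw [hinner] at h2
    linarith
  have hdisj' : Disjoint (E ∩ σ ⁻¹' E) (A ∪ σ ⁻¹' A') := by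
    rw [Set.disjoint_left]
    rintro x hx (hx' | hx')
    · exact hx'.2.2 hx.2
    · exact hx'.2.1 hx.2
  have hsplit : ∀ g : EuclideanSpace ℝ (Fin n) → ℝ≥0∞, ∫⁻ x in E, g x =
      (∫⁻ x in E ∩ σ ⁻¹' E, g x) + ((∫⁻ x in A, g x) + ∫⁻ x in σ ⁻¹' A', g x) := by
    intro g
    conv_lhs => rw [h.eq_union (F := E)]
    rw [lintegral_union (mA.union (h.measurable mA')) hdisj',
      lintegral_union (h.measurable mA') hdisj]
  have hS : ∫⁻ x in E ∩ σ ⁻¹' E, f (σ x) = ∫⁻ x in E ∩ σ ⁻¹' E, f x := by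
    rw [← h.setLIntegral_preimage mS mf, Set.preimage_inter, h.preimage_preimage, Set.inter_comm]
  have hz1 : ∫⁻ x in σ ⁻¹' A', f x = 0 := by
    rw [h.setLIntegral_preimage mA' mf]
    refine setLIntegral_eq_zero mA' fun x hx => ?_
    have : (0 : ℝ) < inner ℝ x v := hx.1
    simp only [hf, hinner, Pi.zero_apply, ENNReal.ofReal_eq_zero]
    linarith
  have hz2 : ∫⁻ x in A, f (σ x) = 0 := by
    refine setLIntegral_eq_zero mA fun x hx => ?_
    have : (0 : ℝ) < inner ℝ x v := hx.1
    simp only [hf, hinner, Pi.zero_apply, ENNReal.ofReal_eq_zero]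
    linarith
  have hA3 : ∫⁻ x in σ ⁻¹' A', f (σ x) = ∫⁻ x in A', f x := by
    rw [h.setLIntegral_preimage mA' (f := fun x => f (σ x)) (mf.comp h.measurable)]
    simp only [h.involutive _]
  have hS_fin : ∫⁻ x in E ∩ σ ⁻¹' E, f x ≠ ∞ :=
    ne_top_of_le_ne_top hfin (lintegral_mono_set Set.inter_subset_left)
  have hAA' : ∫⁻ x in A', f x = ∫⁻ x in A, f x := by
    rw [hsplit f, hsplit (fun x => f (σ x)), hS, hz1, hz2, hA3, zero_add, add_zero,
      ENNReal.add_right_inj hS_fin] at heq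
    exact heq.symm
  refine ⟨?_, hAA'⟩
  set a := ∫⁻ x in A, f x with ha
  have ha_fin : a ≠ ∞ := ne_top_of_le_ne_top hfin
    (lintegral_mono_set fun x hx => hx.2.1)
  rcases eq_or_ne a 0 with ha0 | ha0
  · rw [ha0]; exact zero_le
  have hq0 : 0 < (n : ℝ) + s := by linarith
  have hD0 : 0 < D := by
    by_contra hD0
    refine ha0 (setLIntegral_eq_zero mA fun x hx => ?_)
    have h1 := hD x hx.2.1 0 h0
    have h2 : x = 0 := dist_le_zero.1 (by linarith)
    simp [h2, hf]
  set c : ℝ := 2 * (n + s) * D ^ (-((n : ℝ) + s) - 2) with hc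
  have hc0 : 0 < c := by positivity
  have hG : ENNReal.ofReal (c / ‖v‖ ^ 2) * (a * a) ≤
      ∫⁻ x in A, ∫⁻ y in A', (fracKer n s x y - fracKer n s x (σ y)) := by
    have e1 : ENNReal.ofReal (c / ‖v‖ ^ 2) * (a * a) =
        ∫⁻ x in A, ∫⁻ y in A', ENNReal.ofReal (c / ‖v‖ ^ 2) * (f x * f y) := by
      have e2 : ∀ x, ∫⁻ y in A', ENNReal.ofReal (c / ‖v‖ ^ 2) * (f x * f y) =
          ENNReal.ofReal (c / ‖v‖ ^ 2) * (f x * a) := by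
        intro x
        rw [lintegral_const_mul _ (by fun_prop), lintegral_const_mul _ mf, hAA']
      simp only [e2]
      rw [lintegral_const_mul _ (by fun_prop), lintegral_mul_const _ mf]
    rw [e1]
    refine setLIntegral_mono' mA fun x hx => setLIntegral_mono' mA' fun y hy => ?_
    have hx0 : (0 : ℝ) < inner ℝ x v := hx.1
    have hy0 : (0 : ℝ) < inner ℝ y v := hy.1
    have hyE : σ y ∈ E := not_not.1 hy.2.2
    rw [fracKer_eq_dist, fracKer_eq_dist, ← ENNReal.ofReal_sub _ (by positivity), hf,
      ← ENNReal.ofReal_mul hx0.le, ← ENNReal.ofReal_mul (by positivity)]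
    refine ENNReal.ofReal_le_ofReal ?_
    have hxy : x ≠ y := fun e => hy.2.1 (e ▸ hx.2.1)
    have := two_mul_mul_rpow_le_rpow_sub_rpow (q := n + s) (d := dist x y) (e := dist x (σ y))
      (D := D) (h := inner ℝ x v * inner ℝ y v / ‖v‖ ^ 2) hq (dist_pos.2 hxy) dist_nonneg
      (hD x hx.2.1 _ hyE) (by positivity) (by rw [hσ, sq_dist_hypRefl hv]; ring)
    refine le_trans (le_of_eq ?_) this
    rw [hc]
    ring
  have hB := fracPer_ball_le hq0 (h.measurableSet_polarize hE) (R := D) ?_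
    ((h.volume_polarize hE).trans hvol)
  · have hE' := h.fracPer_eq_fracPer_polarize_add hE hq0
    have h1 : fracPer n s (ball 0 1) + 2 * (ENNReal.ofReal (c / ‖v‖ ^ 2) * (a * a)) ≤
        fracPer n s E := by
      rw [hE']
      gcongr
    have h2 := ENNReal.toReal_mono hP h1
    have hBfin : fracPer n s (ball (0 : EuclideanSpace ℝ (Fin n)) 1) ≠ ∞ :=
      ne_top_of_le_ne_top hP (le_self_add.trans h1)
    rw [ENNReal.toReal_add hBfin (ENNReal.mul_ne_top (by simp) (ENNReal.mul_ne_top (by simp)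
      (ENNReal.mul_ne_top ha_fin ha_fin))), ENNReal.toReal_mul, ENNReal.toReal_mul,
      ENNReal.toReal_mul, ENNReal.toReal_ofReal (by positivity), ENNReal.toReal_ofNat] at h2
    rw [← ENNReal.ofReal_toReal ha_fin]
    refine ENNReal.ofReal_le_ofReal ?_
    rw [← div_le_iff₀' hvn]
    refine Real.le_sqrt_of_sq_le ?_
    rw [le_div_iff₀ (by positivity)]
    calc _ = 2 * (c / ‖v‖ ^ 2 * (a.toReal * a.toReal)) := by rw [hc, div_pow]; ring
      _ ≤ _ := by linarith
  · have hsig : ∀ x, ‖σ x‖ = ‖x‖ := by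
      intro x
      have e0 : σ 0 = 0 := by simp [hσ, hypRefl]
      have := h.isometry.dist_eq x 0
      rwa [e0, dist_zero_right, dist_zero_right] at this
    rintro x (hx | hx | hx)
    · exact hR hx.1
    · exact hR hx.2.1
    · have h3 := hR (not_not.1 hx.2.2 : σ x ∈ E)
      rw [mem_closedBall_zero_iff] at h3 ⊢
      rwa [hsig] at h3

theorem lintegral_abs_inner_le (hq : 2 ≤ (n : ℝ) + s) {E : Set (EuclideanSpace ℝ (Fin n))}
    (hE : MeasurableSet E) (hvol : volume E = volume (ball (0 : EuclideanSpace ℝ (Fin n)) 1))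
    (hbar : ∫ x in E, x = 0) {D : ℝ} (hD : ∀ x ∈ E, ∀ y ∈ E, dist x y ≤ D) (h0 : 0 ∈ E)
    (hP : fracPer n s E ≠ ∞) (v : EuclideanSpace ℝ (Fin n)) :
    ∫⁻ x in {x | ¬(x ∈ E ↔ hypRefl v 0 x ∈ E)}, ENNReal.ofReal |inner ℝ x v| ≤
      ENNReal.ofReal (4 * (‖v‖ * √(((fracPer n s E).toReal -
        (fracPer n s (ball (0 : EuclideanSpace ℝ (Fin n)) 1)).toReal) /
          (4 * (n + s) * D ^ (-((n : ℝ) + s) - 2))))) := by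
  rcases eq_or_ne v 0 with rfl | hv
  · simp
  obtain ⟨h1, h2⟩ := lintegral_inner_oddPart_le hq hE hvol hbar hD h0 hP hv
  have h := isReflection_hypRefl hv 0
  set σ := hypRefl v 0 with hσ
  set H := {x : EuclideanSpace ℝ (Fin n) | 0 < inner ℝ x v} with hH
  have mA := h.measurableSet_oddPart hE
  have mA' := h.measurableSet_oddPart hE.compl
  have hinner : ∀ x, inner ℝ (σ x) v = -inner ℝ x v := by
    intro x
    rw [hσ, inner_hypRefl hv]
    ring
  have hsub : {x | ¬(x ∈ E ↔ σ x ∈ E)} ⊆ (oddPart σ H E ∪ oddPart σ H Eᶜ) ∪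
      (σ ⁻¹' oddPart σ H E ∪ σ ⁻¹' oddPart σ H Eᶜ) := by
    intro x hx
    have h3 := h.mem_iff x
    have h4 := h.involutive x
    have h5 : σ x ≠ x := fun e => hx (by rw [e])
    have h3 := h3 h5
    simp only [Set.mem_ofPred_eq] at hx
    simp only [oddPart, Set.mem_union, Set.mem_preimage, Set.mem_ofPred_eq, Set.mem_compl_iff, h4]
    tauto
  have habs : ∀ B : Set (EuclideanSpace ℝ (Fin n)), MeasurableSet B → B ⊆ H →
      ∫⁻ x in B, ENNReal.ofReal |inner ℝ x v| = ∫⁻ x in B, ENNReal.ofReal (inner ℝ x v) := by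
    intro B mB hB
    refine setLIntegral_congr_fun mB fun x hx => ?_
    simp only [abs_of_pos (show (0 : ℝ) < inner ℝ x v from hB hx)]
  have hpre : ∀ B : Set (EuclideanSpace ℝ (Fin n)), MeasurableSet B →
      ∫⁻ x in σ ⁻¹' B, ENNReal.ofReal |inner ℝ x v| =
        ∫⁻ x in B, ENNReal.ofReal |inner ℝ x v| := by
    intro B mB
    rw [h.setLIntegral_preimage mB (by fun_prop)]
    simp only [hinner, abs_neg]
  refine (lintegral_mono_set hsub).trans ?_
  refine (lintegral_union_le _ _ _).trans ?_
  refine (add_le_add (lintegral_union_le _ _ _) (lintegral_union_le _ _ _)).trans ?_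
  rw [hpre _ mA, hpre _ mA', habs _ mA fun x hx => hx.1, habs _ mA' fun x hx => hx.1, h2,
    ENNReal.ofReal_mul (by norm_num), ENNReal.ofReal_ofNat]
  calc _ = 4 * ∫⁻ x in oddPart σ H E, ENNReal.ofReal (inner ℝ x v) := by ring
    _ ≤ _ := by gcongr

theorem exists_volume_slab_le {κ : ℝ≥0∞} (hκ : κ ≠ 0) :
    ∃ c : ℝ, 0 < c ∧ ∀ u : EuclideanSpace ℝ (Fin n), ‖u‖ = 1 →
      volume {v ∈ ball (0 : EuclideanSpace ℝ (Fin n)) 1 | |inner ℝ u v| < c} ≤ κ := by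
  obtain ⟨N, hN⟩ := ENNReal.exists_nat_mul_gt hκ
    (measure_ball_lt_top (μ := volume) (x := (0 : EuclideanSpace ℝ (Fin n))) (r := 2)).ne
  have hN0 : N ≠ 0 := by
    rintro rfl
    simp at hN
  have hN1 : (0 : ℝ) < N := by exact_mod_cast Nat.pos_of_ne_zero hN0
  refine ⟨1 / (2 * N), by positivity, fun u hu => ?_⟩
  set S := {v ∈ ball (0 : EuclideanSpace ℝ (Fin n)) 1 | |inner ℝ u v| < 1 / (2 * N)} with hS
  have mS : MeasurableSet S := measurableSet_ball.inter
    (measurableSet_lt (f := fun v => |inner ℝ u v|) (by fun_prop) measurable_const)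
  have h := natCast_mul_volume_le (Y := ball 0 2) mS ((1 / (N : ℝ)) • u) N ?_ ?_
  · have h2 := h.trans hN.le
    exact (ENNReal.mul_le_mul_iff_right (by simpa using hN0) (by simp)).1 h2
  · intro k hk x hx
    have h1 := hx.1
    rw [mem_ball_zero_iff] at h1 ⊢
    have hkN : (k : ℝ) < N := by exact_mod_cast hk
    refine (norm_add_le _ _).trans_lt ?_
    rw [smul_smul, norm_smul, hu, mul_one, Real.norm_of_nonneg (by positivity), mul_one_div]
    have : (k : ℝ) / N ≤ 1 := (div_le_one hN1).2 hkN.le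
    linarith
  · intro k _ l _ x hx y hy he
    have h1 : inner ℝ u x - inner ℝ u y = ((l : ℝ) - k) * (1 / N) := by
      have := congrArg (inner ℝ u) he
      simp only [inner_add_right, inner_smul_right, real_inner_self_eq_norm_sq, hu] at this
      linarith
    have h2 := abs_sub (inner ℝ u x) (inner ℝ u y)
    have h3 := hx.2
    have h4 := hy.2
    have h5 : |((l : ℝ) - k) * (1 / N)| < 1 / N := by
      rw [← h1]
      refine h2.trans_lt ((add_lt_add h3 h4).trans_le (le_of_eq ?_))
      field_simp
      norm_num
    rw [abs_mul, abs_of_pos (by positivity : (0 : ℝ) < 1 / N)] at h5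
    have h6 : |(l : ℝ) - k| < 1 := by
      by_contra hcon
      push Not at hcon
      have : 0 < 1 / (N : ℝ) := by positivity
      nlinarith
    have h7 : |(l : ℤ) - k| < 1 := by exact_mod_cast h6
    rw [Int.abs_lt_one_iff] at h7
    omega

/-- The reflection of `u` across the hyperplane orthogonal to `v`, scaled by `‖v‖ ^ 2`. -/
noncomputable def scaledRefl (u v : EuclideanSpace ℝ (Fin n)) : EuclideanSpace ℝ (Fin n) :=
  ‖v‖ ^ 2 • u - (2 * inner ℝ u v) • v

theorem measurable_scaledRefl (u : EuclideanSpace ℝ (Fin n)) : Measurable (scaledRefl u) := by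
  unfold scaledRefl
  fun_prop

theorem lipschitzOnWith_scaledRefl {u : EuclideanSpace ℝ (Fin n)} (hu : ‖u‖ = 1) :
    LipschitzOnWith 6 (scaledRefl u) (ball 0 1) := by
  refine LipschitzOnWith.of_dist_le_mul fun v hv w hw => ?_
  rw [mem_ball_zero_iff] at hv hw
  rw [dist_eq_norm, dist_eq_norm]
  have e : scaledRefl u v - scaledRefl u w = ((‖v‖ + ‖w‖) * (‖v‖ - ‖w‖)) • u -
      ((2 * inner ℝ u (v - w)) • v + (2 * inner ℝ u w) • (v - w)) := by
    unfold scaledRefl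
    rw [inner_sub_right]
    module
  have h1 := abs_norm_sub_norm_le v w
  have h2 : |inner ℝ u (v - w)| ≤ ‖v - w‖ := by
    simpa [hu] using abs_real_inner_le_norm u (v - w)
  have h3 : |inner ℝ u w| ≤ 1 := by
    have := abs_real_inner_le_norm u w
    rw [hu, one_mul] at this
    linarith
  rw [e]
  refine (norm_sub_le _ _).trans ?_
  refine (add_le_add_right (norm_add_le _ _) _).trans ?_
  simp only [norm_smul, hu, Real.norm_eq_abs, abs_mul, abs_two, mul_one]
  have h4 : |‖v‖ + ‖w‖| ≤ 2 := by
    rw [abs_of_nonneg (by positivity)]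
    linarith
  have h5 : |‖v‖ + ‖w‖| * |‖v‖ - ‖w‖| ≤ 2 * ‖v - w‖ := by gcongr
  have h6 : |inner ℝ u (v - w)| * ‖v‖ ≤ ‖v - w‖ * 1 := by gcongr
  have h7 : |inner ℝ u w| * ‖v - w‖ ≤ 1 * ‖v - w‖ := by gcongr
  have h8 : ((6 : NNReal) : ℝ) = 6 := rfl
  rw [h8]
  linarith

theorem exists_unit_scaledRefl_eq (hn : 2 ≤ n) {u w : EuclideanSpace ℝ (Fin n)} (hu : ‖u‖ = 1)
    (hw : ‖w‖ = 1) : ∃ e : EuclideanSpace ℝ (Fin n), ‖e‖ = 1 ∧ scaledRefl u e = w := by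
  rcases eq_or_ne u w with rfl | huw
  · have hne : (Submodule.span ℝ {u})ᗮ ≠ ⊥ := by
      intro h
      rw [Submodule.orthogonal_eq_bot_iff] at h
      have h1 := finrank_span_le_card (R := ℝ) ({u} : Set (EuclideanSpace ℝ (Fin n)))
      rw [h, finrank_top, finrank_euclideanSpace_fin] at h1
      simp at h1
      omega
    obtain ⟨e, he, he0⟩ := Submodule.exists_mem_ne_zero_of_ne_bot hne
    rw [Submodule.mem_orthogonal_singleton_iff_inner_right] at he
    have h1 : ‖‖e‖⁻¹ • e‖ = 1 := norm_smul_inv_norm he0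
    refine ⟨‖e‖⁻¹ • e, h1, ?_⟩
    rw [scaledRefl, inner_smul_right, he, h1]
    simp
  · have h0 : 0 < ‖u - w‖ := norm_sub_pos_iff.2 huw
    have h1 : ‖‖u - w‖⁻¹ • (u - w)‖ = 1 := norm_smul_inv_norm (sub_ne_zero.2 huw)
    refine ⟨‖u - w‖⁻¹ • (u - w), h1, ?_⟩
    have h2 : ‖u - w‖ ^ 2 = 2 * inner ℝ u (u - w) := by
      rw [norm_sub_sq_real, inner_sub_right, real_inner_self_eq_norm_sq, hu, hw]
      ring
    rw [scaledRefl, h1, inner_smul_right, smul_smul]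
    have h3 : 2 * (‖u - w‖⁻¹ * inner ℝ u (u - w)) * ‖u - w‖⁻¹ = 1 := by
      field_simp
      linarith
    rw [h3]
    module

theorem exists_scaledRefl_eq (hn : 2 ≤ n) {u z : EuclideanSpace ℝ (Fin n)} (hu : ‖u‖ = 1)
    (hz : z ∈ ball 0 1) (hz0 : z ≠ 0) : ∃ v ∈ ball 0 1, scaledRefl u v = z := by
  obtain ⟨e, he, hez⟩ := exists_unit_scaledRefl_eq hn hu (norm_smul_inv_norm (𝕜 := ℝ) hz0)
  have h0 : 0 < ‖z‖ := norm_pos_iff.2 hz0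
  rw [mem_ball_zero_iff] at hz
  have h1 : scaledRefl u (√‖z‖ • e) = ‖z‖ • scaledRefl u e := by
    unfold scaledRefl
    rw [inner_smul_right, norm_smul, smul_smul, mul_pow, Real.norm_eq_abs, sq_abs,
      Real.sq_sqrt h0.le, smul_sub, smul_smul, smul_smul]
    congr 2
    linear_combination (2 * inner ℝ u e) * Real.mul_self_sqrt h0.le
  refine ⟨√‖z‖ • e, ?_, ?_⟩
  · rw [mem_ball_zero_iff, norm_smul, he, mul_one, Real.norm_of_nonneg (Real.sqrt_nonneg _),
      Real.sqrt_lt' one_pos]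
    simpa using hz
  · rw [h1, hez]
    exact smul_inv_smul₀ h0.ne' z

theorem norm_scaledRefl {u : EuclideanSpace ℝ (Fin n)} (hu : ‖u‖ = 1)
    (v : EuclideanSpace ℝ (Fin n)) : ‖scaledRefl u v‖ = ‖v‖ ^ 2 := by
  rw [← sq_eq_sq₀ (norm_nonneg _) (by positivity), scaledRefl, norm_sub_sq_real, norm_smul,
    norm_smul, inner_smul_left, inner_smul_right, hu, Real.norm_eq_abs, Real.norm_eq_abs, mul_pow,
    mul_pow, sq_abs, sq_abs]
  simp
  ring

theorem hypRefl_smul {u v : EuclideanSpace ℝ (Fin n)} (hv : v ≠ 0) (hu : ‖u‖ = 1) (r : ℝ) :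
    hypRefl v 0 (r • u) = r • (‖scaledRefl u v‖⁻¹ • scaledRefl u v) := by
  have h0 : ‖v‖ ≠ 0 := norm_ne_zero_iff.2 hv
  rw [norm_scaledRefl hu, scaledRefl, hypRefl, smul_sub, smul_smul, smul_smul,
    inv_mul_cancel₀ (pow_ne_zero 2 h0), real_inner_smul_left, smul_sub, one_smul, smul_smul]
  congr 2
  ring

/-- If `T` fills half of the unit ball, then so do, quantitatively and away from `uᗮ`, the normals
reflecting `u` into the direction of a point of `T`. -/
theorem exists_le_lintegral_scaledRefl (hn : 2 ≤ n) :
    ∃ c : ℝ≥0∞, c ≠ 0 ∧ c ≠ ∞ ∧ ∀ T : Set (EuclideanSpace ℝ (Fin n)), MeasurableSet T → 0 ∉ T →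
      volume (ball (0 : EuclideanSpace ℝ (Fin n)) 1) / 2 ≤ volume (ball 0 1 ∩ T) →
      ∀ u : EuclideanSpace ℝ (Fin n), ‖u‖ = 1 →
        c ≤ ∫⁻ v in ball 0 1 ∩ scaledRefl u ⁻¹' T, ENNReal.ofReal |inner ℝ u v| := by
  set ω := volume (ball (0 : EuclideanSpace ℝ (Fin n)) 1) with hω
  have hω0 : ω ≠ 0 := (measure_ball_pos _ _ one_pos).ne'
  have hωt : ω ≠ ∞ := measure_ball_lt_top.ne
  set m : ℝ≥0∞ := ω / 2 / 6 ^ n with hm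
  have hm0 : m ≠ 0 := by
    rw [hm]
    exact (ENNReal.div_pos (ENNReal.div_pos hω0 (by simp)).ne' (by simp)).ne'
  have hmt : m ≠ ∞ := ENNReal.div_ne_top (ENNReal.div_ne_top hωt (by simp)) (by simp)
  obtain ⟨c, hc, hslab⟩ := exists_volume_slab_le (n := n) (κ := m / 2)
    (ENNReal.div_pos hm0 (by simp)).ne'
  refine ⟨ENNReal.ofReal c * (m / 2), mul_ne_zero (by simpa using hc)
    (ENNReal.div_pos hm0 (by simp)).ne', ENNReal.mul_ne_top (by simp)
    (ENNReal.div_ne_top hmt (by simp)), fun T mT hT0 hT u hu => ?_⟩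
  set S := ball 0 1 ∩ scaledRefl u ⁻¹' T with hS
  have mS : MeasurableSet S := measurableSet_ball.inter (measurable_scaledRefl u mT)
  have h1 : m ≤ volume S := by
    rw [hm]
    refine ENNReal.div_le_of_le_mul ?_
    rw [mul_comm]
    refine hT.trans ((measure_mono (fun z hz => ?_)).trans (volume_image_le_of_lipschitzOnWith
      ((lipschitzOnWith_scaledRefl hu).mono (s := S) Set.inter_subset_left)))
    obtain ⟨v, hv, rfl⟩ := exists_scaledRefl_eq hn hu hz.1 (fun h => hT0 (h ▸ hz.2))
    exact ⟨v, ⟨hv, hz.2⟩, rfl⟩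
  set S' := S \ {v ∈ ball (0 : EuclideanSpace ℝ (Fin n)) 1 | |inner ℝ u v| < c} with hS'
  have mS' : MeasurableSet S' := mS.diff (measurableSet_ball.inter
    (measurableSet_lt (f := fun v => |inner ℝ u v|) (by fun_prop) measurable_const))
  have h2 : m / 2 ≤ volume S' := by
    have h3 : m ≤ volume S' + m / 2 := by
      refine h1.trans ((measure_mono (?_ : S ⊆ S' ∪ _)).trans ((measure_union_le _ _).trans
        (add_le_add_right (hslab u hu) _)))
      rw [hS', Set.sdiff_union_self]
      exact Set.subset_union_left
    have h4 : m - m / 2 ≤ volume S' := tsub_le_iff_right.2 h3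
    rwa [ENNReal.sub_half hmt] at h4
  calc ENNReal.ofReal c * (m / 2) ≤ ENNReal.ofReal c * volume S' := by gcongr
    _ = ∫⁻ v in S', ENNReal.ofReal c := (setLIntegral_const _ _).symm
    _ ≤ ∫⁻ v in S', ENNReal.ofReal |inner ℝ u v| := by
        refine setLIntegral_mono' mS' fun v hv => ENNReal.ofReal_le_ofReal ?_
        by_contra hcon
        exact hv.2 ⟨hv.1.1, not_le.1 hcon⟩
    _ ≤ _ := lintegral_mono_set Set.sdiff_subset

theorem hypRefl_mem_iff_of_scaledRefl {E : Set (EuclideanSpace ℝ (Fin n))} (hc : Convex ℝ E)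
    (h0 : 0 ∈ E) {x v : EuclideanSpace ℝ (Fin n)} (hx : x ≠ 0) (hv : v ≠ 0) :
    (‖x‖ ≤ 1 → ‖scaledRefl (‖x‖⁻¹ • x) v‖⁻¹ • scaledRefl (‖x‖⁻¹ • x) v ∈ E → hypRefl v 0 x ∈ E) ∧
    (1 ≤ ‖x‖ → ‖scaledRefl (‖x‖⁻¹ • x) v‖⁻¹ • scaledRefl (‖x‖⁻¹ • x) v ∉ E →
      hypRefl v 0 x ∉ E) := by
  have hx0 : 0 < ‖x‖ := norm_pos_iff.2 hx
  have h1 := hypRefl_smul hv (norm_smul_inv_norm (𝕜 := ℝ) hx) ‖x‖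
  simp only [RCLike.ofReal_real_eq_id, id] at h1
  rw [smul_inv_smul₀ hx0.ne'] at h1
  refine ⟨fun h2 h3 => ?_, fun h2 h3 h4 => h3 ?_⟩
  · rw [h1]
    exact hc.smul_mem_of_zero_mem h0 h3 ⟨hx0.le, h2⟩
  · rw [h1] at h4
    have := hc.smul_mem_of_zero_mem h0 h4 (t := ‖x‖⁻¹) ⟨by positivity, inv_le_one_of_one_le₀ h2⟩
    rwa [inv_smul_smul₀ hx0.ne'] at this

theorem mul_lintegral_norm_le {E X : Set (EuclideanSpace ℝ (Fin n))} (hE : MeasurableSet E)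
    (hX : MeasurableSet X) {c ε : ℝ≥0∞} (hx0 : ∀ x ∈ X, x ≠ 0)
    (hc : ∀ x ∈ X, ∃ V ⊆ ball (0 : EuclideanSpace ℝ (Fin n)) 1, MeasurableSet V ∧
      c ≤ ∫⁻ v in V, ENNReal.ofReal |inner ℝ (‖x‖⁻¹ • x) v| ∧
      ∀ v ∈ V, ¬(x ∈ E ↔ hypRefl v 0 x ∈ E))
    (hε : ∀ v ∈ ball (0 : EuclideanSpace ℝ (Fin n)) 1,
      ∫⁻ x in {x | ¬(x ∈ E ↔ hypRefl v 0 x ∈ E)}, ENNReal.ofReal |inner ℝ x v| ≤ ε) :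
    c * ∫⁻ x in X, ENNReal.ofReal ‖x‖ ≤
      ε * volume (ball (0 : EuclideanSpace ℝ (Fin n)) 1) := by
  set U : Set (EuclideanSpace ℝ (Fin n) × EuclideanSpace ℝ (Fin n)) :=
    {p | ¬(p.1 ∈ E ↔ hypRefl p.2 0 p.1 ∈ E)} with hU
  have mr : Measurable fun p : EuclideanSpace ℝ (Fin n) × EuclideanSpace ℝ (Fin n) =>
      hypRefl p.2 0 p.1 := by
    unfold hypRefl
    fun_prop
  have mU : MeasurableSet U := by
    have h1 : MeasurableSet ((Prod.fst ⁻¹' E : Set (EuclideanSpace ℝ (Fin n) × _)) ∆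
      ((fun p : EuclideanSpace ℝ (Fin n) × EuclideanSpace ℝ (Fin n) =>
        hypRefl p.2 0 p.1) ⁻¹' E)) := (measurable_fst hE).symmDiff (mr hE)
    convert h1 using 1
    ext p
    simp only [hU, Set.mem_ofPred_eq, Set.mem_symmDiff, Set.mem_preimage]
    tauto
  have mg : Measurable fun p : EuclideanSpace ℝ (Fin n) × EuclideanSpace ℝ (Fin n) =>
      U.indicator (fun p => ENNReal.ofReal |inner ℝ p.1 p.2|) p :=
    Measurable.indicator (by fun_prop) mU
  have h1 : c * ∫⁻ x in X, ENNReal.ofReal ‖x‖ ≤ ∫⁻ x in X, ∫⁻ v in ball 0 1,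
      U.indicator (fun p => ENNReal.ofReal |inner ℝ p.1 p.2|) (x, v) := by
    rw [← lintegral_const_mul _ (by fun_prop)]
    refine setLIntegral_mono' hX fun x hx => ?_
    obtain ⟨V, hVb, mV, hcV, hV⟩ := hc x hx
    have hn0 : 0 < ‖x‖ := norm_pos_iff.2 (hx0 x hx)
    calc c * ENNReal.ofReal ‖x‖ ≤
        (∫⁻ v in V, ENNReal.ofReal |inner ℝ (‖x‖⁻¹ • x) v|) * ENNReal.ofReal ‖x‖ := by gcongr
      _ = ∫⁻ v in V, U.indicator (fun p => ENNReal.ofReal |inner ℝ p.1 p.2|) (x, v) := by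
        rw [← lintegral_mul_const _ (by fun_prop)]
        refine setLIntegral_congr_fun mV fun v hv => ?_
        have hU' : (x, v) ∈ U := hV v hv
        simp only [Set.indicator_of_mem hU']
        rw [← ENNReal.ofReal_mul (abs_nonneg _), real_inner_smul_left, abs_mul,
          abs_of_pos (inv_pos.2 hn0)]
        congr 1
        field_simp
      _ ≤ _ := lintegral_mono_set hVb
  refine h1.trans ?_
  rw [lintegral_lintegral_swap mg.aemeasurable, ← setLIntegral_const]
  refine setLIntegral_mono' measurableSet_ball fun v hv => le_trans ?_ (hε v hv)
  have mUv : MeasurableSet {x | ¬(x ∈ E ↔ hypRefl v 0 x ∈ E)} :=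
    (measurable_id.prodMk measurable_const) mU
  rw [← lintegral_indicator mUv]
  refine (setLIntegral_le_lintegral _ _).trans (lintegral_mono fun x => le_of_eq ?_)
  rfl

open scoped Pointwise in
theorem two_mul_volume_inter_ball_le [NeZero n] {E : Set (EuclideanSpace ℝ (Fin n))}
    (hc : Convex ℝ E) (h0 : 0 ∈ E) :
    2 * volume ((ball 0 1 \ E) ∩ ball 0 (1 / 2)) ≤ volume (ball 0 1 \ E) := by
  have hn : n ≠ 0 := NeZero.ne n
  have h1 : volume ((2 : ℝ) • ((ball 0 1 \ E) ∩ ball 0 (1 / 2))) ≤ volume (ball 0 1 \ E) := by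
    refine measure_mono ?_
    rintro _ ⟨x, hx, rfl⟩
    refine ⟨?_, fun h => hx.1.2 ?_⟩
    · have := hx.2
      simp only [mem_ball_zero_iff, norm_smul, Real.norm_ofNat] at this ⊢
      linarith
    · have := hc.smul_mem_of_zero_mem h0 h (t := 1 / 2) ⟨by norm_num, by norm_num⟩
      simpa [smul_smul] using this
  refine le_trans ?_ h1
  rw [Measure.addHaar_smul, finrank_euclideanSpace_fin, abs_of_nonneg (by positivity)]
  gcongr
  calc (2 : ℝ≥0∞) = ENNReal.ofReal 2 := (ENNReal.ofReal_ofNat 2).symm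
    _ ≤ _ := ENNReal.ofReal_le_ofReal (le_self_pow₀ (by norm_num) hn)

theorem exists_volume_sdiff_ball_le (hn : 2 ≤ n) :
    ∃ C : ℝ≥0∞, C ≠ ∞ ∧ ∀ E : Set (EuclideanSpace ℝ (Fin n)), Convex ℝ E → MeasurableSet E →
      0 ∈ E → volume E = volume (ball (0 : EuclideanSpace ℝ (Fin n)) 1) → ∀ ε : ℝ≥0∞,
      (∀ v ∈ ball (0 : EuclideanSpace ℝ (Fin n)) 1,
        ∫⁻ x in {x | ¬(x ∈ E ↔ hypRefl v 0 x ∈ E)}, ENNReal.ofReal |inner ℝ x v| ≤ ε) →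
      volume (E \ ball 0 1) ≤ C * ε := by
  have : NeZero n := ⟨by omega⟩
  obtain ⟨c, hc0, hct, hT⟩ := exists_le_lintegral_scaledRefl hn
  set ω := volume (ball (0 : EuclideanSpace ℝ (Fin n)) 1) with hω
  have hωt : ω ≠ ∞ := measure_ball_lt_top.ne
  refine ⟨4 * (ω / c), ENNReal.mul_ne_top (by simp) (ENNReal.div_ne_top hωt hc0),
    fun E hc hE h0 hvol ε hε => ?_⟩
  have hunit : ∀ x : EuclideanSpace ℝ (Fin n), x ≠ 0 → ‖‖x‖⁻¹ • x‖ = 1 := fun x hx =>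
    norm_smul_inv_norm (𝕜 := ℝ) hx
  set R : EuclideanSpace ℝ (Fin n) → EuclideanSpace ℝ (Fin n) := fun z => ‖z‖⁻¹ • z with hR
  have mR : Measurable R := by fun_prop
  set T₁ := {0}ᶜ ∩ R ⁻¹' Eᶜ with hT₁
  set T₂ := {0}ᶜ ∩ R ⁻¹' E with hT₂
  have mT₁ : MeasurableSet T₁ := (measurableSet_singleton 0).compl.inter (mR hE.compl)
  have mT₂ : MeasurableSet T₂ := (measurableSet_singleton 0).compl.inter (mR hE)
  have hle : ∀ I : ℝ≥0∞, c * I ≤ ε * ω → I ≤ ω / c * ε := by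
    intro I hI
    rw [mul_comm, ← mul_div_assoc]
    rw [mul_comm] at hI
    exact (ENNReal.le_div_iff_mul_le (Or.inl hc0) (Or.inl hct)).2 hI
  have hsv : ∀ (u v : EuclideanSpace ℝ (Fin n)), scaledRefl u v ≠ 0 → v ≠ 0 := by
    rintro u v h rfl
    simp [scaledRefl] at h
  have hsplit : ω ≤ volume (ball 0 1 ∩ T₁) + volume (ball 0 1 ∩ T₂) := by
    have h1 : ball (0 : EuclideanSpace ℝ (Fin n)) 1 ⊆
        {0} ∪ ((ball 0 1 ∩ T₁) ∪ (ball 0 1 ∩ T₂)) := by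
      intro x hx
      by_cases hx0 : x = 0
      · exact Or.inl hx0
      · by_cases hxE : R x ∈ E
        · exact Or.inr (Or.inr ⟨hx, hx0, hxE⟩)
        · exact Or.inr (Or.inl ⟨hx, hx0, hxE⟩)
    refine (measure_mono h1).trans ((measure_union_le _ _).trans ?_)
    rw [measure_singleton, zero_add]
    exact measure_union_le _ _
  have hcases : ω / 2 ≤ volume (ball 0 1 ∩ T₁) ∨ ω / 2 ≤ volume (ball 0 1 ∩ T₂) := by
    by_contra! hcon
    have := ENNReal.add_lt_add hcon.1 hcon.2
    rw [ENNReal.add_halves] at this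
    exact absurd hsplit (not_le.2 this)
  rcases hcases with h | h
  · have hX : MeasurableSet (E \ ball 0 1) := hE.diff measurableSet_ball
    have hX1 : ∀ x ∈ E \ ball 0 1, 1 ≤ ‖x‖ := fun x hx => by
      have := hx.2
      rwa [mem_ball_zero_iff, not_lt] at this
    have hX0 : ∀ x ∈ E \ ball 0 1, x ≠ 0 := fun x hx => by
      rw [← norm_pos_iff]
      exact one_pos.trans_le (hX1 x hx)
    have h1 := hle _ (mul_lintegral_norm_le (c := c) hE hX hX0 (fun x hx =>
      ⟨ball 0 1 ∩ scaledRefl (‖x‖⁻¹ • x) ⁻¹' T₁, Set.inter_subset_left,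
        measurableSet_ball.inter (measurable_scaledRefl _ mT₁),
        hT T₁ mT₁ (fun h => h.1 rfl) h _ (hunit x (hX0 x hx)), fun v hv hiff =>
        ((hypRefl_mem_iff_of_scaledRefl hc h0 (hX0 x hx) (hsv _ _ hv.2.1)).2 (hX1 x hx) hv.2.2)
          (hiff.1 hx.1)⟩) hε)
    calc volume (E \ ball 0 1) = ∫⁻ x in E \ ball 0 1, 1 := (setLIntegral_one _).symm
      _ ≤ ∫⁻ x in E \ ball 0 1, ENNReal.ofReal ‖x‖ := by
        refine setLIntegral_mono' hX fun x hx => ?_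
        rw [← ENNReal.ofReal_one]
        exact ENNReal.ofReal_le_ofReal (hX1 x hx)
      _ ≤ ω / c * ε := h1
      _ ≤ 4 * (ω / c * ε) := le_mul_of_one_le_left zero_le (by norm_num)
      _ = _ := by ring
  · have hX : MeasurableSet (ball 0 1 \ E) := measurableSet_ball.diff hE
    have hX1 : ∀ x ∈ ball 0 1 \ E, ‖x‖ ≤ 1 := fun x hx => (mem_ball_zero_iff.1 hx.1).le
    have hX0 : ∀ x ∈ ball 0 1 \ E, x ≠ 0 := fun x hx e => hx.2 (e ▸ h0)
    have h1 := hle _ (mul_lintegral_norm_le (c := c) hE hX hX0 (fun x hx =>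
      ⟨ball 0 1 ∩ scaledRefl (‖x‖⁻¹ • x) ⁻¹' T₂, Set.inter_subset_left,
        measurableSet_ball.inter (measurable_scaledRefl _ mT₂),
        hT T₂ mT₂ (fun h => h.1 rfl) h _ (hunit x (hX0 x hx)), fun v hv hiff =>
        hx.2 (hiff.2 ((hypRefl_mem_iff_of_scaledRefl hc h0 (hX0 x hx) (hsv _ _ hv.2.1)).1
          (hX1 x hx) hv.2.2))⟩) hε)
    rw [volume_sdiff_comm hE measurableSet_ball (hvol ▸ hωt) hvol]
    set X := ball 0 1 \ E with hXdef
    have hXt : volume X ≠ ∞ := ne_top_of_le_ne_top hωt (measure_mono Set.sdiff_subset)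
    have h2 := two_mul_volume_inter_ball_le hc h0
    have h3 : volume (X \ ball 0 (1 / 2)) ≤ 2 * (ω / c * ε) := by
      have h4 : ENNReal.ofReal (1 / 2) * volume (X \ ball 0 (1 / 2)) ≤ ω / c * ε := by
        rw [← setLIntegral_const]
        refine le_trans ?_ h1
        refine (setLIntegral_mono' (hX.diff measurableSet_ball) fun x hx => ?_).trans
          (lintegral_mono_set Set.sdiff_subset)
        have := hx.2
        rw [mem_ball_zero_iff, not_lt] at this
        exact ENNReal.ofReal_le_ofReal this
      calc volume (X \ ball 0 (1 / 2)) = 2 * (ENNReal.ofReal (1 / 2) *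
            volume (X \ ball 0 (1 / 2))) := by
            have e : 2 * ENNReal.ofReal (1 / 2) = 1 := by
              rw [← ENNReal.ofReal_ofNat 2, ← ENNReal.ofReal_mul (by norm_num)]
              norm_num
            rw [← mul_assoc, e, one_mul]
        _ ≤ _ := by gcongr
    have h5 := measure_inter_add_sdiff (μ := volume) X (measurableSet_ball (x := 0) (ε := 1 / 2))
    have h6 : 2 * volume X ≤ volume X + 2 * (2 * (ω / c * ε)) := by
      conv_lhs => rw [← h5, mul_add]
      gcongr
    rw [two_mul, ENNReal.add_le_add_iff_left hXt] at h6
    refine h6.trans (le_of_eq ?_)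
    ring

/-- Stability for normalized convex sets. -/
theorem exists_volume_symmDiff_ball_le (hn : 2 ≤ n) (hs : s ∈ Set.Ioo (0 : ℝ) 1) :
    ∃ C : ℝ, 0 < C ∧ ∀ E : Set (EuclideanSpace ℝ (Fin n)), Convex ℝ E → MeasurableSet E → 0 ∈ E →
      volume E = volume (ball (0 : EuclideanSpace ℝ (Fin n)) 1) → ∫ x in E, x = 0 →
      fracPer n s E ≠ ∞ →
      (volume (E ∆ ball 0 1)).toReal ≤ C * √(((fracPer n s E).toReal -
        (fracPer n s (ball (0 : EuclideanSpace ℝ (Fin n)) 1)).toReal) /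
          (fracPer n s (ball (0 : EuclideanSpace ℝ (Fin n)) 1)).toReal) := by
  have : NeZero n := ⟨by omega⟩
  have hn' : (2 : ℝ) ≤ n := by exact_mod_cast hn
  have hq : 2 ≤ (n : ℝ) + s := by linarith [hs.1]
  set B := ball (0 : EuclideanSpace ℝ (Fin n)) 1 with hB
  have hωt : volume B ≠ ∞ := measure_ball_lt_top.ne
  have hω : 0 < (volume B).toReal := ENNReal.toReal_pos (measure_ball_pos _ _ one_pos).ne' hωt
  have hBt : fracPer n s B ≠ ∞ := (convex_ball _ _).fracPer_ne_top hs measurableSet_ball hωt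
    (c := 0) (r := 1 / 2) (by norm_num) (closedBall_subset_ball (by norm_num))
  set p := (fracPer n s B).toReal with hp
  have hp0 : 0 < p := ENNReal.toReal_pos (fracPer_ball_pos (by linarith)).ne' hBt
  obtain ⟨D, hD0, hD⟩ := exists_dist_le_of_fracPer_le (n := n) (s := s) hs.1
    (ENNReal.mul_ne_top ENNReal.ofNat_ne_top hBt : 2 * fracPer n s B ≠ ∞)
  obtain ⟨C₀, hC₀, hvolC⟩ := exists_volume_sdiff_ball_le hn
  set c := 4 * (n + s) * D ^ (-((n : ℝ) + s) - 2) with hc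
  have hs0 := hs.1
  have hc0 : 0 < c := by positivity
  refine ⟨2 * (volume B).toReal + 8 * C₀.toReal * √(p / c), by positivity,
    fun E hconv hE h0 hvol hbar hP => ?_⟩
  set Δ := (fracPer n s E).toReal - p with hΔ
  have hsd : volume (E ∆ B) = 2 * volume (E \ B) := by
    rw [measure_symmDiff_eq hE.nullMeasurableSet measurableSet_ball.nullMeasurableSet, two_mul,
      volume_sdiff_comm hE measurableSet_ball (hvol ▸ hωt) hvol]
  rw [hsd, ENNReal.toReal_mul, ENNReal.toReal_ofNat]
  by_cases hM : fracPer n s E ≤ 2 * fracPer n s B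
  · have h1 := hvolC E hconv hE h0 hvol (ENNReal.ofReal (4 * √(Δ / c))) fun v hv => by
      refine (lintegral_abs_inner_le hq hE hvol hbar (hD E hconv hE hvol hM) h0 hP v).trans
        (ENNReal.ofReal_le_ofReal ?_)
      have : ‖v‖ ≤ 1 := (mem_ball_zero_iff.1 hv).le
      gcongr
      exact mul_le_of_le_one_left (Real.sqrt_nonneg _) this
    have h2 := ENNReal.toReal_mono (ENNReal.mul_ne_top hC₀ ENNReal.ofReal_ne_top) h1
    rw [ENNReal.toReal_mul, ENNReal.toReal_ofReal (by positivity)] at h2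
    have h3 : √(Δ / c) = √(p / c) * √(Δ / p) := by
      rw [← Real.sqrt_mul (by positivity)]
      congr 1
      field_simp
    rw [h3] at h2
    rw [add_mul]
    have h4 : 0 ≤ 2 * (volume B).toReal * √(Δ / p) := by positivity
    linarith
  · have h1 : 1 ≤ √(Δ / p) := by
      rw [Real.one_le_sqrt, one_le_div hp0]
      have h2 := ENNReal.toReal_mono hP (not_le.1 hM).le
      rw [ENNReal.toReal_mul, ENNReal.toReal_ofNat] at h2
      linarith
    have h2 : (volume (E \ B)).toReal ≤ (volume B).toReal := by
      rw [← hvol]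
      exact ENNReal.toReal_mono (hvol ▸ hωt) (measure_mono Set.sdiff_subset)
    calc 2 * (volume (E \ B)).toReal ≤ (2 * (volume B).toReal +
          8 * C₀.toReal * √(p / c)) * 1 := by
          have : 0 ≤ 8 * C₀.toReal * √(p / c) := by positivity
          linarith
      _ ≤ _ := by gcongr

theorem map_add_smul_volume (b : EuclideanSpace ℝ (Fin n)) {r : ℝ} (hr : 0 < r) :
    Measure.map (fun x => b + r • x) volume =
      ENNReal.ofReal ((r ^ n)⁻¹) • (volume : Measure (EuclideanSpace ℝ (Fin n))) := by
  have h : (fun x : EuclideanSpace ℝ (Fin n) => b + r • x) = (fun x => b + x) ∘ (r • ·) := rfl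
  rw [h, ← Measure.map_map (by fun_prop) (by fun_prop), Measure.map_addHaar_smul _ hr.ne',
    Measure.map_smul, map_add_left_eq_self, finrank_euclideanSpace_fin,
    abs_of_pos (by positivity)]

theorem volume_preimage_add_smul (b : EuclideanSpace ℝ (Fin n)) {r : ℝ} (hr : 0 < r)
    {E : Set (EuclideanSpace ℝ (Fin n))} (hE : MeasurableSet E) :
    volume ((fun x => b + r • x) ⁻¹' E) = ENNReal.ofReal ((r ^ n)⁻¹) * volume E := by
  rw [← Measure.map_apply (by fun_prop) hE, map_add_smul_volume b hr, Measure.smul_apply,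
    smul_eq_mul]

theorem setLIntegral_preimage_add_smul (b : EuclideanSpace ℝ (Fin n)) {r : ℝ} (hr : 0 < r)
    {E : Set (EuclideanSpace ℝ (Fin n))} (hE : MeasurableSet E)
    {f : EuclideanSpace ℝ (Fin n) → ℝ≥0∞} (hf : Measurable f) :
    ∫⁻ x in (fun x => b + r • x) ⁻¹' E, f (b + r • x) =
      ENNReal.ofReal ((r ^ n)⁻¹) * ∫⁻ x in E, f x := by
  rw [← setLIntegral_map hE hf (by fun_prop), map_add_smul_volume b hr, Measure.restrict_smul,
    lintegral_smul_measure, smul_eq_mul]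

theorem fracPer_preimage_add_smul (b : EuclideanSpace ℝ (Fin n)) {r : ℝ} (hr : 0 < r)
    {E : Set (EuclideanSpace ℝ (Fin n))} (hE : MeasurableSet E) :
    fracPer n s ((fun x => b + r • x) ⁻¹' E) =
      ENNReal.ofReal (r ^ ((n : ℝ) + s) * ((r ^ n)⁻¹ * (r ^ n)⁻¹)) * fracPer n s E := by
  have hK : ∀ x y : EuclideanSpace ℝ (Fin n), fracKer n s x y =
      ENNReal.ofReal (r ^ ((n : ℝ) + s)) * fracKer n s (b + r • x) (b + r • y) := by
    intro x y
    rw [fracKer, fracKer, ← ENNReal.ofReal_mul (by positivity), add_sub_add_left_eq_sub,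
      ← smul_sub, norm_smul, Real.norm_of_nonneg hr.le, Real.mul_rpow hr.le (norm_nonneg _),
      ← mul_assoc, ← Real.rpow_add hr, add_neg_cancel, Real.rpow_zero, one_mul]
  rw [fracPer_eq_interaction, fracPer_eq_interaction, interaction, interaction]
  have h1 : ∀ x : EuclideanSpace ℝ (Fin n), ∫⁻ y in ((fun x => b + r • x) ⁻¹' E)ᶜ,
      fracKer n s x y =
      ENNReal.ofReal (r ^ ((n : ℝ) + s)) * (ENNReal.ofReal ((r ^ n)⁻¹) *
        ∫⁻ y in Eᶜ, fracKer n s (b + r • x) y) := by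
    intro x
    have mk : Measurable fun y => fracKer n s (b + r • x) (b + r • y) :=
      (measurable_fracKer_right (b + r • x)).comp (by fun_prop)
    rw [lintegral_congr (hK x), lintegral_const_mul _ mk,
      ← Set.preimage_compl, setLIntegral_preimage_add_smul b hr hE.compl
        (measurable_fracKer_right (b + r • x))]
  simp_rw [h1]
  have mg : Measurable fun x : EuclideanSpace ℝ (Fin n) => ∫⁻ y in Eᶜ, fracKer n s x y :=
    measurable_lintegral_fracKer _
  rw [setLIntegral_preimage_add_smul b hr hE (f := fun x => ENNReal.ofReal (r ^ ((n : ℝ) + s)) *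
    (ENNReal.ofReal ((r ^ n)⁻¹) * ∫⁻ y in Eᶜ, fracKer n s x y)) ((mg.const_mul _).const_mul _),
    lintegral_const_mul _ (mg.const_mul _), lintegral_const_mul _ mg,
    ENNReal.ofReal_mul (by positivity), ENNReal.ofReal_mul (by positivity)]
  ring

theorem setIntegral_preimage_add_smul (b : EuclideanSpace ℝ (Fin n)) {r : ℝ} (hr : 0 < r)
    {E : Set (EuclideanSpace ℝ (Fin n))} (hE : MeasurableSet E) :
    ∫ x in (fun x => b + r • x) ⁻¹' E, (b + r • x) = (r ^ n)⁻¹ • ∫ x in E, x := by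
  rw [← setIntegral_map (f := fun x => x) hE aestronglyMeasurable_id (by fun_prop),
    map_add_smul_volume b hr, Measure.restrict_smul, integral_smul_measure,
    ENNReal.toReal_ofReal (by positivity)]

theorem fracPer_congr {E F : Set (EuclideanSpace ℝ (Fin n))} (h : E =ᵐ[volume] F) :
    fracPer n s E = fracPer n s F := by
  rw [fracPer, fracPer, Measure.restrict_congr_set h, Measure.restrict_congr_set h.compl]

theorem sDeficit_congr {E F : Set (EuclideanSpace ℝ (Fin n))} (h : E =ᵐ[volume] F) :
    sDeficit n s E = sDeficit n s F := by
  rw [sDeficit, sDeficit, matchRad, matchRad, fracPer_congr h, measure_congr h]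

theorem barAsym_congr {E F : Set (EuclideanSpace ℝ (Fin n))} (h : E =ᵐ[volume] F) :
    barAsym n E = barAsym n F := by
  have h1 : barycenter n E = barycenter n F := by
    rw [barycenter, barycenter, measure_congr h, setIntegral_congr_set h]
  have h2 : matchRad n E = matchRad n F := by rw [matchRad, matchRad, measure_congr h]
  have h3 : volume (E ∆ ball (barycenter n F) (matchRad n F)) =
      volume (F ∆ ball (barycenter n F) (matchRad n F)) :=
    measure_congr (ae_eq_set_symmDiff h (Filter.EventuallyEq.refl _ _))
  rw [barAsym, barAsym, h1, h2, measure_congr h, h3]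

theorem barAsym_le_of_isCompact (hn : 2 ≤ n) (hs : s ∈ Set.Ioo (0 : ℝ) 1) {C : ℝ}
    (hC : ∀ E : Set (EuclideanSpace ℝ (Fin n)), Convex ℝ E → MeasurableSet E → 0 ∈ E →
      volume E = volume (ball (0 : EuclideanSpace ℝ (Fin n)) 1) → ∫ x in E, x = 0 →
      fracPer n s E ≠ ∞ →
      (volume (E ∆ ball 0 1)).toReal ≤ C * √(((fracPer n s E).toReal -
        (fracPer n s (ball (0 : EuclideanSpace ℝ (Fin n)) 1)).toReal) /
          (fracPer n s (ball (0 : EuclideanSpace ℝ (Fin n)) 1)).toReal))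
    {K : Set (EuclideanSpace ℝ (Fin n))} (hK : IsCompact K) (hc : Convex ℝ K)
    (hi : (interior K).Nonempty) :
    barAsym n K ≤ C / (volume (ball (0 : EuclideanSpace ℝ (Fin n)) 1)).toReal *
      √(sDeficit n s K) := by
  have : NeZero n := ⟨by omega⟩
  have hn0 : (n : ℝ) ≠ 0 := by exact_mod_cast NeZero.ne n
  have mK : MeasurableSet K := hK.measurableSet
  have hKt : volume K ≠ ∞ := hK.measure_lt_top.ne
  have hK0 : 0 < (volume K).toReal :=
    ENNReal.toReal_pos (Measure.measure_pos_of_nonempty_interior _ hi).ne' hKt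
  set ω := (volume (ball (0 : EuclideanSpace ℝ (Fin n)) 1)).toReal with hω
  have hωt : volume (ball (0 : EuclideanSpace ℝ (Fin n)) 1) ≠ ∞ := measure_ball_lt_top.ne
  have hω0 : 0 < ω := ENNReal.toReal_pos (measure_ball_pos _ _ one_pos).ne' hωt
  set r := matchRad n K with hr
  have hr0 : 0 < r := Real.rpow_pos_of_pos (div_pos hK0 hω0) _
  have hrn : r ^ n = (volume K).toReal / ω := by
    rw [hr, matchRad, ← Real.rpow_natCast, ← Real.rpow_mul (by positivity), one_div,
      inv_mul_cancel₀ hn0, Real.rpow_one]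
  set b := barycenter n K with hb
  set φ : EuclideanSpace ℝ (Fin n) → EuclideanSpace ℝ (Fin n) := fun x => b + r • x with hφ
  have cφ : Continuous φ := by fun_prop
  set F := φ ⁻¹' K with hF
  have mF : MeasurableSet F := cφ.measurable mK
  have cF : Convex ℝ F := by
    intro x hx y hy α β hα hβ hαβ
    have h1 := hc (hx : φ x ∈ K) (hy : φ y ∈ K) hα hβ hαβ
    have h2 : φ (α • x + β • y) = α • φ x + β • φ y := by
      simp only [hφ]
      have : b = (α + β) • b := by rw [hαβ, one_smul]
      nth_rewrite 1 [this]
      module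
    change φ _ ∈ K
    rwa [h2]
  have hvolF : volume F = volume (ball (0 : EuclideanSpace ℝ (Fin n)) 1) := by
    rw [hF, volume_preimage_add_smul b hr0 mK, hrn, ← ENNReal.ofReal_toReal hKt,
      ← ENNReal.ofReal_mul (by positivity), ← ENNReal.ofReal_toReal hωt]
    congr 1
    rw [ENNReal.toReal_ofReal hK0.le, ← hω]
    field_simp
  have hFt : volume F ≠ ∞ := hvolF ▸ hωt
  have hFb : ∃ R, F ⊆ closedBall 0 R := by
    obtain ⟨R, hR⟩ := hK.isBounded.subset_closedBall b
    refine ⟨R / r, fun x hx => ?_⟩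
    have := hR hx
    rw [mem_closedBall, dist_eq_norm] at this
    simp only [hφ, add_sub_cancel_left, norm_smul, Real.norm_of_nonneg hr0.le] at this
    rw [mem_closedBall_zero_iff, le_div_iff₀' hr0]
    exact this
  obtain ⟨R, hFR⟩ := hFb
  have hint : IntegrableOn (fun x : EuclideanSpace ℝ (Fin n) => x) F :=
    (continuous_id.continuousOn.integrableOn_compact (isCompact_closedBall 0 R)).mono_set hFR
  have hbarF : ∫ x in F, x = 0 := by
    have h1 : ∫ x in F, (b + r • x) = (r ^ n)⁻¹ • ∫ x in K, x :=
      setIntegral_preimage_add_smul b hr0 mK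
    rw [integral_add (f := fun _ => b) (g := fun x => r • x) (integrableOn_const hFt)
      (hint.smul r), setIntegral_const, integral_smul, measureReal_def, hvolF] at h1
    have h2 : (r ^ n)⁻¹ • ∫ x in K, x = ω • b := by
      rw [hb, barycenter, smul_smul, hrn]
      congr 1
      field_simp
    rw [h2] at h1
    have h3 : r • ∫ x in F, x = 0 := add_eq_left.1 h1
    exact (smul_eq_zero.1 h3).resolve_left hr0.ne'
  have h0F : 0 ∈ F := by
    have h1 := cF.set_average_mem (hK.isClosed.preimage cφ) (μ := volume) (t := F)
      (f := fun x => x) (by rw [hvolF]; exact (measure_ball_pos _ _ one_pos).ne') hFt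
      (ae_restrict_mem mF) hint
    rwa [setAverage_eq, hbarF, smul_zero] at h1
  have hPF : fracPer n s F ≠ ∞ := by
    obtain ⟨z, hz⟩ := hi
    have hz' : φ (r⁻¹ • (z - b)) = z := by simp [hφ, smul_inv_smul₀ hr0.ne']
    have h1 : F ∈ nhds (r⁻¹ • (z - b)) :=
      cφ.continuousAt.preimage_mem_nhds (by rw [hz']; exact mem_interior_iff_mem_nhds.1 hz)
    obtain ⟨ρ, hρ, hρF⟩ := nhds_basis_closedBall.mem_iff.1 h1
    exact cF.fracPer_ne_top hs mF hFt hρ hρF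
  have hmain := hC F cF mF h0F hvolF hbarF hPF
  have hball : ∀ b : EuclideanSpace ℝ (Fin n), (fun x => b + r • x) ⁻¹' ball b r = ball 0 1 := by
    intro b
    ext x
    rw [Set.mem_preimage, mem_ball, dist_eq_norm, add_sub_cancel_left, norm_smul,
      Real.norm_of_nonneg hr0.le, mem_ball_zero_iff]
    exact mul_lt_iff_lt_one_right hr0
  set k := r ^ ((n : ℝ) + s) * ((r ^ n)⁻¹ * (r ^ n)⁻¹) with hk
  have hk0 : 0 < k := by positivity
  have hPK : (fracPer n s F).toReal = k * (fracPer n s K).toReal := by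
    rw [hF, fracPer_preimage_add_smul b hr0 mK, ENNReal.toReal_mul,
      ENNReal.toReal_ofReal hk0.le]
  have hPB : (fracPer n s (ball (0 : EuclideanSpace ℝ (Fin n)) 1)).toReal =
      k * (fracPer n s (ball (0 : EuclideanSpace ℝ (Fin n)) r)).toReal := by
    rw [← hball 0, fracPer_preimage_add_smul 0 hr0 measurableSet_ball, ENNReal.toReal_mul,
      ENNReal.toReal_ofReal hk0.le]
  have hdef : ((fracPer n s F).toReal -
      (fracPer n s (ball (0 : EuclideanSpace ℝ (Fin n)) 1)).toReal) /
        (fracPer n s (ball (0 : EuclideanSpace ℝ (Fin n)) 1)).toReal = sDeficit n s K := by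
    rw [hPK, hPB, ← mul_sub, mul_div_mul_left _ _ hk0.ne', sDeficit]
  have hasym : (volume (F ∆ ball 0 1)).toReal = ω * barAsym n K := by
    have h1 : F ∆ ball 0 1 = φ ⁻¹' (K ∆ ball b r) := by
      rw [← hball b]
      rfl
    rw [h1, volume_preimage_add_smul b hr0 (mK.symmDiff measurableSet_ball), ENNReal.toReal_mul,
      ENNReal.toReal_ofReal (by positivity), barAsym, hrn, ← hr, ← hb]
    field_simp
  rw [hdef, hasym] at hmain
  rw [div_mul_eq_mul_div, le_div_iff₀' hω0]
  exact hmain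

end FractionalPerimeter

/-- **Barycentric stability of nonlocal perimeters, convex case.**
For every `n ≥ 2` and `s ∈ (0,1)` there is `C = C(n,s) > 0` such that every bounded convex set
`E ⊆ ℝⁿ` with nonempty interior satisfies `λ₀(E) ≤ C √(δ_s(E))`. -/
theorem barycentric_quantitative_isoperimetric_fractional
    (n : ℕ) (hn : 2 ≤ n) (s : ℝ) (hs : s ∈ Set.Ioo (0 : ℝ) 1) :
    ∃ C : ℝ, 0 < C ∧ ∀ E : Set (EuclideanSpace ℝ (Fin n)),
      Convex ℝ E → IsBounded E → (interior E).Nonempty →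
      barAsym n E ≤ C * Real.sqrt (sDeficit n s E) := by
  obtain ⟨C, hC0, hC⟩ := exists_volume_symmDiff_ball_le hn hs
  have hω : 0 < (volume (ball (0 : EuclideanSpace ℝ (Fin n)) 1)).toReal :=
    ENNReal.toReal_pos (measure_ball_pos _ _ one_pos).ne' measure_ball_lt_top.ne
  refine ⟨_, div_pos hC0 hω, fun E hE hb hi => ?_⟩
  have h : closure E =ᵐ[volume] E := closure_ae_eq_of_null_frontier (hE.addHaar_frontier volume)
  rw [← barAsym_congr h, ← sDeficit_congr h]
  exact barAsym_le_of_isCompact hn hs hC hb.isCompact_closure hE.closure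
    (hi.mono (interior_mono subset_closure))
end

section
/- Let n ≥ 2, let a > 0, and let E ⊆ ℝⁿ be an open bounded set with |E| = ω_n, bar(E) = 0, whose boundary is ∂E = {(1+u(x))x : x ∈ ∂B} for a Lipschitz function u : ∂B → ℝ with ‖u‖_{L^∞(∂B)} ≤ a, where B is the open unit ball. Then λ₀(E) ≤ ((1+a)ⁿ − 1)/(ω_n·a) · ‖u‖_{L¹(∂B)}, where ‖u‖_{L¹(∂B)} = ∫_{∂B} |u| dH^{n−1}. -/
open MeasureTheory Metric Bornology
open scoped ENNReal symmDiff

open scoped Pointwise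

section ConeVolume

variable {F : Type*} [NormedAddCommGroup F] [InnerProductSpace ℝ F] [FiniteDimensional ℝ F]
  [MeasurableSpace F] [BorelSpace F]

theorem OrthonormalBasis.volume_le_prod_ediam {ι : Type*} [Fintype ι] (b : OrthonormalBasis ι ℝ F)
    (s : Set F) : volume s ≤ ∏ i, ediam ((fun x => inner ℝ (b i) x) '' s) := by
  classical
  let e : F ≃ᵐ (ι → ℝ) := b.measurableEquiv.trans (MeasurableEquiv.toLp 2 (ι → ℝ)).symm
  have he : MeasurePreserving e volume volume :=
    b.measurePreserving_measurableEquiv.trans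
      (EuclideanSpace.volume_preserving_symm_measurableEquiv_toLp ι)
  have hval : ∀ x i, e x i = inner ℝ (b i) x := fun x i => b.repr_apply_apply x i
  calc volume s = volume (e ⁻¹' (e '' s)) := by rw [e.injective.preimage_image]
    _ = volume (e '' s) := he.measure_preimage_equiv _
    _ ≤ ∏ i, ediam (Function.eval i '' (e '' s)) := Real.volume_pi_le_prod_diam _
    _ = _ := by simp only [Set.image_image, Function.eval, hval]

theorem abs_mul_sub_mul_le {α β s t d : ℝ} (hs : s ∈ Set.Ioo (0 : ℝ) 1)
    (ht : t ∈ Set.Ioo (0 : ℝ) 1) (hα : |α| ≤ d) (hβ : |β| ≤ d) (h : |α - β| ≤ d) :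
    |s * α - t * β| ≤ d := by
  obtain ⟨hs0, hs1⟩ := hs
  obtain ⟨ht0, ht1⟩ := ht
  rw [abs_le] at *
  have h1 : s * α ≤ max α 0 := by
    rcases le_total 0 α with h | h
    · rw [max_eq_left h]; nlinarith
    · rw [max_eq_right h]; nlinarith
  have h2 : min α 0 ≤ s * α := by
    rcases le_total 0 α with h | h
    · rw [min_eq_right h]; nlinarith
    · rw [min_eq_left h]; nlinarith
  have h3 : t * β ≤ max β 0 := by
    rcases le_total 0 β with h | h
    · rw [max_eq_left h]; nlinarith
    · rw [max_eq_right h]; nlinarith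
  have h4 : min β 0 ≤ t * β := by
    rcases le_total 0 β with h | h
    · rw [min_eq_right h]; nlinarith
    · rw [min_eq_left h]; nlinarith
  constructor <;> rcases le_total 0 α with h5 | h5 <;> rcases le_total 0 β with h6 | h6 <;>
    simp only [h5, h6, max_eq_left, max_eq_right, min_eq_left, min_eq_right] at h1 h2 h3 h4 <;>
    linarith

/-- The cone over a subset of diameter at most `1` of the unit sphere has volume at most `diam ^ (dim - 1)`. -/
theorem volume_cone_le_ediam_pow (s : Set (sphere (0 : F) 1)) (hs : ediam s ≤ 1) :
    volume (Set.Ioo (0 : ℝ) 1 • (Subtype.val '' s)) ≤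
      ediam s ^ (Module.finrank ℝ F - 1) := by
  classical
  rcases s.eq_empty_or_nonempty with rfl | ⟨x₀, hx₀⟩
  · simp
  have hx₀n : ‖(x₀ : F)‖ = 1 := by simp
  have hfin : 0 < Module.finrank ℝ F :=
    Module.finrank_pos_iff_exists_ne_zero.2 ⟨x₀, fun h => by simp [h] at hx₀n⟩
  let i₀ : Fin (Module.finrank ℝ F) := ⟨0, hfin⟩
  obtain ⟨b, hb⟩ := Orthonormal.exists_orthonormalBasis_extension_of_card_eq (𝕜 := ℝ) (E := F)
    (ι := Fin (Module.finrank ℝ F)) (by simp) (v := fun _ => (x₀ : F)) (s := {i₀})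
    (by
      refine ⟨fun _ => hx₀n, fun i j hij => (hij (Subsingleton.elim _ _)).elim⟩)
  have hb₀ : b i₀ = x₀ := hb i₀ rfl
  have hne : ediam s ≠ ⊤ := by
    have : IsBounded s := isBounded_of_compactSpace
    exact this.ediam_ne_top
  have hdist : ∀ i, ∀ x ∈ s, ∀ y ∈ s, |inner ℝ (b i) (x : F) - inner ℝ (b i) (y : F)| ≤ diam s := by
    intro i x hx y hy
    rw [← inner_sub_right]
    calc |inner ℝ (b i) ((x : F) - y)| ≤ ‖b i‖ * ‖(x : F) - y‖ := abs_real_inner_le_norm _ _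
      _ = dist x y := by rw [b.norm_eq_one, one_mul, Subtype.dist_eq, dist_eq_norm]
      _ ≤ diam s := dist_le_diam_of_mem' hne hx hy
  have hdiam : ∀ i, i ≠ i₀ → ediam ((fun x => inner ℝ (b i) x) ''
      (Set.Ioo (0 : ℝ) 1 • (Subtype.val '' s))) ≤ ediam s := by
    intro i hi
    have hz : inner ℝ (b i) (x₀ : F) = (0 : ℝ) := by
      rw [← hb₀, b.inner_eq_ite, if_neg hi]
    have habs : ∀ x ∈ s, |inner ℝ (b i) (x : F)| ≤ diam s := by
      intro x hx
      simpa [hz] using hdist i x hx x₀ hx₀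
    refine ediam_le ?_
    rintro _ ⟨_, ⟨t, ht, _, ⟨x, hx, rfl⟩, rfl⟩, rfl⟩ _ ⟨_, ⟨r, hr, _, ⟨y, hy, rfl⟩, rfl⟩, rfl⟩
    rw [edist_dist, Real.dist_eq, ← ENNReal.ofReal_toReal hne]
    refine ENNReal.ofReal_le_ofReal ?_
    simp only [inner_smul_right]
    exact abs_mul_sub_mul_le ht hr (habs x hx) (habs y hy) (hdist i x hx y hy)
  have hdiam₀ : ediam ((fun x => inner ℝ (b i₀) x) ''
      (Set.Ioo (0 : ℝ) 1 • (Subtype.val '' s))) ≤ 1 := by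
    have hsub : (fun x => inner ℝ (b i₀) x) '' (Set.Ioo (0 : ℝ) 1 • (Subtype.val '' s)) ⊆
        Set.Icc (0 : ℝ) 1 := by
      rintro _ ⟨_, ⟨t, ht, _, ⟨x, hx, rfl⟩, rfl⟩, rfl⟩
      have hxn : ‖(x : F)‖ = 1 := by simp
      have hd : ‖(x₀ : F) - x‖ ≤ 1 := by
        have : edist x₀ x ≤ 1 := (edist_le_ediam_of_mem hx₀ hx).trans hs
        rw [edist_dist, ENNReal.ofReal_le_one, Subtype.dist_eq, dist_eq_norm] at this
        exact this
      have hsq := norm_sub_sq_real (x₀ : F) x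
      have hle : inner ℝ (x₀ : F) (x : F) ≤ 1 := by
        simpa [hxn, hx₀n] using real_inner_le_norm (x₀ : F) x
      have hge : 0 ≤ inner ℝ (x₀ : F) (x : F) := by
        rw [hxn, hx₀n] at hsq
        nlinarith [norm_nonneg ((x₀ : F) - x)]
      simp only [inner_smul_right, hb₀]
      exact ⟨mul_nonneg ht.1.le hge, mul_le_one₀ ht.2.le hge hle⟩
    refine (ediam_mono hsub).trans ?_
    simp [Real.ediam_Icc]
  calc volume (Set.Ioo (0 : ℝ) 1 • (Subtype.val '' s)) ≤ _ := b.volume_le_prod_ediam _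
    _ ≤ ∏ i, (if i = i₀ then 1 else ediam s) := by
        refine Finset.prod_le_prod' fun i _ => ?_
        split_ifs with h
        · exact h ▸ hdiam₀
        · exact hdiam i h
    _ = _ := by
        rw [Finset.prod_ite]
        simp [Finset.filter_ne']

theorem toSphere_le_finrank_smul_hausdorffMeasure :
    (volume : Measure F).toSphere ≤
      (Module.finrank ℝ F : ℝ≥0∞) • μH[(Module.finrank ℝ F : ℝ) - 1] := by
  rcases Nat.eq_zero_or_pos (Module.finrank ℝ F) with h0 | hpos
  · rw [(Measure.toSphere_eq_zero_iff_finrank volume).2 h0]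
    exact Measure.zero_le _
  set d := Module.finrank ℝ F with hd
  have hd0 : (d : ℝ≥0∞) ≠ 0 := by simpa using hpos.ne'
  have hle : (d : ℝ≥0∞)⁻¹ • (volume : Measure F).toSphere ≤ μH[(d : ℝ) - 1] := by
    refine Measure.le_hausdorffMeasure _ _ 1 one_pos fun s hs => ?_
    calc ((d : ℝ≥0∞)⁻¹ • (volume : Measure F).toSphere) s
        ≤ ((d : ℝ≥0∞)⁻¹ • (volume : Measure F).toSphere) (closure s) := measure_mono subset_closure
      _ = volume (Set.Ioo (0 : ℝ) 1 • (Subtype.val '' closure s)) := by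
        rw [Measure.smul_apply, Measure.toSphere_apply' _ isClosed_closure.measurableSet,
          smul_eq_mul, ← mul_assoc, ENNReal.inv_mul_cancel hd0 (ENNReal.natCast_ne_top _), one_mul]
      _ ≤ ediam (closure s) ^ (d - 1) :=
        volume_cone_le_ediam_pow _ (by rwa [ediam_closure])
      _ = ediam s ^ ((d : ℝ) - 1) := by
        rw [ediam_closure, ← ENNReal.rpow_natCast, Nat.cast_sub hpos, Nat.cast_one]
  calc (volume : Measure F).toSphere
      = (d : ℝ≥0∞) • (d : ℝ≥0∞)⁻¹ • (volume : Measure F).toSphere := by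
        rw [smul_smul, ENNReal.mul_inv_cancel hd0 (ENNReal.natCast_ne_top _), one_smul]
    _ ≤ _ := by gcongr

end ConeVolume

section SphereFinite

theorem LocallyLipschitz.hausdorffMeasure_image_lt_top {X Y : Type*}
    [EMetricSpace X] [MeasurableSpace X] [BorelSpace X]
    [EMetricSpace Y] [MeasurableSpace Y] [BorelSpace Y] {d : ℝ} (hd : 0 ≤ d)
    [IsLocallyFiniteMeasure (μH[d] : Measure X)] {g : X → Y} (hg : LocallyLipschitz g) {K : Set X}
    (hK : IsCompact K) : μH[d] (g '' K) < ⊤ := by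
  refine hK.induction_on (p := fun s => μH[d] (g '' s) < ⊤) (by simp) ?_ ?_ ?_
  · exact fun s t hst ht => (measure_mono (Set.image_mono hst)).trans_lt ht
  · intro s t hs ht
    rw [Set.image_union]
    exact (measure_union_le _ _).trans_lt (ENNReal.add_lt_top.2 ⟨hs, ht⟩)
  · intro x _
    obtain ⟨C, t, ht, hLip⟩ := hg x
    obtain ⟨r, hr, hfin⟩ := (μH[d] : Measure X).finiteAt_nhds x
    refine ⟨t ∩ r, mem_nhdsWithin_of_mem_nhds (Filter.inter_mem ht hr), ?_⟩
    refine ((hLip.mono Set.inter_subset_left).hausdorffMeasure_image_le hd).trans_lt ?_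
    refine ENNReal.mul_lt_top (ENNReal.rpow_lt_top_of_nonneg hd ENNReal.coe_ne_top) ?_
    exact (measure_mono Set.inter_subset_right).trans_lt hfin

theorem hausdorffMeasure_sphere_lt_top (n : ℕ) :
    μH[(n : ℝ) - 1] (sphere (0 : EuclideanSpace ℝ (Fin n)) 1) < ⊤ := by
  classical
  let w : (p : Fin n × Bool) → ({j // j ≠ p.1} → ℝ) → EuclideanSpace ℝ (Fin n) := fun p y =>
    WithLp.toLp 2 fun j => if h : j = p.1 then (if p.2 then 1 else -1) else y ⟨j, h⟩
  let g : (p : Fin n × Bool) → ({j // j ≠ p.1} → ℝ) → EuclideanSpace ℝ (Fin n) := fun p y =>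
    ‖w p y‖⁻¹ • w p y
  have hw0 : ∀ p y, w p y ≠ 0 := by
    intro p y h
    have h1 : w p y p.1 = 0 := by rw [h]; rfl
    simp only [w, dite_true] at h1
    split_ifs at h1 <;> norm_num at h1
  have hw : ∀ p, ContDiff ℝ 1 (w p) := by
    intro p
    rw [contDiff_euclidean]
    intro j
    by_cases h : j = p.1
    · simp only [w, h, dite_true]
      exact contDiff_const
    · simp only [w, h, dite_false]
      exact contDiff_apply ℝ ℝ _
  have hg : ∀ p, LocallyLipschitz (g p) := fun p =>
    (((hw p).norm ℝ (hw0 p)).inv fun y => norm_ne_zero_iff.2 (hw0 p y)).smul (hw p)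
      |>.locallyLipschitz
  have himg : ∀ p : Fin n × Bool, μH[(n : ℝ) - 1] (g p '' Set.Icc (-1) 1) < ⊤ := by
    intro p
    have hn : 0 < n := p.1.pos
    have hcard : ((Fintype.card {j // j ≠ p.1} : ℕ) : ℝ) = (n : ℝ) - 1 := by
      rw [Fintype.card_subtype_compl]
      simp [Nat.cast_sub (Nat.succ_le_of_lt hn)]
    have hvol : (μH[(n : ℝ) - 1] : Measure ({j // j ≠ p.1} → ℝ)) = volume := by
      rw [← hcard, hausdorffMeasure_pi_real]
    have : IsLocallyFiniteMeasure (μH[(n : ℝ) - 1] : Measure ({j // j ≠ p.1} → ℝ)) := by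
      rw [hvol]; infer_instance
    exact (hg p).hausdorffMeasure_image_lt_top (by rw [← hcard]; positivity) isCompact_Icc
  have hcover : sphere (0 : EuclideanSpace ℝ (Fin n)) 1 ⊆ ⋃ p, g p '' Set.Icc (-1) 1 := by
    intro x hx
    have hxn : ‖x‖ = 1 := by simpa using hx
    have hne : Nonempty (Fin n) := by
      by_contra h
      rw [not_nonempty_iff] at h
      rw [Subsingleton.elim x 0, norm_zero] at hxn
      exact zero_ne_one hxn
    obtain ⟨i, hi⟩ := Finite.exists_max fun j => |x j|
    have hi0 : 0 < |x i| := by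
      rw [abs_pos]
      intro h
      have : x = 0 := by
        ext j
        have := hi j
        simp only [h, abs_zero] at this
        simpa using abs_nonpos_iff.1 this
      rw [this, norm_zero] at hxn
      exact zero_ne_one hxn
    let p : Fin n × Bool := (i, decide (0 < x i))
    let y : {j // j ≠ p.1} → ℝ := fun j => |x i|⁻¹ * x j
    have hwy : w p y = |x i|⁻¹ • x := by
      ext j
      by_cases h : j = i
      · subst h
        simp only [w, p, dite_true, PiLp.smul_apply, smul_eq_mul, decide_eq_true_eq]
        split_ifs with hpos
        · rw [abs_of_pos hpos, inv_mul_cancel₀ hpos.ne']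
        · have : x j < 0 := lt_of_le_of_ne (not_lt.1 hpos) (abs_pos.1 hi0)
          rw [abs_of_neg this, inv_neg, neg_mul, inv_mul_cancel₀ this.ne]
      · simp [w, p, y, h]
    refine Set.mem_iUnion.2 ⟨p, y, ?_, ?_⟩
    · rw [Set.mem_Icc, Pi.le_def, Pi.le_def, ← forall_and]
      intro j
      refine abs_le.1 (?_ : |y j| ≤ 1)
      simp only [y, abs_mul, abs_inv, abs_abs]
      rw [inv_mul_le_one₀ hi0]
      exact hi j
    · simp only [g, hwy, norm_smul, hxn, norm_inv, Real.norm_eq_abs, abs_abs, mul_one, inv_inv]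
      rw [smul_smul, mul_inv_cancel₀ hi0.ne', one_smul]
  refine (measure_mono hcover).trans_lt ((measure_iUnion_le _).trans_lt ?_)
  rw [tsum_fintype]
  exact ENNReal.sum_lt_top.2 fun p _ => himg p

end SphereFinite

section Rays

variable {F : Type*} [NormedAddCommGroup F] [NormedSpace ℝ F] {E : Set F} {u : F → ℝ}

theorem eq_or_eq_neg_of_smul_mem_image
    {x : F} (hx : x ∈ sphere (0 : F) 1) {t : ℝ} (ht : 0 < t)
    (h : t • x ∈ (fun x => (1 + u x) • x) '' sphere (0 : F) 1) :
    t = 1 + u x ∨ t = -(1 + u (-x)) := by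
  obtain ⟨z, hz, hzx⟩ := h
  simp only at hzx
  have hxn : ‖x‖ = 1 := by simpa using hx
  have hzn : ‖z‖ = 1 := by simpa using hz
  have hnorm : |1 + u z| = t := by
    simpa [norm_smul, hxn, hzn, abs_of_pos ht] using congrArg norm hzx
  rcases le_total 0 (1 + u z) with h | h
  · rw [abs_of_nonneg h] at hnorm
    rw [hnorm] at hzx
    left
    rw [← smul_right_injective F ht.ne' hzx, hnorm]
  · rw [abs_of_nonpos h] at hnorm
    right
    have : -t • z = t • x := by rw [← hzx, ← hnorm, neg_neg]
    rw [neg_smul, ← smul_neg] at this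
    rw [← smul_right_injective F ht.ne' this, neg_neg, hnorm]

/-- A radial segment meeting both a set and its complement meets the boundary of the set. -/
theorem exists_smul_mem_frontier {x : F} {I : Set ℝ} (hI : I.OrdConnected) {s t : ℝ} (hs : s ∈ I)
    (ht : t ∈ I) (hsE : s • x ∈ E) (htE : t • x ∉ E) : ∃ r ∈ I, r • x ∈ frontier E := by
  have hc : IsPreconnected ((fun r : ℝ => r • x) '' I) :=
    hI.isPreconnected.image _ (by fun_prop)
  obtain ⟨_, ⟨r, hr, rfl⟩, hrE⟩ := isPreconnected_closed_iff.1 hc (closure E) (closure Eᶜ)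
    isClosed_closure isClosed_closure
    (fun z _ => (em (z ∈ E)).imp (fun h => subset_closure h) fun h => subset_closure h)
    ⟨_, Set.mem_image_of_mem _ hs, subset_closure hsE⟩
    ⟨_, Set.mem_image_of_mem _ ht, subset_closure htE⟩
  exact ⟨r, hr, by rwa [frontier_eq_closure_inter_closure]⟩

theorem lt_max_of_smul_mem (hopen : IsOpen E) (hbd : IsBounded E)
    (hbdry : frontier E = (fun x => (1 + u x) • x) '' sphere (0 : F) 1)
    {x : F} (hx : x ∈ sphere (0 : F) 1) {t : ℝ} (ht : 0 < t) (h : t • x ∈ E) :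
    t < max (1 + u x) (-(1 + u (-x))) := by
  have hxn : ‖x‖ = 1 := by simpa using hx
  obtain ⟨R, hR⟩ := hbd.subset_closedBall (0 : F)
  have hout : (max t (R + 1)) • x ∉ E := by
    intro hmem
    have := hR hmem
    rw [mem_closedBall_zero_iff, norm_smul, hxn, mul_one, Real.norm_eq_abs] at this
    linarith [le_abs_self (max t (R + 1)), le_max_right t (R + 1)]
  obtain ⟨r, hr, hrE⟩ := exists_smul_mem_frontier (Set.ordConnected_Ici (a := t))
    Set.self_mem_Ici (Set.mem_Ici.2 (le_max_left t (R + 1))) h hout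
  have hrt : t < r := lt_of_le_of_ne hr fun he => by
    rw [hopen.frontier_eq, ← he] at hrE
    exact hrE.2 h
  rw [hbdry] at hrE
  rcases eq_or_eq_neg_of_smul_mem_image hx (ht.trans hrt) hrE with h | h
  · exact lt_max_of_lt_left (h ▸ hrt)
  · exact lt_max_of_lt_right (h ▸ hrt)

theorem smul_mem_of_lt (hopen : IsOpen E) (hbd : IsBounded E)
    (hbdry : frontier E = (fun x => (1 + u x) • x) '' sphere (0 : F) 1)
    (hu : ContinuousOn u (sphere (0 : F) 1))
    {x : F} (hx : x ∈ sphere (0 : F) 1) (hq : 0 < 1 + u (-x)) {t : ℝ} (ht : 0 < t)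
    (htp : t < 1 + u x) : t • x ∈ E := by
  by_contra htE
  have hxn : ‖x‖ = 1 := by simpa using hx
  have hp : 0 < 1 + u x := ht.trans htp
  have htc : t • x ∈ (closure E)ᶜ := by
    intro hmem
    have hfr : t • x ∈ frontier E := by rw [hopen.frontier_eq]; exact ⟨hmem, htE⟩
    rw [hbdry] at hfr
    rcases eq_or_eq_neg_of_smul_mem_image hx ht hfr with h | h <;> linarith
  set y : F := (1 + u x) • x with hy
  have hyn : ‖y‖ = 1 + u x := by rw [hy, norm_smul, hxn, mul_one, Real.norm_of_nonneg hp.le]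
  have hy0 : y ≠ 0 := norm_ne_zero_iff.1 (hyn ▸ hp.ne')
  have hdir : ‖y‖⁻¹ • y = x := by rw [hyn, hy, smul_smul, inv_mul_cancel₀ hp.ne', one_smul]
  have hcd : ContinuousAt (fun z : F => ‖z‖⁻¹ • z) y :=
    (continuousAt_id.norm.inv₀ (norm_ne_zero_iff.2 hy0)).smul continuousAt_id
  have hsph : ∀ᶠ z in nhds y, ‖z‖⁻¹ • z ∈ sphere (0 : F) 1 := by
    filter_upwards [isOpen_ne.mem_nhds hy0] with z hz
    simp [norm_smul, inv_mul_cancel₀ (norm_ne_zero_iff.2 hz)]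
  have htend : Filter.Tendsto (fun z : F => ‖z‖⁻¹ • z) (nhds y)
      (nhdsWithin x (sphere (0 : F) 1)) :=
    tendsto_nhdsWithin_iff.2 ⟨by simpa only [hdir] using hcd.tendsto, hsph⟩
  have hneg : ContinuousOn (fun z => u (-z)) (sphere (0 : F) 1) :=
    hu.comp continuous_neg.continuousOn fun z hz => by simpa using hz
  have e₁ : ∀ᶠ z in nhds y, t < 1 + u (‖z‖⁻¹ • z) :=
    htend.eventually (((hu x hx).const_add 1).eventually (lt_mem_nhds htp))
  have e₂ : ∀ᶠ z in nhds y, 0 < 1 + u (-(‖z‖⁻¹ • z)) :=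
    htend.eventually (((hneg x hx).const_add 1).eventually (lt_mem_nhds hq))
  have e₃ : ∀ᶠ z in nhds y, t • (‖z‖⁻¹ • z) ∈ (closure E)ᶜ := by
    have : Filter.Tendsto (fun z : F => t • (‖z‖⁻¹ • z)) (nhds y) (nhds (t • x)) := by
      simpa only [hdir] using (hcd.tendsto).const_smul t
    exact this.eventually (isClosed_closure.isOpen_compl.mem_nhds htc)
  have hyE : y ∈ closure E := frontier_subset_closure (by rw [hbdry]; exact ⟨x, hx, rfl⟩)
  obtain ⟨z, hzE, hz₁, hz₂, hz₃, hzs, hz0⟩ := ((mem_closure_iff_frequently.1 hyE).and_eventually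
    (e₁.and (e₂.and (e₃.and (hsph.and (isOpen_ne.mem_nhds hy0)))))).exists
  have hznorm : 0 < ‖z‖ := norm_pos_iff.2 hz0
  have hz : ‖z‖ • (‖z‖⁻¹ • z) = z := by rw [smul_smul, mul_inv_cancel₀ hznorm.ne', one_smul]
  have hlt := lt_max_of_smul_mem hopen hbd hbdry hzs hznorm (by rwa [hz])
  rw [max_eq_left (by linarith)] at hlt
  obtain ⟨r, hr, hrE⟩ := exists_smul_mem_frontier
    (Set.ordConnected_Ioo (a := (0 : ℝ)) (b := 1 + u (‖z‖⁻¹ • z)))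
    ⟨hznorm, hlt⟩ ⟨ht, hz₁⟩ (by rwa [hz]) (fun h => hz₃ (subset_closure h))
  rw [hbdry] at hrE
  rcases eq_or_eq_neg_of_smul_mem_image hzs hr.1 hrE with h | h
  · exact hr.2.ne h
  · linarith [hr.1]

end Rays

section Numeric

theorem abs_pow_sub_one_le {n : ℕ} {a p : ℝ} (ha : 0 < a) (hp : 0 ≤ p) (hpa : p ≤ 1 + a) :
    |p ^ n - 1| ≤ ((1 + a) ^ n - 1) / a * |p - 1| := by
  have hc : ((1 + a) ^ n - 1) / a = ∑ i ∈ Finset.range n, (1 + a) ^ i := by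
    rw [← mul_geom_sum]
    field_simp
    ring
  rw [hc, ← mul_geom_sum, abs_mul, mul_comm,
    abs_of_nonneg (Finset.sum_nonneg fun i _ => pow_nonneg hp i)]
  gcongr

theorem max_pow_add_max_pow_le {n : ℕ} (hn : 2 ≤ n) {a p q : ℝ} (ha : 0 < a) (hp : |p - 1| ≤ a)
    (hq : |q - 1| ≤ a) (hq0 : q ≤ 0) :
    max 1 (max p (-q)) ^ n + max 1 (max q (-p)) ^ n ≤
      ((1 + a) ^ n - 1) / a * (|p - 1| + |q - 1|) := by
  have hn0 : n ≠ 0 := by omega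
  set c := ((1 + a) ^ n - 1) / a with hc
  have hneg : ∀ r : ℝ, r ≤ 0 → |r - 1| ≤ a → (-r) ^ n + 3 ≤ c * |r - 1| := by
    intro r hr hra
    have habs : |r - 1| = 1 - r := by rw [abs_sub_comm, abs_of_nonneg (by linarith)]
    have h1 := abs_pow_sub_one_le (n := n) ha (p := 2 - r) (by linarith) (by linarith)
    have h2 : (2 : ℝ) ^ n + (-r) ^ n ≤ (2 + -r) ^ n :=
      pow_add_pow_le (by norm_num) (by linarith) hn0
    have h3 : (2 : ℝ) ^ 2 ≤ 2 ^ n := pow_le_pow_right₀ (by norm_num) hn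
    rw [abs_of_nonneg (show (0 : ℝ) ≤ 2 - r - 1 by linarith), ← hc] at h1
    rw [habs]
    rw [← sub_eq_add_neg] at h2
    have h4 := le_abs_self ((2 - r) ^ n - 1)
    have h5 : c * (2 - r - 1) = c * (1 - r) := by ring
    linarith
  have hmax : ∀ r : ℝ, 0 ≤ r → max 1 r ^ n ≤ 1 + r ^ n := by
    intro r hr
    rcases max_choice 1 r with h | h <;> rw [h]
    · simpa using pow_nonneg hr n
    · linarith
  have hq1 := hneg q hq0 hq
  have hqn : 0 ≤ (-q) ^ n := pow_nonneg (by linarith) n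
  rw [mul_add]
  rcases le_total p 0 with hp0 | hp0
  · rw [max_eq_right (show p ≤ -q by linarith), max_eq_right (show q ≤ -p by linarith)]
    linarith [hneg p hp0 hp, hmax (-q) (by linarith), hmax (-p) (by linarith)]
  · have h1 : max 1 (max q (-p)) = 1 := by
      rw [max_eq_left]
      exact max_le (by linarith) (by linarith)
    have h2 := abs_pow_sub_one_le (n := n) ha hp0 (by linarith [(abs_le.1 hp).2])
    have h3 := (abs_nonneg _).trans h2
    have h4 := le_abs_self (p ^ n - 1)
    rw [h1, one_pow]
    rw [← hc] at h2 h3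
    rcases max_choice p (-q) with h | h <;> rw [h]
    · linarith [hmax p hp0]
    · linarith [hmax (-q) (by linarith)]

end Numeric

section Polar

theorem volume_eq_lintegral_toSphere {F : Type*} [NormedAddCommGroup F] [InnerProductSpace ℝ F]
    [FiniteDimensional ℝ F] [MeasurableSpace F] [BorelSpace F] [Nontrivial F] {A : Set F}
    (hA : MeasurableSet A) :
    volume A = ∫⁻ x : sphere (0 : F) 1,
      Measure.volumeIoiPow (Module.finrank ℝ F - 1) {t | (t : ℝ) • (x : F) ∈ A}
        ∂(volume : Measure F).toSphere := by
  have hmp := (volume : Measure F).measurePreserving_homeomorphUnitSphereProd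
  let e := (homeomorphUnitSphereProd F).toMeasurableEquiv
  have hpre : MeasurableSet (e.symm ⁻¹' (Subtype.val ⁻¹' A)) :=
    e.symm.measurable (measurable_subtype_coe hA)
  calc volume A = volume (A \ {0}) := (measure_sdiff_null (measure_singleton 0)).symm
    _ = (volume : Measure F).comap (Subtype.val : ({0}ᶜ : Set F) → F) (Subtype.val ⁻¹' A) := by
      rw [comap_subtype_coe_apply (measurableSet_singleton _).compl,
        Subtype.image_preimage_coe, Set.inter_comm, Set.sdiff_eq]
    _ = ((volume : Measure F).toSphere.prod (Measure.volumeIoiPow (Module.finrank ℝ F - 1)))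
        (e.symm ⁻¹' (Subtype.val ⁻¹' A)) := by
      rw [← hmp.measure_preimage hpre.nullMeasurableSet]
      congr 1
      ext z
      simp [e]
    _ = _ := by
      rw [Measure.prod_apply hpre]
      rfl

theorem volumeIoiPow_le_of_forall_lt {k : ℕ} {T : Set (Set.Ioi (0 : ℝ))} {b : ℝ} (hb : 0 < b)
    (hT : ∀ t ∈ T, (t : ℝ) < b) :
    Measure.volumeIoiPow k T ≤ ENNReal.ofReal (b ^ (k + 1) / (k + 1)) := by
  rw [← Measure.volumeIoiPow_apply_Iio k ⟨b, hb⟩]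
  exact measure_mono fun t ht => hT t ht

theorem volumeIoiPow_le_of_forall_mem_Ico {k : ℕ} {T : Set (Set.Ioi (0 : ℝ))} {a b : ℝ}
    (ha : 0 < a) (hab : a ≤ b) (hT : ∀ t ∈ T, (t : ℝ) ∈ Set.Ico a b) :
    Measure.volumeIoiPow k T ≤ ENNReal.ofReal ((b ^ (k + 1) - a ^ (k + 1)) / (k + 1)) := by
  have hsub : Set.Iio (⟨a, ha⟩ : Set.Ioi (0 : ℝ)) ⊆ Set.Iio ⟨b, ha.trans_le hab⟩ :=
    Set.Iio_subset_Iio hab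
  calc Measure.volumeIoiPow k T
      ≤ Measure.volumeIoiPow k (Set.Iio ⟨b, ha.trans_le hab⟩ \ Set.Iio ⟨a, ha⟩) :=
        measure_mono fun t ht => ⟨(hT t ht).2, not_lt.2 (hT t ht).1⟩
    _ = _ := by
      rw [measure_sdiff hsub measurableSet_Iio.nullMeasurableSet
          (by rw [Measure.volumeIoiPow_apply_Iio]; exact ENNReal.ofReal_ne_top),
        Measure.volumeIoiPow_apply_Iio, Measure.volumeIoiPow_apply_Iio,
        ← ENNReal.ofReal_sub _ (by positivity), sub_div]

end Polar

section Sections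

variable {F : Type*} [NormedAddCommGroup F] [NormedSpace ℝ F] {E : Set F} {u : F → ℝ}

theorem volumeIoiPow_symmDiff_ball_le_of_pos {n : ℕ} (hn : 0 < n) (hopen : IsOpen E)
    (hbd : IsBounded E)
    (hbdry : frontier E = (fun x => (1 + u x) • x) '' sphere (0 : F) 1)
    (hu : ContinuousOn u (sphere (0 : F) 1))
    {x : F} (hx : x ∈ sphere (0 : F) 1) (hp : 0 < 1 + u x) (hq : 0 < 1 + u (-x)) :
    Measure.volumeIoiPow (n - 1) {t | (t : ℝ) • x ∈ E ∆ ball (0 : F) 1} ≤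
      ENNReal.ofReal (|(1 + u x) ^ n - 1| / n) := by
  obtain ⟨k, rfl⟩ := Nat.exists_eq_add_of_le' hn
  have hxn : ‖x‖ = 1 := by simpa using hx
  have hball : ∀ t : Set.Ioi (0 : ℝ), (t : ℝ) • x ∈ ball (0 : F) 1 ↔ (t : ℝ) < 1 := fun t => by
    rw [mem_ball_zero_iff, norm_smul, hxn, mul_one, Real.norm_of_nonneg (le_of_lt t.2)]
  have hE : ∀ t : Set.Ioi (0 : ℝ), (t : ℝ) • x ∈ E ↔ (t : ℝ) < 1 + u x := fun t => by
    refine ⟨fun h => ?_, fun h => smul_mem_of_lt hopen hbd hbdry hu hx hq t.2 h⟩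
    have := lt_max_of_smul_mem hopen hbd hbdry hx t.2 h
    rwa [max_eq_left (by linarith)] at this
  simp only [Set.mem_symmDiff, hball, hE, not_lt, Nat.add_sub_cancel, Nat.cast_add, Nat.cast_one]
  rcases le_total 1 (1 + u x) with h | h
  · rw [abs_of_nonneg (sub_nonneg.2 (one_le_pow₀ h))]
    have := volumeIoiPow_le_of_forall_mem_Ico (k := k) one_pos h
      (T := {t | (t : ℝ) < 1 + u x ∧ 1 ≤ (t : ℝ) ∨ (t : ℝ) < 1 ∧ 1 + u x ≤ t}) (by
        rintro t (ht | ht)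
        · exact ⟨ht.2, ht.1⟩
        · linarith [ht.1, ht.2])
    rwa [one_pow] at this
  · rw [abs_sub_comm, abs_of_nonneg (sub_nonneg.2 (pow_le_one₀ hp.le h))]
    have := volumeIoiPow_le_of_forall_mem_Ico (k := k) hp h
      (T := {t | (t : ℝ) < 1 + u x ∧ 1 ≤ (t : ℝ) ∨ (t : ℝ) < 1 ∧ 1 + u x ≤ t}) (by
        rintro t (ht | ht)
        · linarith [ht.1, ht.2]
        · exact ⟨ht.2, ht.1⟩)
    rwa [one_pow] at this

theorem volumeIoiPow_symmDiff_ball_le {n : ℕ} (hn : 0 < n) (hopen : IsOpen E)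
    (hbd : IsBounded E)
    (hbdry : frontier E = (fun x => (1 + u x) • x) '' sphere (0 : F) 1)
    {x : F} (hx : x ∈ sphere (0 : F) 1) :
    Measure.volumeIoiPow (n - 1) {t | (t : ℝ) • x ∈ E ∆ ball (0 : F) 1} ≤
      ENNReal.ofReal (max 1 (max (1 + u x) (-(1 + u (-x)))) ^ n / n) := by
  obtain ⟨k, rfl⟩ := Nat.exists_eq_add_of_le' hn
  have hxn : ‖x‖ = 1 := by simpa using hx
  simp only [Nat.add_sub_cancel, Nat.cast_add, Nat.cast_one]
  refine volumeIoiPow_le_of_forall_lt (lt_max_of_lt_left one_pos) fun t ht => ?_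
  rcases ht with ht | ht
  · exact lt_max_of_lt_right (lt_max_of_smul_mem hopen hbd hbdry hx t.2 ht.1)
  · have := ht.1
    rw [mem_ball_zero_iff, norm_smul, hxn, mul_one, Real.norm_of_nonneg (le_of_lt t.2)] at this
    exact lt_max_of_lt_left this

theorem volumeIoiPow_symmDiff_ball_add_neg_le {n : ℕ} (hn : 2 ≤ n) {a : ℝ} (ha : 0 < a)
    (hopen : IsOpen E) (hbd : IsBounded E)
    (hbdry : frontier E = (fun x => (1 + u x) • x) '' sphere (0 : F) 1)
    (hu : ContinuousOn u (sphere (0 : F) 1)) (hsup : ∀ x ∈ sphere (0 : F) 1, |u x| ≤ a)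
    {x : F} (hx : x ∈ sphere (0 : F) 1) :
    Measure.volumeIoiPow (n - 1) {t | (t : ℝ) • x ∈ E ∆ ball (0 : F) 1} +
        Measure.volumeIoiPow (n - 1) {t | (t : ℝ) • -x ∈ E ∆ ball (0 : F) 1} ≤
      ENNReal.ofReal (((1 + a) ^ n - 1) / a / n * (|u x| + |u (-x)|)) := by
  have hn0 : 0 < n := by omega
  have hx' : -x ∈ sphere (0 : F) 1 := by simpa using hx
  have hp := hsup x hx
  have hq := hsup (-x) hx'
  have hup : |u x| = |1 + u x - 1| := by rw [add_sub_cancel_left]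
  have huq : |u (-x)| = |1 + u (-x) - 1| := by rw [add_sub_cancel_left]
  by_cases hpos : 0 < 1 + u x ∧ 0 < 1 + u (-x)
  · have h1 := volumeIoiPow_symmDiff_ball_le_of_pos hn0 hopen hbd hbdry hu hx hpos.1 hpos.2
    have h2 := volumeIoiPow_symmDiff_ball_le_of_pos hn0 hopen hbd hbdry hu hx' hpos.2
      (by rw [neg_neg]; exact hpos.1)
    refine (add_le_add h1 h2).trans ?_
    rw [← ENNReal.ofReal_add (by positivity) (by positivity), ← add_div, div_mul_eq_mul_div]
    refine ENNReal.ofReal_le_ofReal (div_le_div_of_nonneg_right ?_ (Nat.cast_nonneg n))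
    rw [mul_add, hup, huq]
    exact add_le_add
      (abs_pow_sub_one_le ha hpos.1.le (by linarith [(abs_le.1 hp).2]))
      (abs_pow_sub_one_le ha hpos.2.le (by linarith [(abs_le.1 hq).2]))
  · have h1 := volumeIoiPow_symmDiff_ball_le hn0 hopen hbd hbdry hx
    have h2 := volumeIoiPow_symmDiff_ball_le hn0 hopen hbd hbdry hx'
    rw [neg_neg] at h2
    refine (add_le_add h1 h2).trans ?_
    rw [← ENNReal.ofReal_add (by positivity) (by positivity), ← add_div, div_mul_eq_mul_div]
    refine ENNReal.ofReal_le_ofReal (div_le_div_of_nonneg_right ?_ (Nat.cast_nonneg n))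
    rw [hup] at hp ⊢
    rw [huq] at hq ⊢
    rcases not_and_or.1 hpos with h | h
    · have := max_pow_add_max_pow_le hn ha hq hp (not_lt.1 h)
      linarith
    · exact max_pow_add_max_pow_le hn ha hp hq (not_lt.1 h)

end Sections

section HausdorffSphere

theorem lintegral_hausdorffMeasure_sphere {F : Type*} [NormedAddCommGroup F] [MeasurableSpace F]
    [BorelSpace F] {d : ℝ} (hd : 0 ≤ d) (f : F → ℝ≥0∞) :
    ∫⁻ x : sphere (0 : F) 1, f x ∂μH[d] = ∫⁻ x in sphere (0 : F) 1, f x ∂μH[d] := by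
  have hemb : MeasurableEmbedding (Subtype.val : sphere (0 : F) 1 → F) :=
    MeasurableEmbedding.subtype_coe isClosed_sphere.measurableSet
  have hmap := (isometry_subtype_coe (s := sphere (0 : F) 1)).map_hausdorffMeasure (Or.inl hd)
  rw [Subtype.range_coe] at hmap
  rw [← hmap, hemb.lintegral_map]

theorem lintegral_hausdorffMeasure_sphere_neg {F : Type*} [NormedAddCommGroup F]
    [MeasurableSpace F] [BorelSpace F] (d : ℝ) (f : sphere (0 : F) 1 → ℝ≥0∞) :
    ∫⁻ x : sphere (0 : F) 1, f (-x) ∂μH[d] = ∫⁻ x, f x ∂μH[d] := by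
  let e : sphere (0 : F) 1 ≃ᵢ sphere (0 : F) 1 :=
    ⟨Equiv.neg _, Isometry.of_dist_eq fun x y => by
      simp [Subtype.dist_eq, dist_neg_neg]⟩
  exact (e.measurePreserving_hausdorffMeasure d).lintegral_comp_emb
    e.toHomeomorph.measurableEmbedding f

/-- Any measurable set whose radial sections in opposite directions are jointly controlled by
`f x + f (-x)` has volume at most the integral of `f` against the Hausdorff measure. -/
theorem volume_le_lintegral_hausdorffMeasure {F : Type*} [NormedAddCommGroup F]
    [InnerProductSpace ℝ F] [FiniteDimensional ℝ F] [MeasurableSpace F] [BorelSpace F]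
    [Nontrivial F] {A : Set F} (hA : MeasurableSet A) {f : sphere (0 : F) 1 → ℝ≥0∞}
    (hf : Measurable f)
    (h : ∀ x : sphere (0 : F) 1,
      Measure.volumeIoiPow (Module.finrank ℝ F - 1) {t | (t : ℝ) • (x : F) ∈ A} +
          Measure.volumeIoiPow (Module.finrank ℝ F - 1) {t | (t : ℝ) • -(x : F) ∈ A} ≤
        (Module.finrank ℝ F : ℝ≥0∞)⁻¹ * (f x + f (-x))) :
    volume A ≤ ∫⁻ x, f x ∂μH[(Module.finrank ℝ F : ℝ) - 1] := by
  set d := Module.finrank ℝ F with hd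
  have hd0 : (d : ℝ≥0∞) ≠ 0 := by simpa using (Module.finrank_pos (R := ℝ) (M := F)).ne'
  have hdt : (d : ℝ≥0∞) ≠ ⊤ := ENNReal.natCast_ne_top d
  have hpre : MeasurableSet {p : sphere (0 : F) 1 × Set.Ioi (0 : ℝ) | (p.2 : ℝ) • (p.1 : F) ∈ A} :=
    (by fun_prop : Measurable fun p : sphere (0 : F) 1 × Set.Ioi (0 : ℝ) =>
      (p.2 : ℝ) • (p.1 : F)) hA
  have hmeas : Measurable fun x : sphere (0 : F) 1 =>
      Measure.volumeIoiPow (d - 1) {t | (t : ℝ) • (x : F) ∈ A} :=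
    measurable_measure_prodMk_left hpre
  have hneg : volume A = ∫⁻ x : sphere (0 : F) 1,
      Measure.volumeIoiPow (d - 1) {t | (t : ℝ) • -(x : F) ∈ A}
        ∂(volume : Measure F).toSphere := by
    rw [← Measure.measure_neg volume A, volume_eq_lintegral_toSphere hA.neg]
    simp only [Set.mem_neg, smul_neg, ← hd]
  have htwo : 2 * volume A ≤ 2 * ∫⁻ x, f x ∂μH[(d : ℝ) - 1] := by
    calc 2 * volume A = volume A + volume A := two_mul _
      _ = ∫⁻ x : sphere (0 : F) 1,
          (Measure.volumeIoiPow (d - 1) {t | (t : ℝ) • (x : F) ∈ A} +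
            Measure.volumeIoiPow (d - 1) {t | (t : ℝ) • -(x : F) ∈ A})
            ∂(volume : Measure F).toSphere := by
        rw [lintegral_add_left hmeas, ← hneg, ← volume_eq_lintegral_toSphere hA]
      _ ≤ ∫⁻ x : sphere (0 : F) 1, (d : ℝ≥0∞)⁻¹ * (f x + f (-x))
            ∂(volume : Measure F).toSphere := lintegral_mono h
      _ ≤ ∫⁻ x : sphere (0 : F) 1, (d : ℝ≥0∞)⁻¹ * (f x + f (-x))
            ∂((d : ℝ≥0∞) • μH[(d : ℝ) - 1]) :=
        lintegral_mono' toSphere_le_finrank_smul_hausdorffMeasure le_rfl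
      _ = ∫⁻ x : sphere (0 : F) 1, (f x + f (-x)) ∂μH[(d : ℝ) - 1] := by
        rw [lintegral_smul_measure, lintegral_const_mul' _ _ (ENNReal.inv_ne_top.2 hd0),
          smul_eq_mul, ← mul_assoc, ENNReal.mul_inv_cancel hd0 hdt, one_mul]
      _ = 2 * ∫⁻ x, f x ∂μH[(d : ℝ) - 1] := by
        rw [lintegral_add_left hf, lintegral_hausdorffMeasure_sphere_neg, two_mul]
  exact (ENNReal.mul_le_mul_iff_right two_ne_zero ENNReal.ofNat_ne_top).1 htwo

end HausdorffSphere

section Asymmetry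

theorem matchRad_eq_one {n : ℕ} {E : Set (EuclideanSpace ℝ (Fin n))}
    (hvol : volume E = volume (ball (0 : EuclideanSpace ℝ (Fin n)) 1)) : matchRad n E = 1 := by
  have hpos : 0 < (volume (ball (0 : EuclideanSpace ℝ (Fin n)) 1)).toReal :=
    ENNReal.toReal_pos (measure_ball_pos _ _ one_pos).ne' measure_ball_lt_top.ne
  rw [matchRad, hvol, div_self hpos.ne', Real.one_rpow]

end Asymmetry

/-- If `E ⊆ ℝⁿ` is open and bounded with `|E| = ω_n`, barycenter at the origin, and boundary
`∂E = {(1 + u(x)) x : x ∈ ∂B}` for a Lipschitz function `u` with `‖u‖_{L^∞(∂B)} ≤ a`, then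
`λ₀(E) ≤ ((1+a)ⁿ - 1)/(ω_n a) · ‖u‖_{L¹(∂B)}`, the surface integrals being taken with respect
to the `(n-1)`-dimensional Hausdorff measure on the unit sphere. -/
theorem barAsym_le_of_boundary_graph
    (n : ℕ) (hn : 2 ≤ n) (a : ℝ) (ha : 0 < a)
    (E : Set (EuclideanSpace ℝ (Fin n))) (u : EuclideanSpace ℝ (Fin n) → ℝ)
    (hopen : IsOpen E) (hbd : IsBounded E)
    (hvol : volume E = volume (ball (0 : EuclideanSpace ℝ (Fin n)) 1))
    (hbar : barycenter n E = 0)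
    (hbdry : frontier E
      = (fun x => (1 + u x) • x) '' sphere (0 : EuclideanSpace ℝ (Fin n)) 1)
    (hLip : ∃ K : NNReal, LipschitzOnWith K u (sphere (0 : EuclideanSpace ℝ (Fin n)) 1))
    (hsup : ∀ x ∈ sphere (0 : EuclideanSpace ℝ (Fin n)) 1, |u x| ≤ a) :
    barAsym n E
      ≤ ((1 + a) ^ n - 1) / ((volume (ball (0 : EuclideanSpace ℝ (Fin n)) 1)).toReal * a)
        * ∫ x in sphere (0 : EuclideanSpace ℝ (Fin n)) 1, |u x| ∂(μH[(n : ℝ) - 1]) := by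
  have hn0 : 0 < n := by omega
  have hω : 0 < (volume (ball (0 : EuclideanSpace ℝ (Fin n)) 1)).toReal :=
    ENNReal.toReal_pos (measure_ball_pos _ _ one_pos).ne' measure_ball_lt_top.ne
  have : Nonempty (Fin n) := ⟨⟨0, hn0⟩⟩
  obtain ⟨K, hK⟩ := hLip
  have hu := hK.continuousOn
  have hfr : Module.finrank ℝ (EuclideanSpace ℝ (Fin n)) = n := finrank_euclideanSpace_fin
  have hd : (0 : ℝ) ≤ (n : ℝ) - 1 := by
    have : (2 : ℝ) ≤ n := by exact_mod_cast hn
    linarith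
  set c : ℝ := ((1 + a) ^ n - 1) / a with hc
  have hc0 : 0 ≤ c := div_nonneg (sub_nonneg.2 (one_le_pow₀ (by linarith))) ha.le
  have hmeasA : MeasurableSet (E ∆ ball (0 : EuclideanSpace ℝ (Fin n)) 1) :=
    hopen.measurableSet.symmDiff measurableSet_ball
  have hcont : Continuous fun x : sphere (0 : EuclideanSpace ℝ (Fin n)) 1 => c * |u x| :=
    (hu.domRestrict.abs).const_mul c
  have hvolA : volume (E ∆ ball (0 : EuclideanSpace ℝ (Fin n)) 1) ≤
      ∫⁻ x in sphere (0 : EuclideanSpace ℝ (Fin n)) 1, ENNReal.ofReal (c * |u x|)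
        ∂μH[(n : ℝ) - 1] := by
    rw [← lintegral_hausdorffMeasure_sphere hd fun x => ENNReal.ofReal (c * |u x|)]
    have := volume_le_lintegral_hausdorffMeasure hmeasA hcont.measurable.ennreal_ofReal
    rw [hfr] at this
    refine this fun x => ?_
    refine (volumeIoiPow_symmDiff_ball_add_neg_le hn ha hopen hbd hbdry hu hsup x.2).trans_eq ?_
    rw [← ENNReal.ofReal_add (by positivity) (by positivity), ← ENNReal.ofReal_natCast,
      ← ENNReal.ofReal_inv_of_pos (by exact_mod_cast hn0),
      ← ENNReal.ofReal_mul (by positivity), ← hc, ← mul_add, ← mul_assoc, inv_mul_eq_div]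
    rfl
  have hint : IntegrableOn (fun x => c * |u x|) (sphere (0 : EuclideanSpace ℝ (Fin n)) 1)
      (μH[(n : ℝ) - 1]) := by
    refine Integrable.const_mul ?_ c
    refine IntegrableOn.of_bound (hausdorffMeasure_sphere_lt_top n)
      (hu.abs.aestronglyMeasurable isClosed_sphere.measurableSet) a ?_
    filter_upwards [ae_restrict_mem isClosed_sphere.measurableSet] with x hx
    simpa using hsup x hx
  have hreal : (volume (E ∆ ball (0 : EuclideanSpace ℝ (Fin n)) 1)).toReal ≤
      c * ∫ x in sphere (0 : EuclideanSpace ℝ (Fin n)) 1, |u x| ∂(μH[(n : ℝ) - 1]) := by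
    rw [← integral_const_mul]
    refine ENNReal.toReal_le_of_le_ofReal (integral_nonneg fun x => by positivity) ?_
    rwa [ofReal_integral_eq_lintegral_ofReal hint (ae_of_all _ fun x => by positivity)]
  rw [barAsym, hbar, matchRad_eq_one hvol, hvol, div_le_iff₀ hω]
  refine hreal.trans_eq ?_
  rw [hc]
  field_simp
end
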